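/- There exists a universal constant C > 0 such that for every μ ∈ (0,1), setting δ := μ^C, k := ⌈C·log(1/μ)⌉ and d := ⌈C·log(1/μ)⌉ (with C chosen so that k < 3^{(2d+1)/2}/2), the following holds for all r ≥ d: for all functions A, B : P_{r,2d} → [0,1], if E[A] > μ, E[B] > μ, and E[A(f)·B(f + a(p²+1))] ≤ δ — where f is uniform on P_{r,2d}, p is uniform on P_{r,d}, and a is uniform on {1,2}, all independent — then there exists x ∈ F₃^r such that Inf_x^{≤k}(A) ≥ δ and Inf_x^{≤k}(B) ≥ δ. -/

import Mathlib

open scoped BigOperators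

abbrev F3 := ZMod 3
abbrev Pt (r : ℕ) := Fin r → F3
abbrev Fn (r : ℕ) := Pt r → F3

/-- The set of functions `F₃^r → F₃` computed by polynomials of total degree at most `d`
with individual degrees at most `2`. -/
def PolySet (r d : ℕ) : Set (Fn r) :=
  {g | ∃ P : MvPolynomial (Fin r) F3,
        P.totalDegree ≤ d ∧ (∀ i, P.degreeOf i ≤ 2) ∧
        ∀ x, g x = MvPolynomial.eval x P}

noncomputable def polyFinset (r d : ℕ) : Finset (Fn r) :=
  (Set.toFinite (PolySet r d)).toFinset

/-- Support size `|β|`. -/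
def supp {r : ℕ} (β : Fn r) : ℕ := (Finset.univ.filter fun x => β x ≠ 0).card

/-- Dot product `⟨β, f⟩ = Σ_x β(x) f(x)` in `F₃`. -/
def dotF {r : ℕ} (β f : Fn r) : F3 := ∑ x, β x * f x

noncomputable def ω : ℂ := Complex.exp (2 * (Real.pi : ℂ) * Complex.I / 3)

/-- The character `χ_β(f) = ω^{⟨β,f⟩}`. -/
noncomputable def chi {r : ℕ} (β f : Fn r) : ℂ := ω ^ (dotF β f).val

/-- The dual `S^⊥` of a set of functions. -/
def dualSet (r : ℕ) (S : Set (Fn r)) : Set (Fn r) := {g | ∀ h ∈ S, dotF g h = 0}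

/-- `Λ` contains exactly one representative, of minimal support size, from each coset
of `𝔉_r` modulo `P_{r,d}^⊥`. -/
def IsMinRepSet (r d : ℕ) (Λ : Finset (Fn r)) : Prop :=
  (∀ β : Fn r, ∃! β', β' ∈ Λ ∧ β - β' ∈ dualSet r (PolySet r d)) ∧
  (∀ β' ∈ Λ, ∀ γ : Fn r, β' - γ ∈ dualSet r (PolySet r d) → supp β' ≤ supp γ)

/-- The noise `a·(p² + 1)` (pointwise). -/
def shift {r : ℕ} (p : Fn r) (a : F3) : Fn r := fun x => a * (p x ^ 2 + 1)

/-- Fourier coefficient `Â(β)` of a function on `P_{r,d}`. -/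
noncomputable def fourierP (r d : ℕ) (A : Fn r → ℂ) (β : Fn r) : ℂ :=
  (∑ g ∈ polyFinset r d, A g * (starRingEnd ℂ) (chi β g)) / ((polyFinset r d).card : ℂ)

/-- Expectation `E_{f ∈ P_{r,d}}[A(f)]`. -/
noncomputable def expP (r d : ℕ) (A : Fn r → ℝ) : ℝ :=
  (∑ f ∈ polyFinset r d, A f) / ((polyFinset r d).card : ℝ)

/-- Degree-`k` influence `Inf_x^{≤k}(A)` with respect to a set `Λ` of minimal-support
coset representatives. -/
noncomputable def infP (r d k : ℕ) (Λ : Finset (Fn r)) (A : Fn r → ℝ) (x : Pt r) : ℝ :=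
  ∑ β ∈ Λ.filter (fun β => β x ≠ 0 ∧ supp β ≤ k),
    ‖fourierP r d (fun g => (A g : ℂ)) β‖ ^ 2

open scoped BigOperators
namespace S5
open Finset

/-! ### The additive character -/

noncomputable def ee (c : F3) : ℂ := ω ^ c.val

lemma omega_cube : ω ^ 3 = 1 := by
  unfold ω
  rw [← Complex.exp_nat_mul]
  rw [show ((3:ℕ):ℂ) * (2 * (Real.pi : ℂ) * Complex.I / 3) = 2 * Real.pi * Complex.I by push_cast; ring]
  exact Complex.exp_two_pi_mul_I

lemma omega_ne_one : ω ≠ 1 := by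
  have h := (Complex.isPrimitiveRoot_exp 3 (by norm_num)).ne_one (by norm_num)
  unfold ω; exact_mod_cast h

lemma omega_sum : 1 + ω + ω ^ 2 = 0 := by
  have h : (ω - 1) * (1 + ω + ω ^ 2) = 0 := by
    linear_combination omega_cube
  rcases mul_eq_zero.1 h with h | h
  · exact absurd (sub_eq_zero.1 h) omega_ne_one
  · exact h

lemma ee_zero : ee 0 = 1 := by simp [ee]

lemma ee_one : ee 1 = ω := by
  simp only [ee]; rw [show (1 : F3).val = 1 from rfl, pow_one]

lemma ee_two : ee 2 = ω ^ 2 := by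
  simp only [ee]; rw [show (2 : F3).val = 2 from rfl]

lemma ee_add (a b : F3) : ee (a + b) = ee a * ee b := by
  unfold ee
  rw [← pow_add, ZMod.val_add]
  conv_rhs => rw [← Nat.mod_add_div (a.val + b.val) 3, pow_add, pow_mul, omega_cube]
  simp

lemma norm_omega : ‖ω‖ = 1 := by
  have : ‖ω‖ ^ 3 = 1 := by rw [← norm_pow, omega_cube]; simp
  exact (pow_eq_one_iff_of_nonneg (norm_nonneg _) (by norm_num)).1 this

lemma norm_ee (a : F3) : ‖ee a‖ = 1 := by
  unfold ee; rw [norm_pow, norm_omega, one_pow]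

lemma ee_neg (a : F3) : ee (-a) = (starRingEnd ℂ) (ee a) := by
  have h1 : ee (-a) * ee a = 1 := by rw [← ee_add]; simp [ee_zero]
  have h2 : (starRingEnd ℂ) (ee a) * ee a = 1 := by
    rw [mul_comm, Complex.mul_conj, Complex.normSq_eq_norm_sq, norm_ee]; simp
  have h3 : ee a ≠ 0 := by
    intro h; have := norm_ee a; rw [h] at this; simp at this
  exact mul_right_cancel₀ h3 (h1.trans h2.symm)

lemma ee_eq_one {a : F3} (h : ee a = 1) : a = 0 := by
  have h2 : ω ^ 2 ≠ 1 := by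
    intro h2
    have := omega_cube
    rw [pow_succ, h2, one_mul] at this
    exact omega_ne_one this
  have h3 : a = 0 ∨ a = 1 ∨ a = 2 := by clear h; revert a; decide
  rcases h3 with h3 | h3 | h3
  · exact h3
  · rw [h3, ee_one] at h; exact absurd h omega_ne_one
  · rw [h3, ee_two] at h; exact absurd h h2

/-- Average of a character of a finite group. -/
lemma expect_ee {G : Type*} [AddCommGroup G] [Fintype G] (φ : G → F3)
    (hφ : ∀ a b, φ (a + b) = φ a + φ b) [Decidable (∀ g, φ g = 0)] :
    𝔼 g, ee (φ g) = if ∀ g, φ g = 0 then 1 else 0 := by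
  split_ifs with h
  · simp [h, ee_zero]
  · push Not at h
    obtain ⟨g0, hg0⟩ := h
    have h1 : 𝔼 g, ee (φ g) = 𝔼 g, ee (φ (g + g0)) :=
      (Fintype.expect_equiv (Equiv.addRight g0) _ _ (fun x => rfl)).symm
    have h2 : 𝔼 g, ee (φ (g + g0)) = (𝔼 g, ee (φ g)) * ee (φ g0) := by
      rw [expect_mul]; simp only [hφ, ee_add]
    rw [h2] at h1
    have h3 : (𝔼 g, ee (φ g)) * (ee (φ g0) - 1) = 0 := by
      rw [mul_sub, ← h1]; ring
    rcases mul_eq_zero.1 h3 with h | h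
    · exact h
    · exact absurd (ee_eq_one (sub_eq_zero.1 h)) hg0

/-! ### Dot products and characters -/
section
variable {r : ℕ}

lemma dotF_add_right (β f g : Fn r) : dotF β (f + g) = dotF β f + dotF β g := by
  simp [dotF, mul_add, sum_add_distrib]
lemma dotF_add_left (β f g : Fn r) : dotF (β + f) g = dotF β g + dotF f g := by
  simp [dotF, add_mul, sum_add_distrib]
lemma dotF_neg_left (β g : Fn r) : dotF (-β) g = - dotF β g := by
  simp [dotF]
lemma dotF_neg_right (β g : Fn r) : dotF β (-g) = - dotF β g := by
  simp [dotF]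
lemma dotF_sub_left (β f g : Fn r) : dotF (β - f) g = dotF β g - dotF f g := by
  rw [sub_eq_add_neg, dotF_add_left, dotF_neg_left, sub_eq_add_neg]
lemma dotF_smul_left (c : F3) (β g : Fn r) : dotF (c • β) g = c * dotF β g := by
  simp [dotF, mul_sum, mul_assoc]
lemma dotF_smul_right (c : F3) (β g : Fn r) : dotF β (c • g) = c * dotF β g := by
  simp only [dotF, mul_sum, Pi.smul_apply, smul_eq_mul]
  exact sum_congr rfl fun x _ => by ring
lemma dotF_zero_left (g : Fn r) : dotF 0 g = 0 := by simp [dotF]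
lemma dotF_zero_right (g : Fn r) : dotF g 0 = 0 := by simp [dotF]
lemma dotF_mul (β v g : Fn r) : dotF (β * v) g = dotF β (v * g) := by
  simp [dotF, mul_assoc]

lemma chi_eq (β f : Fn r) : chi β f = ee (dotF β f) := rfl
lemma chi_add_right (β f g : Fn r) : chi β (f + g) = chi β f * chi β g := by
  simp only [chi_eq, dotF_add_right, ee_add]
lemma chi_add_left (β f g : Fn r) : chi (β + f) g = chi β g * chi f g := by
  simp only [chi_eq, dotF_add_left, ee_add]
lemma chi_neg_left (β g : Fn r) : chi (-β) g = (starRingEnd ℂ) (chi β g) := by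
  simp only [chi_eq, dotF_neg_left, ee_neg]
lemma chi_neg_right (β g : Fn r) : chi β (-g) = (starRingEnd ℂ) (chi β g) := by
  simp only [chi_eq, dotF_neg_right, ee_neg]
lemma norm_chi (β f : Fn r) : ‖chi β f‖ = 1 := norm_ee _
lemma chi_zero_left (g : Fn r) : chi 0 g = 1 := by simp [chi_eq, dotF_zero_left, ee_zero]
lemma chi_zero_right (g : Fn r) : chi g 0 = 1 := by simp [chi_eq, dotF_zero_right, ee_zero]
lemma chi_mul_conj (β f : Fn r) : chi β f * (starRingEnd ℂ) (chi β f) = 1 := by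
  rw [Complex.mul_conj, Complex.normSq_eq_norm_sq, norm_chi]; simp

/-- annihilator -/
def perp (V : Submodule F3 (Fn r)) : Submodule F3 (Fn r) where
  carrier := {g | ∀ h ∈ V, dotF g h = 0}
  add_mem' := by
    intro a b ha hb h hh
    rw [dotF_add_left, ha h hh, hb h hh, add_zero]
  zero_mem' := fun h _ => dotF_zero_left h
  smul_mem' := by
    intro c a ha h hh
    rw [dotF_smul_left, ha h hh, mul_zero]

lemma mem_perp {V : Submodule F3 (Fn r)} {g : Fn r} : g ∈ perp V ↔ ∀ h ∈ V, dotF g h = 0 := Iff.rfl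

end

/-- degree-one functions -/
def P1 (r : ℕ) : Submodule F3 (Fn r) :=
  Submodule.span F3 (insert 1 (Set.range fun i => fun x : Pt r => x i))

def P (r D : ℕ) : Submodule F3 (Fn r) := P1 r ^ D

def dl (r D : ℕ) : Submodule F3 (Fn r) := perp (P r D)

section
variable {r : ℕ}

lemma one_mem_P1 : (1 : Fn r) ∈ P1 r := Submodule.subset_span (Set.mem_insert _ _)
lemma coord_mem_P1 (i : Fin r) : (fun x : Pt r => x i) ∈ P1 r :=
  Submodule.subset_span (Set.mem_insert_of_mem _ ⟨i, rfl⟩)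

lemma const_mem_P1 (c : F3) : (fun _ => c : Fn r) ∈ P1 r := by
  have := (P1 r).smul_mem c (one_mem_P1 (r := r))
  convert this using 1
  ext x; simp

lemma one_le_P1 : (1 : Submodule F3 (Fn r)) ≤ P1 r := Submodule.one_le.2 one_mem_P1

lemma P_mono {D E : ℕ} (h : D ≤ E) : P r D ≤ P r E := by
  obtain ⟨k, rfl⟩ := Nat.exists_eq_add_of_le h
  unfold P
  rw [pow_add]
  calc P1 r ^ D = P1 r ^ D * 1 := (mul_one _).symm
    _ ≤ _ := by
      exact mul_le_mul_right (by
        calc (1 : Submodule F3 (Fn r)) = 1 ^ k := (one_pow k).symm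
          _ ≤ _ := pow_le_pow_left' one_le_P1 k) _

lemma P_one : P r 1 = P1 r := pow_one _
lemma one_mem_P (D : ℕ) : (1 : Fn r) ∈ P r D := by
  apply P_mono (Nat.zero_le D)
  unfold P; rw [pow_zero]; exact Submodule.one_le.1 le_rfl
lemma P_mul {D E : ℕ} {f g : Fn r} (hf : f ∈ P r D) (hg : g ∈ P r E) : f * g ∈ P r (D + E) := by
  unfold P at *; rw [pow_add]; exact Submodule.mul_mem_mul hf hg
lemma P_mul_le {D E F : ℕ} {f g : Fn r} (hf : f ∈ P r D) (hg : g ∈ P r E) (h : D + E ≤ F) :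
    f * g ∈ P r F := P_mono h (P_mul hf hg)
lemma dl_anti {D E : ℕ} (h : D ≤ E) : dl r E ≤ dl r D := fun _ hg p hp => hg p (P_mono h hp)
lemma dl_mul {D E F : ℕ} {η v : Fn r} (hη : η ∈ dl r F) (hv : v ∈ P r E) (h : E + D ≤ F) :
    η * v ∈ dl r D := by
  intro p hp
  rw [dotF_mul]; exact hη _ (P_mul_le hv hp h)

lemma F3_cube (a : F3) : a ^ 3 = a := by revert a; decide


/-! ### Identification of `PolySet` with powers of `P1` -/

lemma PolySet_add {D : ℕ} {f g : Fn r} (hf : f ∈ PolySet r D) (hg : g ∈ PolySet r D) :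
    f + g ∈ PolySet r D := by
  obtain ⟨p, h1, h2, h3⟩ := hf
  obtain ⟨q, h4, h5, h6⟩ := hg
  refine ⟨p + q, (MvPolynomial.totalDegree_add _ _).trans (max_le h1 h4), fun i =>
    (MvPolynomial.degreeOf_add_le _ _ _).trans (max_le (h2 i) (h5 i)), fun x => ?_⟩
  simp [h3, h6]

lemma PolySet_zero {D : ℕ} : (0 : Fn r) ∈ PolySet r D :=
  ⟨0, by simp, by simp, by simp⟩

lemma red_exists (e : ℕ) : ∃ e' : ℕ, e' ≤ e ∧ e' ≤ 2 ∧ ∀ x : F3, x ^ e = x ^ e' := by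
  induction e using Nat.strong_induction_on with
  | _ e ih =>
    by_cases he : e ≤ 2
    · exact ⟨e, le_rfl, he, fun _ => rfl⟩
    · push Not at he
      obtain ⟨e', h1, h2, h3⟩ := ih (e - 2) (by omega)
      refine ⟨e', by omega, h2, fun x => ?_⟩
      rw [← h3]
      have : e = (e - 3) + 3 := by omega
      rw [this, pow_add, F3_cube, ← pow_succ]
      congr 1

lemma PolySet_monomial {D : ℕ} (e : Fin r → ℕ) (he : ∑ i, e i ≤ D) (c : F3) :
    (fun x : Pt r => c * ∏ i, x i ^ e i) ∈ PolySet r D := by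
  choose φ h1 h2 h3 using red_exists
  refine ⟨MvPolynomial.monomial (Finsupp.equivFunOnFinite.symm (fun i => φ (e i))) c, ?_, ?_, ?_⟩
  · refine (MvPolynomial.totalDegree_monomial_le _ _).trans ?_
    rw [Finsupp.sum_fintype _ _ (by simp)]
    refine le_trans (sum_le_sum fun i _ => ?_) he
    simpa using h1 (e i)
  · intro i
    refine (MvPolynomial.degreeOf_le_iff).2 ?_
    intro m hm
    have := MvPolynomial.support_monomial_subset hm
    rw [mem_singleton] at this
    rw [this]; simpa using h2 (e i)
  · intro x
    rw [MvPolynomial.eval_monomial, Finsupp.prod_fintype _ _ (by simp)]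
    refine congrArg (c * ·) (prod_congr rfl fun i _ => ?_)
    simpa using h3 (e i) (x i)

lemma PolySet_of_eval {D : ℕ} (p : MvPolynomial (Fin r) F3) (hp : p.totalDegree ≤ D) :
    (fun x => MvPolynomial.eval x p) ∈ PolySet r D := by
  have : (fun x : Pt r => MvPolynomial.eval x p) =
      ∑ m ∈ p.support, fun x : Pt r => p.coeff m * ∏ i, x i ^ m i := by
    ext x; rw [MvPolynomial.eval_eq', Finset.sum_apply]
  rw [this]
  refine sum_induction _ (· ∈ PolySet r D) (fun a b => PolySet_add) PolySet_zero ?_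
  intro m hm
  refine PolySet_monomial _ ?_ _
  have := MvPolynomial.le_totalDegree hm
  rw [Finsupp.sum_fintype _ _ (by simp)] at this
  exact this.trans hp

lemma mem_P_of_PolySet {D : ℕ} {f : Fn r} (hf : f ∈ PolySet r D) : f ∈ P r D := by
  obtain ⟨p, h1, -, h3⟩ := hf
  have : f = ∑ m ∈ p.support, p.coeff m • ∏ i, (fun x : Pt r => x i) ^ m i := by
    ext x; rw [h3, MvPolynomial.eval_eq']; simp
  rw [this]
  refine Submodule.sum_mem _ fun m hm => Submodule.smul_mem _ _ ?_
  have h2 := MvPolynomial.le_totalDegree hm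
  rw [Finsupp.sum_fintype _ _ (by simp)] at h2
  refine P_mono (h2.trans h1) ?_
  have key : ∀ s : Finset (Fin r), ∏ i ∈ s, (fun x : Pt r => x i) ^ m i ∈ P r (∑ i ∈ s, m i) := by
    intro s
    induction s using Finset.induction_on with
    | empty => simpa using one_mem_P 0
    | insert a s ha ih =>
      rw [prod_insert ha, sum_insert ha]
      exact P_mul (Submodule.pow_mem_pow _ (coord_mem_P1 a) _) ih
  exact key univ

lemma P1_eval {f : Fn r} (hf : f ∈ P1 r) :
    ∃ p : MvPolynomial (Fin r) F3, p.totalDegree ≤ 1 ∧ f = fun x => MvPolynomial.eval x p := by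
  refine Submodule.span_induction ?_ ?_ ?_ ?_ hf
  · rintro g (rfl | ⟨i, rfl⟩)
    · exact ⟨1, by simp, by ext x; simp⟩
    · exact ⟨MvPolynomial.X i, by simp, by ext x; simp⟩
  · exact ⟨0, by simp, by ext x; simp⟩
  · rintro f g - - ⟨p, h1, rfl⟩ ⟨q, h2, rfl⟩
    exact ⟨p + q, (MvPolynomial.totalDegree_add _ _).trans (max_le h1 h2), by ext x; simp⟩
  · rintro c f - ⟨p, h1, rfl⟩
    exact ⟨c • p, (MvPolynomial.totalDegree_smul_le _ _).trans h1, by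
      ext x; simp [MvPolynomial.smul_eval]⟩

lemma P_eval {D : ℕ} {f : Fn r} (hf : f ∈ P r D) :
    ∃ p : MvPolynomial (Fin r) F3, p.totalDegree ≤ D ∧ f = fun x => MvPolynomial.eval x p := by
  induction D generalizing f with
  | zero =>
    unfold P at hf
    rw [pow_zero, Submodule.mem_one] at hf
    obtain ⟨c, rfl⟩ := hf
    exact ⟨MvPolynomial.C c, by simp, by ext x; simp⟩
  | succ n ih =>
    unfold P at hf
    rw [pow_succ] at hf
    refine Submodule.mul_induction_on hf ?_ ?_
    · intro a ha b hb
      obtain ⟨p, h1, rfl⟩ := ih ha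
      obtain ⟨q, h2, rfl⟩ := P1_eval hb
      exact ⟨p * q, (MvPolynomial.totalDegree_mul _ _).trans (add_le_add h1 h2), by ext x; simp⟩
    · rintro f g ⟨p, h1, rfl⟩ ⟨q, h2, rfl⟩
      exact ⟨p + q, (MvPolynomial.totalDegree_add _ _).trans (max_le h1 h2), by ext x; simp⟩

lemma mem_PolySet {D : ℕ} {f : Fn r} : f ∈ PolySet r D ↔ f ∈ P r D := by
  refine ⟨mem_P_of_PolySet, fun h => ?_⟩
  obtain ⟨p, h1, rfl⟩ := P_eval h
  exact PolySet_of_eval p h1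

lemma mem_polyFinset {D : ℕ} {f : Fn r} : f ∈ polyFinset r D ↔ f ∈ P r D := by
  rw [polyFinset, Set.Finite.mem_toFinset, mem_PolySet]

lemma mem_dualSet {D : ℕ} {f : Fn r} : f ∈ dualSet r (PolySet r D) ↔ f ∈ dl r D := by
  simp only [dualSet, Set.mem_ofPred_eq, mem_PolySet]; rfl

end
end S5

open scoped BigOperators
namespace S5
open Finset
section
variable {r : ℕ}

noncomputable instance subFintype (V : Submodule F3 (Fn r)) : Fintype V := Fintype.ofFinite _

/-- translation invariance -/
lemma expect_trans {E : Type*} [AddCommMonoid E] [Module ℚ≥0 E] {V : Submodule F3 (Fn r)} {y : Fn r} (hy : y ∈ V)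
    (F : Fn r → E) : 𝔼 f : V, F (f + y) = 𝔼 f : V, F f :=
  Fintype.expect_equiv (Equiv.addRight (⟨y, hy⟩ : V)) _ _ (fun x => rfl)

lemma expect_trans_top {E : Type*} [AddCommMonoid E] [Module ℚ≥0 E] (y : Fn r)
    (F : Fn r → E) : 𝔼 f : Fn r, F (f + y) = 𝔼 f : Fn r, F f :=
  Fintype.expect_equiv (Equiv.addRight y) _ _ (fun x => rfl)

open Classical in
lemma expect_chi (V : Submodule F3 (Fn r)) (γ : Fn r) :
    𝔼 f : V, chi γ f = if γ ∈ perp V then 1 else 0 := by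
  have h := expect_ee (fun f : V => dotF γ (f : Fn r))
    (fun a b => by simpa using dotF_add_right γ a b)
  simp only [chi_eq]
  rw [h]
  have : (∀ g : V, dotF γ (g : Fn r) = 0) ↔ γ ∈ perp V := by
    rw [mem_perp]; simp
  simp only [this]

/-- `1[Q]` as a real number -/
noncomputable def ind (Q : Prop) : ℝ := by classical exact if Q then 1 else 0

lemma ind_true {Q : Prop} (h : Q) : ind Q = 1 := by simp [ind, h]
lemma ind_false {Q : Prop} (h : ¬ Q) : ind Q = 0 := by simp [ind, h]
lemma ind_nonneg (Q : Prop) : 0 ≤ ind Q := by unfold ind; split_ifs <;> norm_num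
lemma ind_le_one (Q : Prop) : ind Q ≤ 1 := by unfold ind; split_ifs <;> norm_num
lemma ind_mono {Q R : Prop} (h : Q → R) : ind Q ≤ ind R := by
  by_cases hQ : Q
  · rw [ind_true hQ, ind_true (h hQ)]
  · rw [ind_false hQ]; exact ind_nonneg _
lemma ind_congr {Q R : Prop} (h : Q ↔ R) : ind Q = ind R := by rw [propext h]
lemma ind_sq (Q : Prop) : ind Q ^ 2 = ind Q := by unfold ind; split_ifs <;> norm_num

/-- A proper subset closed under differences has density at most 1/3. -/
lemma prob_proper {X : Type*} [AddCommGroup X] [Module F3 X] [Fintype X] (M : Submodule F3 X)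
    (x0 : X) (hx0 : x0 ∉ M) : 𝔼 x : X, ind (x ∈ M) ≤ 1 / 3 := by
  have key : ∀ x : X, ind (x ∈ M) + ind (x + x0 ∈ M) + ind (x + (2 : F3) • x0 ∈ M) ≤ 1 := by
    intro x
    have h2 : (2 : F3) • x0 ∉ M := fun h => hx0 (by
      have := M.smul_mem (2 : F3) h
      rwa [smul_smul, show (2 : F3) * 2 = 1 from rfl, one_smul] at this)
    by_cases h1 : x ∈ M
    · rw [ind_true h1, ind_false, ind_false]; · norm_num
      · exact fun h => h2 ((M.add_mem_iff_right h1).1 h)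
      · exact fun h => hx0 ((M.add_mem_iff_right h1).1 h)
    · rw [ind_false h1]
      by_cases h3 : x + x0 ∈ M
      · rw [ind_true h3, ind_false]; · norm_num
        intro h
        apply hx0
        have := M.sub_mem h h3
        rwa [add_sub_add_left_eq_sub, two_smul, add_sub_cancel_right] at this
      · rw [ind_false h3]; linarith [ind_le_one (x + (2 : F3) • x0 ∈ M)]
  have h1 : 𝔼 x : X, ind (x + x0 ∈ M) = 𝔼 x : X, ind (x ∈ M) :=
    Fintype.expect_equiv (Equiv.addRight x0) _ _ (fun x => rfl)
  have h2 : 𝔼 x : X, ind (x + (2 : F3) • x0 ∈ M) = 𝔼 x : X, ind (x ∈ M) :=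
    Fintype.expect_equiv (Equiv.addRight _) _ _ (fun x => rfl)
  have h3 : 𝔼 x : X, (ind (x ∈ M) + ind (x + x0 ∈ M) + ind (x + (2 : F3) • x0 ∈ M)) ≤ 1 :=
    (expect_le_expect fun x _ => key x).trans (by rw [expect_const univ_nonempty])
  rw [expect_add_distrib, expect_add_distrib, h1, h2] at h3
  linarith

/-- indicator functions of `{ℓ = a}` -/
def eqi (ℓ : Fn r) (a : F3) : Fn r := fun x => if ℓ x = a then 1 else 0

lemma eqi_eq (ℓ : Fn r) (a : F3) : eqi ℓ a = 1 - (ℓ - fun _ => a) * (ℓ - fun _ => a) := by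
  ext x
  simp only [eqi, Pi.sub_apply, Pi.one_apply, Pi.mul_apply]
  generalize ℓ x = b
  revert a b; decide

lemma eqi_mem {ℓ : Fn r} (hℓ : ℓ ∈ P1 r) (a : F3) : eqi ℓ a ∈ P r 2 := by
  rw [eqi_eq]
  have h : ℓ - (fun _ => a) ∈ P r 1 := by
    rw [P_one]; exact Submodule.sub_mem _ hℓ (const_mem_P1 a)
  exact Submodule.sub_mem _ (one_mem_P 2) (P_mul h h)

def sF (β : Fn r) : Finset (Pt r) := univ.filter fun x => β x ≠ 0
lemma mem_sF {β : Fn r} {x : Pt r} : x ∈ sF β ↔ β x ≠ 0 := by simp [sF]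
lemma supp_eq (β : Fn r) : supp β = (sF β).card := rfl
lemma supp_eq_zero {β : Fn r} : supp β = 0 ↔ β = 0 := by
  rw [supp_eq, card_eq_zero]
  constructor
  · intro h; ext x
    by_contra hx
    have : x ∈ sF β := mem_sF.2 hx
    rw [h] at this; simp at this
  · rintro rfl; ext x; simp [mem_sF]
lemma supp_add_le (β γ : Fn r) : supp (β + γ) ≤ supp β + supp γ := by
  rw [supp_eq, supp_eq, supp_eq]
  refine le_trans (card_le_card ?_) (card_union_le _ _)
  intro x
  rw [mem_union, mem_sF, mem_sF, mem_sF]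
  intro h; by_contra h2; push Not at h2; apply h; simp [h2.1, h2.2]
lemma supp_neg (β : Fn r) : supp (-β) = supp β := by simp [supp]
lemma supp_sub_le (β γ : Fn r) : supp (β - γ) ≤ supp β + supp γ := by
  rw [sub_eq_add_neg, ← supp_neg γ]; exact supp_add_le _ _

lemma interp_dual (q : ℕ) (γ : Fn r) (h0 : γ ≠ 0) (hs : supp γ < 2 ^ (q + 1)) :
    γ ∉ dl r (2 * q) := by
  induction q generalizing γ with
  | zero =>
    intro h
    have h1 : supp γ = 1 := by
      have : supp γ ≠ 0 := fun h => h0 (supp_eq_zero.1 h)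
      omega
    rw [supp_eq, card_eq_one] at h1
    obtain ⟨a, ha⟩ := h1
    have h2 := h 1 (one_mem_P _)
    have h3 : dotF γ 1 = γ a := by
      unfold dotF
      rw [sum_eq_single a]
      · simp
      · intro b _ hb
        have : b ∉ sF γ := by rw [ha]; simpa using hb
        rw [mem_sF] at this; push Not at this; simp [this]
      · simp
    rw [h3] at h2
    have : a ∈ sF γ := by rw [ha]; simp
    exact (mem_sF.1 this) h2
  | succ q ih =>
    intro h
    have hne : (sF γ).Nonempty := by
      rw [← card_pos, ← supp_eq]; exact Nat.pos_of_ne_zero fun h => h0 (supp_eq_zero.1 h)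
    have hsub : ∀ γ' : Fn r, γ' ≠ 0 → γ' ∈ dl r (2 * q) → ¬ supp γ' < 2 ^ (q + 1) :=
      fun γ' h1 h2 h3 => ih γ' h1 h3 h2
    by_cases h1 : 1 < (sF γ).card
    · obtain ⟨a, ha, b, hb, hab⟩ := one_lt_card.1 h1
      obtain ⟨i, hi⟩ := Function.ne_iff.1 hab
      set ℓ : Fn r := fun x => x i with hℓ
      have hd : ∀ c, γ * eqi ℓ c ∈ dl r (2 * q) := fun c =>
        dl_mul h (eqi_mem (coord_mem_P1 i) c) (by omega)
      have hz : ∀ z, γ z ≠ 0 → γ * eqi ℓ (z i) ≠ 0 := by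
        intro z hz h
        have := congrFun h z
        simp [eqi, hℓ] at this; exact hz this
      have h2 := hsub _ (hz a (mem_sF.1 ha)) (hd _)
      have h3 := hsub _ (hz b (mem_sF.1 hb)) (hd _)
      have h4 : supp (γ * eqi ℓ (a i)) + supp (γ * eqi ℓ (b i)) ≤ supp γ := by
        rw [supp_eq, supp_eq, supp_eq, ← card_union_of_disjoint]
        · apply card_le_card
          intro x; rw [mem_union, mem_sF, mem_sF, mem_sF]
          rintro (h | h) h' <;> exact h (by simp [h'])
        · rw [disjoint_left]
          intro x; rw [mem_sF, mem_sF]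
          simp only [Pi.mul_apply, eqi, hℓ]
          intro h h'
          split_ifs at h h' with h5 h6 <;> simp_all
      have : 2 ^ (q + 1 + 1) = 2 ^ (q + 1) + 2 ^ (q + 1) := by ring
      omega
    · refine hsub γ h0 (dl_anti (by omega) h) ?_
      have : 1 ≤ 2 ^ q := Nat.one_le_two_pow
      rw [supp_eq]; rw [pow_succ]; omega

/-- `P_{2q}` interpolates on small sets. -/
lemma interp (q : ℕ) (X : Finset (Pt r)) (hX : X.card < 2 ^ (q + 1)) (K : Fn r) :
    ∃ p ∈ P r (2 * q), ∀ x ∈ X, p x = K x := by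
  let res : Fn r →ₗ[F3] (X → F3) := LinearMap.funLeft F3 F3 (fun x : X => (x : Pt r))
  have htop : (P r (2 * q)).map res = ⊤ := by
    by_contra hne
    obtain ⟨φ, hφ, hle⟩ := Submodule.exists_le_ker_of_lt_top _ (lt_top_iff_ne_top.2 hne)
    let γ : Fn r := fun x => if hx : x ∈ X then φ (Pi.single ⟨x, hx⟩ 1) else 0
    have hdot : ∀ f : Fn r, dotF γ f = φ (res f) := by
      intro f
      have h1 : res f = ∑ x : X, f x • Pi.single x (1 : F3) := by
        ext y; simp [res, LinearMap.funLeft_apply, Finset.sum_apply, Pi.single_apply]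
      rw [h1, map_sum]
      unfold dotF
      rw [← sum_subset (subset_univ X) (by intro x _ hx; simp [γ, hx]), ← sum_coe_sort X]
      refine sum_congr rfl fun x _ => ?_
      simp [γ, mul_comm]
    refine interp_dual q γ ?_ ?_ ?_
    · intro h0
      apply hφ
      refine LinearMap.ext fun g => ?_
      obtain ⟨f, rfl⟩ : ∃ f, res f = g := by
        refine ⟨fun x => if hx : x ∈ X then g ⟨x, hx⟩ else 0, ?_⟩
        ext y; simp [res, LinearMap.funLeft_apply]
      rw [← hdot, h0, dotF_zero_left]; rfl
    · refine lt_of_le_of_lt (card_le_card ?_) hX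
      intro x hx
      by_contra hx'
      exact (mem_sF.1 hx) (by simp [γ, hx'])
    · intro p hp
      rw [hdot]
      exact hle (Submodule.mem_map_of_mem hp)
  have : res K ∈ (P r (2 * q)).map res := by rw [htop]; trivial
  obtain ⟨p, hp, h⟩ := this
  exact ⟨p, hp, fun x hx => congrFun h ⟨x, hx⟩⟩

/-- averages of local functions over `P_{2q}` and over all functions agree -/
lemma law {E : Type*} [AddCommMonoid E] [Module ℚ≥0 E] (V : Submodule F3 (Fn r)) (X : Finset (Pt r))
    (hV : ∀ K : Fn r, ∃ p ∈ V, ∀ x ∈ X, p x = K x)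
    (F : Fn r → E) (hF : ∀ f g : Fn r, (∀ x ∈ X, f x = g x) → F f = F g) :
    𝔼 f : V, F f = 𝔼 f : Fn r, F f := by
  have h1 : ∀ G : Fn r, 𝔼 f : V, F (f + G) = 𝔼 f : V, F f := by
    intro G
    obtain ⟨p, hp, hpx⟩ := hV G
    rw [← expect_trans hp F]
    refine expect_congr rfl fun f _ => hF _ _ fun x hx => ?_
    simp [hpx x hx]
  calc 𝔼 f : V, F f = 𝔼 _G : Fn r, 𝔼 f : V, F f := by rw [expect_const univ_nonempty]
    _ = 𝔼 G : Fn r, 𝔼 f : V, F (f + G) := expect_congr rfl fun G _ => (h1 G).symm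
    _ = 𝔼 f : V, 𝔼 G : Fn r, F (f + G) := expect_comm _ _ _
    _ = 𝔼 _f : V, 𝔼 G : Fn r, F G := by
      refine expect_congr rfl fun f _ => ?_
      rw [← expect_trans_top (f : Fn r) F]
      simp only [add_comm]
    _ = _ := by rw [expect_const univ_nonempty]
end
end S5

open scoped BigOperators
set_option linter.unusedVariables false
namespace S5
open Finset
section
variable {r : ℕ}

local notation "conj" => starRingEnd ℂ

noncomputable def hat (V : Submodule F3 (Fn r)) (F : Fn r → ℂ) (β : Fn r) : ℂ :=
  𝔼 g : V, F g * conj (chi β g)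

/-- a set of representatives modulo the annihilator -/
def Reps (V : Submodule F3 (Fn r)) (Λ : Finset (Fn r)) : Prop :=
  ∀ β : Fn r, ∃! β', β' ∈ Λ ∧ β - β' ∈ perp V

lemma chi_congr {V : Submodule F3 (Fn r)} {β γ f : Fn r} (h : β - γ ∈ perp V) (hf : f ∈ V) :
    chi β f = chi γ f := by
  have := h f hf
  rw [dotF_sub_left, sub_eq_zero] at this
  simp only [chi_eq, this]

lemma expect_chi_conj {V : Submodule F3 (Fn r)} {Λ : Finset (Fn r)} (hΛ : Reps V Λ)
    {β γ : Fn r} (hβ : β ∈ Λ) (hγ : γ ∈ Λ) :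
    𝔼 f : V, chi β f * conj (chi γ f) = if β = γ then 1 else 0 := by
  simp only [← chi_neg_left, ← chi_add_left, ← sub_eq_add_neg]
  rw [expect_chi]
  have : (β - γ ∈ perp V) ↔ β = γ := by
    constructor
    · intro h
      obtain ⟨b, -, hb⟩ := hΛ β
      rw [hb β ⟨hβ, by rw [sub_self]; exact zero_mem _⟩, hb γ ⟨hγ, h⟩]
    · rintro rfl; rw [sub_self]; exact zero_mem _
  simp only [this]

lemma plancherel {V : Submodule F3 (Fn r)} {Λ : Finset (Fn r)} (hΛ : Reps V Λ) (a b : Fn r → ℂ) :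
    𝔼 f : V, (∑ β ∈ Λ, a β * chi β f) * conj (∑ β ∈ Λ, b β * chi β f) =
      ∑ β ∈ Λ, a β * conj (b β) := by
  have h1 : ∀ f : V, (∑ β ∈ Λ, a β * chi β f) * conj (∑ β ∈ Λ, b β * chi β f) =
      ∑ β ∈ Λ, ∑ γ ∈ Λ, (a β * conj (b γ)) * (chi β f * conj (chi γ f)) := by
    intro f
    rw [map_sum, sum_mul_sum]
    refine sum_congr rfl fun β _ => sum_congr rfl fun γ _ => ?_
    rw [map_mul]; ring
  simp only [h1]
  rw [expect_sum_comm]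
  refine sum_congr rfl fun β hβ => ?_
  rw [expect_sum_comm]
  rw [sum_eq_single β]
  · rw [← mul_expect, expect_chi_conj hΛ hβ hβ]; simp
  · intro γ hγ hne
    rw [← mul_expect, expect_chi_conj hΛ hβ hγ, if_neg (Ne.symm hne), mul_zero]
  · intro h; exact absurd hβ h

lemma sum_chi {V : Submodule F3 (Fn r)} {Λ : Finset (Fn r)} (hΛ : Reps V Λ) {h : Fn r} (hh : h ∈ V)
    (h0 : h ≠ 0) : ∑ β ∈ Λ, chi β h = 0 := by
  obtain ⟨x, hx⟩ := Function.ne_iff.1 h0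
  set β0 : Fn r := Pi.single x 1
  have hβ0 : chi β0 h ≠ 1 := by
    intro h'
    have := ee_eq_one h'
    apply hx
    simpa [dotF, β0, Pi.single_apply] using this
  choose rep hrep huniq using hΛ
  have h1 : ∑ β ∈ Λ, chi β h = ∑ β ∈ Λ, chi (β + β0) h := by
    symm
    refine sum_bij' (fun β _ => rep (β + β0)) (fun β _ => rep (β - β0)) (fun β _ => (hrep _).1)
      (fun β _ => (hrep _).1) ?_ ?_ ?_
    · intro β hβ
      symm
      refine huniq _ _ ⟨hβ, ?_⟩
      have := (perp V).neg_mem (hrep (β + β0)).2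
      convert this using 1; abel
    · intro β hβ
      symm
      refine huniq _ _ ⟨hβ, ?_⟩
      have := (perp V).neg_mem (hrep (β - β0)).2
      convert this using 1; abel
    · intro β hβ
      exact chi_congr (hrep (β + β0)).2 hh
  simp only [chi_add_left] at h1
  rw [← sum_mul] at h1
  have h2 : (∑ β ∈ Λ, chi β h) * (chi β0 h - 1) = 0 := by rw [mul_sub, ← h1]; ring
  rcases mul_eq_zero.1 h2 with h | h
  · exact h
  · exact absurd (sub_eq_zero.1 h) hβ0

lemma card_reps {V : Submodule F3 (Fn r)} {Λ : Finset (Fn r)} (hΛ : Reps V Λ) :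
    (Λ.card : ℂ) = Fintype.card V := by
  classical
  have h1 : 𝔼 f : V, ∑ β ∈ Λ, chi β f = 1 := by
    rw [expect_sum_comm]
    simp only [expect_chi]
    obtain ⟨b, hb, hb'⟩ := hΛ 0
    rw [sum_eq_single b]
    · rw [if_pos]
      have := (perp V).neg_mem hb.2
      simpa using this
    · intro c hc hne
      rw [if_neg]
      intro h
      exact hne (hb' c ⟨hc, by simpa using (perp V).neg_mem h⟩)
    · intro h; exact absurd hb.1 h
  have h2 : ∀ f : V, ∑ β ∈ Λ, chi β f = if f = 0 then (Λ.card : ℂ) else 0 := by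
    intro f
    split_ifs with h
    · rw [h]; simp [chi_zero_right]
    · exact sum_chi hΛ f.2 (fun h' => h (Subtype.ext h'))
  simp only [h2] at h1
  rw [Fintype.expect_eq_sum_div_card] at h1
  simp only [sum_ite_eq', mem_univ, if_true] at h1
  have h3 : (Fintype.card V : ℂ) ≠ 0 := by exact_mod_cast Fintype.card_ne_zero
  field_simp at h1
  exact h1

lemma inversion {V : Submodule F3 (Fn r)} {Λ : Finset (Fn r)} (hΛ : Reps V Λ) (F : Fn r → ℂ)
    {f : Fn r} (hf : f ∈ V) : F f = ∑ β ∈ Λ, hat V F β * chi β f := by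
  classical
  have h1 : ∑ β ∈ Λ, hat V F β * chi β f = 𝔼 g : V, F g * ∑ β ∈ Λ, chi β (f - g) := by
    unfold hat
    simp only [expect_mul, mul_sum]
    rw [expect_sum_comm]
    refine sum_congr rfl fun β _ => expect_congr rfl fun g _ => ?_
    rw [sub_eq_add_neg, chi_add_right, chi_neg_right]; ring
  have h2 : ∀ g : V, F g * ∑ β ∈ Λ, chi β (f - g) =
      if g = ⟨f, hf⟩ then F f * (Fintype.card V : ℂ) else 0 := by
    intro g
    split_ifs with h
    · rw [h]; simp [chi_zero_right, card_reps hΛ]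
    · rw [sum_chi hΛ (V.sub_mem hf g.2), mul_zero]
      intro h'; exact h (Subtype.ext (sub_eq_zero.1 h').symm)
  rw [h1]
  simp only [h2]
  rw [Fintype.expect_eq_sum_div_card]
  simp only [sum_ite_eq', mem_univ, if_true]
  have h3 : (Fintype.card V : ℂ) ≠ 0 := by exact_mod_cast Fintype.card_ne_zero
  field_simp

lemma norm_sq_eq (z : ℂ) : ((‖z‖ ^ 2 : ℝ) : ℂ) = z * conj z := by
  rw [Complex.mul_conj, Complex.normSq_eq_norm_sq]

lemma parseval_sum {V : Submodule F3 (Fn r)} {Λ : Finset (Fn r)} (hΛ : Reps V Λ) (a : Fn r → ℂ) :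
    𝔼 f : V, ‖∑ β ∈ Λ, a β * chi β f‖ ^ 2 = ∑ β ∈ Λ, ‖a β‖ ^ 2 := by
  have := plancherel hΛ a a
  simp only [← norm_sq_eq] at this
  exact_mod_cast this

lemma parseval_hat {V : Submodule F3 (Fn r)} {Λ : Finset (Fn r)} (hΛ : Reps V Λ) (F : Fn r → ℂ) :
    𝔼 f : V, ‖F f‖ ^ 2 = ∑ β ∈ Λ, ‖hat V F β‖ ^ 2 := by
  rw [← parseval_sum hΛ]
  exact expect_congr rfl fun f _ => by rw [← inversion hΛ F f.2]

lemma hat_noise {ι : Type*} [Fintype ι] {V : Submodule F3 (Fn r)} (F : Fn r → ℂ) (y : ι → Fn r)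
    (hy : ∀ i, y i ∈ V) (β : Fn r) :
    hat V (fun f => 𝔼 i, F (f + y i)) β = hat V F β * 𝔼 i, chi β (y i) := by
  unfold hat
  simp only [expect_mul]
  rw [expect_comm]
  rw [← expect_mul, mul_expect]
  refine expect_congr rfl fun i _ => ?_
  have := expect_trans (hy i) (fun f => F f * conj (chi β f) * chi β (y i))
  rw [expect_mul, ← this]
  refine expect_congr rfl fun f _ => ?_
  rw [chi_add_right, map_mul]
  linear_combination -(F (f + y i) * conj (chi β f)) * chi_mul_conj β (y i)

lemma hat_conj {V : Submodule F3 (Fn r)} (F : Fn r → ℝ) (β : Fn r) :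
    hat V (fun f => (F f : ℂ)) (-β) = conj (hat V (fun f => (F f : ℂ)) β) := by
  unfold hat
  rw [map_expect]
  refine expect_congr rfl fun f _ => ?_
  rw [chi_neg_left, map_mul, Complex.conj_ofReal]

lemma hat_add {V : Submodule F3 (Fn r)} (F G : Fn r → ℂ) (β : Fn r) :
    hat V (fun f => F f + G f) β = hat V F β + hat V G β := by
  unfold hat; simp only [add_mul, expect_add_distrib]

lemma hat_smul {V : Submodule F3 (Fn r)} (c : ℂ) (F : Fn r → ℂ) (β : Fn r) :
    hat V (fun f => c * F f) β = c * hat V F β := by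
  unfold hat; simp only [mul_assoc, mul_expect]

/-! ### Functions on the full space -/

noncomputable def LL (c : Fn r → ℂ) (f : Fn r) : ℂ := ∑ β : Fn r, c β * chi β f

lemma reps_top : Reps (⊤ : Submodule F3 (Fn r)) univ := by
  intro β
  refine ⟨β, ⟨mem_univ _, by rw [sub_self]; exact zero_mem _⟩, ?_⟩
  rintro γ ⟨-, h⟩
  ext x
  have := h (Pi.single x 1) trivial
  rw [dotF_sub_left] at this
  simp [dotF, Pi.single_apply] at this
  exact (sub_eq_zero.1 this).symm

lemma expect_top {E : Type*} [AddCommMonoid E] [Module ℚ≥0 E] (F : Fn r → E) :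
    𝔼 f : (⊤ : Submodule F3 (Fn r)), F f = 𝔼 f : Fn r, F f :=
  Fintype.expect_equiv (Submodule.topEquiv (R := F3) (M := Fn r)).toEquiv _ _ (fun x => rfl)

lemma parseval_LL (c : Fn r → ℂ) : 𝔼 f : Fn r, ‖LL c f‖ ^ 2 = ∑ β, ‖c β‖ ^ 2 := by
  rw [← parseval_sum reps_top, expect_top (fun f => ‖∑ β, c β * chi β f‖ ^ 2)]
  rfl

lemma plancherel_LL (a b : Fn r → ℂ) :
    𝔼 f : Fn r, LL a f * conj (LL b f) = ∑ β, a β * conj (b β) := by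
  rw [← plancherel reps_top,
    expect_top (fun f => (∑ β, a β * chi β f) * conj (∑ β, b β * chi β f))]
  rfl

/-- span of characters of support at most `κ` -/
def Low (κ : ℕ) : Submodule ℂ (Fn r → ℂ) := Submodule.span ℂ {F | ∃ β : Fn r, supp β ≤ κ ∧ F = chi β}

lemma LL_low {κ : ℕ} {c : Fn r → ℂ} (hc : ∀ β, κ < supp β → c β = 0) : LL c ∈ Low κ := by
  have : LL c = ∑ β : Fn r, c β • chi β := by ext f; simp [LL, Finset.sum_apply]
  rw [this]
  refine Submodule.sum_mem _ fun β _ => ?_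
  by_cases h : supp β ≤ κ
  · exact Submodule.smul_mem _ _ (Submodule.subset_span ⟨β, h, rfl⟩)
  · rw [hc β (not_le.1 h), zero_smul]; exact zero_mem _

lemma Low_mul {κ l : ℕ} {F G : Fn r → ℂ} (hF : F ∈ Low κ) (hG : G ∈ Low l) : F * G ∈ Low (κ + l) := by
  have := Submodule.mul_mem_mul hF hG
  unfold Low at this ⊢
  rw [Submodule.span_mul_span] at this
  refine Submodule.span_mono ?_ this
  rintro H ⟨F, ⟨β, hβ, rfl⟩, G, ⟨γ, hγ, rfl⟩, rfl⟩
  exact ⟨β + γ, (supp_add_le _ _).trans (add_le_add hβ hγ), by ext f; simp [chi_add_left]⟩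

lemma Low_conj {κ : ℕ} {F : Fn r → ℂ} (hF : F ∈ Low κ) : (fun f => conj (F f)) ∈ Low κ := by
  refine Submodule.span_induction ?_ ?_ ?_ ?_ hF
  · rintro F ⟨β, hβ, rfl⟩
    exact Submodule.subset_span ⟨-β, by rwa [supp_neg], by ext f; simp [chi_neg_left]⟩
  · have : (fun f : Fn r => conj ((0 : Fn r → ℂ) f)) = 0 := by ext; simp
    rw [this]; exact zero_mem _
  · intro F G _ _ h1 h2
    have : (fun f : Fn r => conj ((F + G) f)) = (fun f => conj (F f)) + fun f => conj (G f) := by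
      ext; simp
    rw [this]; exact add_mem h1 h2
  · intro c F _ h1
    have : (fun f : Fn r => conj ((c • F) f)) = conj c • (fun f => conj (F f)) := by
      ext; simp
    rw [this]; exact Submodule.smul_mem _ _ h1

lemma expect_Low {q κ : ℕ} (hκ : κ < 2 ^ (q + 1)) {F : Fn r → ℂ} (hF : F ∈ Low κ) (y : Fn r) :
    𝔼 f : P r (2 * q), F (f + y) = 𝔼 f : Fn r, F f := by
  rw [← expect_trans_top y F]
  refine Submodule.span_induction ?_ ?_ ?_ ?_ hF
  · rintro F ⟨β, hβ, rfl⟩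
    simp only [chi_add_right]
    rw [← expect_mul, ← expect_mul]
    congr 1
    rw [expect_chi, ← expect_top, expect_chi]
    by_cases h : β = 0
    · subst h; rw [if_pos (zero_mem _), if_pos (zero_mem _)]
    · rw [if_neg, if_neg]
      · intro h'
        apply interp_dual q β h (by omega)
        exact fun p _ => h' p trivial
      · exact interp_dual q β h (by omega)
  · simp
  · intro F G _ _ h1 h2
    simp only [Pi.add_apply, expect_add_distrib, h1, h2]
  · intro c F _ h1
    simp only [Pi.smul_apply, smul_eq_mul, ← mul_expect, h1]

lemma mom2 {q κ : ℕ} (hκ : 2 * κ < 2 ^ (q + 1)) {c : Fn r → ℂ} (hc : ∀ β, κ < supp β → c β = 0)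
    (y : Fn r) : 𝔼 f : P r (2 * q), ‖LL c (f + y)‖ ^ 2 = 𝔼 f : Fn r, ‖LL c f‖ ^ 2 := by
  have h1 := Low_mul (LL_low hc) (Low_conj (LL_low hc))
  have h2 := expect_Low (q := q) (by omega) h1 y
  simp only [Pi.mul_apply, ← norm_sq_eq] at h2
  exact_mod_cast h2

lemma mom4 {q κ : ℕ} (hκ : 4 * κ < 2 ^ (q + 1)) {c : Fn r → ℂ} (hc : ∀ β, κ < supp β → c β = 0)
    (y : Fn r) : 𝔼 f : P r (2 * q), ‖LL c (f + y)‖ ^ 4 = 𝔼 f : Fn r, ‖LL c f‖ ^ 4 := by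
  have h1 := Low_mul (LL_low hc) (Low_conj (LL_low hc))
  have h2 := expect_Low (q := q) (by omega) (Low_mul h1 h1) y
  have h3 : ∀ f : Fn r, ((‖LL c f‖ ^ 4 : ℝ) : ℂ) =
      LL c f * conj (LL c f) * (LL c f * conj (LL c f)) := by
    intro f; rw [← norm_sq_eq]; push_cast; ring
  simp only [Pi.mul_apply, ← h3] at h2
  exact_mod_cast h2

end
end S5

open scoped BigOperators
set_option linter.unusedVariables false
namespace S5
open Finset
section
variable {r : ℕ}

lemma prod_mem_P {ι : Type*} (T : Finset ι) (f : ι → Fn r) (hf : ∀ i ∈ T, f i ∈ P1 r) :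
    ∏ i ∈ T, f i ∈ P r T.card := by
  classical
  induction T using Finset.induction_on with
  | empty => simpa using one_mem_P 0
  | insert a s ha ih =>
    rw [prod_insert ha, card_insert_of_notMem ha, add_comm]
    refine P_mul ?_ (ih fun i hi => hf i (mem_insert_of_mem hi))
    rw [P_one]; exact hf a (mem_insert_self _ _)

lemma span_pow_small (s : Finset (Fn r)) (hs : ∀ y ∈ s, y ∈ P1 r) (e : ℕ) (he : 2 * s.card < e) :
    (Submodule.span F3 (s : Set (Fn r))) ^ e ≤ P r (e - 1) := by
  classical
  rw [Submodule.span_pow, Submodule.span_le]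
  intro a ha
  obtain ⟨f, rfl⟩ := Set.mem_pow.1 ha
  rw [List.prod_ofFn]
  obtain ⟨y, hy, hcard⟩ := Finset.exists_lt_card_fiber_of_mul_lt_card_of_maps_to
    (s := (univ : Finset (Fin e))) (t := s) (f := fun i => (f i : Fn r)) (n := 2)
    (fun i _ => (f i).2) (by simpa [mul_comm] using he)
  obtain ⟨T, hT, hT3⟩ := Finset.exists_subset_card_eq (n := 3) hcard
  rw [← prod_mul_prod_compl T]
  have h1 : ∏ i ∈ T, (f i : Fn r) = y := by
    rw [prod_congr rfl (fun i hi => (mem_filter.1 (hT hi)).2), prod_const, hT3]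
    ext x; simp
  rw [h1]
  have hc : Tᶜ.card = e - 3 := by rw [card_compl, hT3, Fintype.card_fin]
  have hle : T.card ≤ e := by simpa using card_le_univ T
  refine P_mul_le (D := 1) (E := e - 3) ?_ ?_ (by omega)
  · rw [P_one]; exact hs y hy
  · rw [← hc]; exact prod_mem_P _ _ fun i _ => hs _ (f i).2

/-- the multipliers that keep `η` in `dl n` -/
def mker (η : Fn r) (n : ℕ) : Submodule F3 (Fn r) where
  carrier := {ℓ | η * ℓ ∈ dl r n}
  add_mem' := by
    intro a b ha hb
    show η * (a + b) ∈ dl r n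
    rw [mul_add]; exact add_mem ha hb
  zero_mem' := by show η * 0 ∈ dl r n; rw [mul_zero]; exact zero_mem _
  smul_mem' := by
    intro c a ha
    show η * (c • a) ∈ dl r n
    rw [mul_smul_comm]; exact Submodule.smul_mem _ _ ha

lemma mem_mker {η ℓ : Fn r} {n : ℕ} : ℓ ∈ mker η n ↔ η * ℓ ∈ dl r n := Iff.rfl

lemma sup_pow_le (K Y : Submodule F3 (Fn r)) (h : K ⊔ Y = P1 r) (n : ℕ) :
    P1 r ^ (n + 1) ≤ K * P1 r ^ n ⊔ Y ^ (n + 1) := by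
  induction n with
  | zero => simp [h]
  | succ n ih =>
    calc P1 r ^ (n + 1 + 1) = P1 r ^ (n + 1) * P1 r := pow_succ _ _
      _ ≤ (K * P1 r ^ n ⊔ Y ^ (n + 1)) * P1 r := mul_le_mul_left ih _
      _ = K * P1 r ^ (n + 1) ⊔ Y ^ (n + 1) * P1 r := by
        rw [Submodule.sup_mul, mul_assoc, ← pow_succ]
      _ ≤ _ := by
        refine sup_le le_sup_left ?_
        rw [← h, Submodule.mul_sup]
        refine sup_le ?_ ?_
        · rw [h]
          refine le_trans ?_ le_sup_left
          rw [mul_comm]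
          exact mul_le_mul_right (pow_le_pow_left' (by rw [← h]; exact le_sup_right) _) _
        · rw [← pow_succ]; exact le_sup_right

/-- **Lemma S** -/
lemma top_lemma (η : Fn r) (e : ℕ) (h1 : η ∈ dl r e) (h2 : η ∉ dl r (e + 1)) :
    𝔼 ℓ : P1 r, ind (η * (ℓ : Fn r) ∈ dl r e) ≤ (1 / 3 : ℝ) ^ ((e + 1) / 2) := by
  classical
  set K : Submodule F3 (P1 r) := (mker η e).comap (P1 r).subtype with hK
  obtain ⟨Y, hY⟩ := Submodule.exists_isCompl K
  set c := Module.finrank F3 Y with hc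
  have hfin : Module.finrank F3 K + c = Module.finrank F3 (P1 r) :=
    Submodule.finrank_add_eq_of_isCompl hY
  have hce : (e + 1) / 2 ≤ c := by
    by_contra hlt
    push Not at hlt
    apply h2
    let b := Module.finBasis F3 Y
    let s : Finset (Fn r) := univ.image (fun i => ((b i : P1 r) : Fn r))
    have hs : Submodule.span F3 (s : Set (Fn r)) = Y.map (P1 r).subtype := by
      have h3 : (s : Set (Fn r)) = (P1 r).subtype '' (Y.subtype '' Set.range b) := by
        ext y; simp [s]
      rw [h3, ← Submodule.map_span, ← Submodule.map_span, b.span_eq, Submodule.map_subtype_top]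
    have hs1 : ∀ y ∈ s, y ∈ P1 r := by
      intro y hy
      obtain ⟨i, -, rfl⟩ := mem_image.1 hy
      exact (b i : P1 r).2
    have hsc : s.card ≤ c := by
      refine card_image_le.trans ?_
      simp [hc]
    have hsup : K.map (P1 r).subtype ⊔ Y.map (P1 r).subtype = P1 r := by
      rw [← Submodule.map_sup, hY.sup_eq_top, Submodule.map_subtype_top]
    have hp := sup_pow_le _ _ hsup e
    have hY2 : (Y.map (P1 r).subtype) ^ (e + 1) ≤ P r e := by
      rw [← hs]
      exact span_pow_small s hs1 (e + 1) (by omega)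
    intro g hg
    have hg' : g ∈ K.map (P1 r).subtype * P1 r ^ e ⊔ P r e :=
      (hp.trans (sup_le_sup_left hY2 _)) hg
    obtain ⟨u, hu, w, hw, rfl⟩ := Submodule.mem_sup.1 hg'
    rw [dotF_add_right, h1 w hw, add_zero]
    refine Submodule.mul_induction_on hu ?_ ?_
    · intro m hm n hn
      obtain ⟨ℓ, hℓ, rfl⟩ := hm
      rw [← dotF_mul]
      exact hℓ n hn
    · intro x y hx hy
      rw [dotF_add_right, hx, hy, add_zero]
  have hcard : Fintype.card K * 3 ^ c = Fintype.card (P1 r) := by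
    have e1 := Module.card_eq_pow_finrank (K := F3) (V := K)
    have e2 := Module.card_eq_pow_finrank (K := F3) (V := P1 r)
    rw [ZMod.card] at e1 e2
    rw [e2, ← hfin, pow_add, ← e1]
  have hpr : 𝔼 ℓ : P1 r, ind (η * (ℓ : Fn r) ∈ dl r e) = (1 / 3 : ℝ) ^ c := by
    rw [Fintype.expect_eq_sum_div_card]
    have h5 : ∑ ℓ : P1 r, ind (η * (ℓ : Fn r) ∈ dl r e) = Fintype.card K := by
      have : ∀ ℓ : P1 r, ind (η * (ℓ : Fn r) ∈ dl r e) = if ℓ ∈ K then 1 else 0 := by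
        intro ℓ; unfold ind
        have : (η * (ℓ : Fn r) ∈ dl r e) ↔ ℓ ∈ K := Iff.rfl
        simp only [this]
      simp only [this]
      rw [sum_boole]
      norm_cast
      rw [Fintype.card_subtype]
    rw [h5, ← hcard]
    have : (Fintype.card K : ℝ) ≠ 0 := by exact_mod_cast Fintype.card_ne_zero
    push_cast
    field_simp
    rw [← mul_pow]; norm_num
  rw [hpr]
  exact pow_le_pow_of_le_one (by norm_num) (by norm_num) hce

lemma exists_level {η : Fn r} {D E : ℕ} (h1 : η ∈ dl r D) (h2 : η ∉ dl r E) :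
    ∃ e, D ≤ e ∧ e < E ∧ η ∈ dl r e ∧ η ∉ dl r (e + 1) := by
  have hDE : D < E := by
    by_contra h; exact h2 (dl_anti (not_lt.1 h) h1)
  induction E with
  | zero => omega
  | succ n ih =>
    by_cases h : η ∈ dl r n
    · exact ⟨n, by omega, by omega, h, h2⟩
    · have : D < n := by
        rcases Nat.lt_or_ge D n with h' | h'
        · exact h'
        · exact absurd (dl_anti h' h1) h
      obtain ⟨e, h3, h4, h5⟩ := ih h this
      exact ⟨e, h3, by omega, h5⟩

lemma top_cor {η : Fn r} {D E : ℕ} (h1 : η ∈ dl r D) (h2 : η ∉ dl r (E + 1)) :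
    𝔼 ℓ : P1 r, ind (η * (ℓ : Fn r) ∈ dl r E) ≤ (1 / 3 : ℝ) ^ (D / 2) := by
  obtain ⟨e, h3, h4, h5, h6⟩ := exists_level h1 h2
  calc _ ≤ 𝔼 ℓ : P1 r, ind (η * (ℓ : Fn r) ∈ dl r e) :=
        expect_le_expect fun ℓ _ => ind_mono fun h => dl_anti (by omega) h
    _ ≤ _ := top_lemma η e h5 h6
    _ ≤ _ := pow_le_pow_of_le_one (by norm_num) (by norm_num) (by omega)

/-! ### Random affine functions at points -/

lemma prob_zero (x : Pt r) : 𝔼 ℓ : P1 r, ind ((ℓ : Fn r) x ≠ 0) = 2 / 3 := by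
  have h1 : ∀ c : F3, 𝔼 ℓ : P1 r, ind ((ℓ : Fn r) x + c ≠ 0) = 𝔼 ℓ : P1 r, ind ((ℓ : Fn r) x ≠ 0) := by
    intro c
    have := expect_trans (const_mem_P1 (r := r) c) (fun f => ind (f x ≠ 0))
    simpa using this
  have h2 : ∀ b : F3, ind (b ≠ 0) + ind (b + 1 ≠ 0) + ind (b + 2 ≠ 0) = 2 := by
    intro b
    have h3 : b = 0 ∨ b = 1 ∨ b = 2 := by revert b; decide
    rcases h3 with rfl | rfl | rfl
    · rw [ind_false (by decide), ind_true (by decide), ind_true (by decide)]; norm_num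
    · rw [ind_true (by decide), ind_true (by decide), ind_false (by decide)]; norm_num
    · rw [ind_true (by decide), ind_false (by decide), ind_true (by decide)]; norm_num
  have h4 : 𝔼 ℓ : P1 r, (ind ((ℓ : Fn r) x ≠ 0) + ind ((ℓ : Fn r) x + 1 ≠ 0)
      + ind ((ℓ : Fn r) x + 2 ≠ 0)) = 2 := by
    simp only [h2]; rw [expect_const univ_nonempty]
  rw [expect_add_distrib, expect_add_distrib, h1, h1] at h4
  linarith

lemma prob_coll {x y : Pt r} (hxy : x ≠ y) :
    𝔼 ℓ : P1 r, ind ((ℓ : Fn r) x = (ℓ : Fn r) y) ≤ 1 / 3 := by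
  obtain ⟨i, hi⟩ := Function.ne_iff.1 hxy
  let M : Submodule F3 (P1 r) :=
    { carrier := {ℓ | (ℓ : Fn r) x = (ℓ : Fn r) y}
      add_mem' := by
        intro a b ha hb
        simp only [Set.mem_ofPred_eq] at *
        simp [ha, hb]
      zero_mem' := rfl
      smul_mem' := by
        intro c a ha
        simp only [Set.mem_ofPred_eq] at *
        simp [ha] }
  exact prob_proper M ⟨_, coord_mem_P1 i⟩ hi

end
end S5

open scoped BigOperators
set_option linter.unusedVariables false
set_option linter.unusedSectionVars false
namespace S5
open Finset
section
variable {r : ℕ}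

/-- `β` agrees with a function of small support modulo `dl D` -/
def Sm (κ D : ℕ) (β : Fn r) : Prop := ∃ β' : Fn r, supp β' ≤ κ ∧ β - β' ∈ dl r D

def cstF (a : F3) : Fn r := fun _ => a

/-- affine functions that are constant on `γ` modulo `dl D` -/
def conM (D : ℕ) (γ : Fn r) : Submodule F3 (P1 r) where
  carrier := {ℓ | ∃ a : F3, γ * ((ℓ : Fn r) - cstF a) ∈ dl r D}
  add_mem' := by
    rintro x y ⟨a, ha⟩ ⟨b, hb⟩
    refine ⟨a + b, ?_⟩
    have : γ * (((x + y : P1 r) : Fn r) - cstF (a + b)) =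
        γ * ((x : Fn r) - cstF a) + γ * ((y : Fn r) - cstF b) := by
      ext z; simp [cstF]; ring
    rw [this]; exact add_mem ha hb
  zero_mem' := ⟨0, by
    have : γ * (((0 : P1 r) : Fn r) - cstF 0) = 0 := by ext z; simp [cstF]
    rw [this]; exact zero_mem _⟩
  smul_mem' := by
    rintro c x ⟨a, ha⟩
    refine ⟨c * a, ?_⟩
    have : γ * (((c • x : P1 r) : Fn r) - cstF (c * a)) = c • (γ * ((x : Fn r) - cstF a)) := by
      ext z; simp [cstF]; ring
    rw [this]; exact Submodule.smul_mem _ _ ha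

lemma point_of_con {D : ℕ} {γ : Fn r} (h : ∀ ℓ : P1 r, ℓ ∈ conM D γ) : Sm 1 D γ := by
  choose a ha using fun i : Fin r => h ⟨_, coord_mem_P1 i⟩
  have h1 : ∀ ℓ ∈ P1 r, γ * (ℓ - cstF (ℓ a)) ∈ dl r D := by
    intro ℓ hℓ
    refine Submodule.span_induction ?_ ?_ ?_ ?_ hℓ
    · rintro g (rfl | ⟨i, rfl⟩)
      · have : γ * (1 - cstF ((1 : Fn r) a)) = 0 := by ext z; simp [cstF]
        rw [this]; exact zero_mem _
      · exact ha i
    · have : γ * (0 - cstF ((0 : Fn r) a)) = 0 := by ext z; simp [cstF]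
      rw [this]; exact zero_mem _
    · intro x y _ _ hx hy
      have : γ * (x + y - cstF ((x + y) a)) = γ * (x - cstF (x a)) + γ * (y - cstF (y a)) := by
        ext z; simp [cstF]; ring
      rw [this]; exact add_mem hx hy
    · intro c x _ hx
      have : γ * (c • x - cstF ((c • x) a)) = c • (γ * (x - cstF (x a))) := by
        ext z; simp [cstF]; ring
      rw [this]; exact Submodule.smul_mem _ _ hx
  have h2 : ∀ n ≤ D, ∀ g ∈ P r n, dotF γ g = g a * dotF γ 1 := by
    intro n
    induction n with
    | zero =>
      intro _ g hg
      unfold P at hg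
      rw [pow_zero, Submodule.mem_one] at hg
      obtain ⟨c, rfl⟩ := hg
      have : (algebraMap F3 (Fn r) c) = c • (1 : Fn r) := by ext; simp
      rw [this, dotF_smul_right]; simp
    | succ n ih =>
      intro hn g hg
      unfold P at hg
      rw [pow_succ'] at hg
      refine Submodule.mul_induction_on hg ?_ ?_
      · intro ℓ hℓ q hq
        have h3 := h1 ℓ hℓ q (P_mono (by omega) hq)
        rw [dotF_mul] at h3
        have : ℓ * q = (ℓ - cstF (ℓ a)) * q + ℓ a • q := by
          ext z; simp [cstF]; ring
        rw [this, dotF_add_right, h3, dotF_smul_right, ih (by omega) q hq]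
        simp [cstF, mul_assoc]
      · intro x y hx hy
        rw [dotF_add_right, hx, hy]; simp [add_mul]
  refine ⟨Pi.single a (dotF γ 1), ?_, ?_⟩
  · rw [supp_eq]
    refine (card_le_card (t := {a}) ?_).trans (by simp)
    intro x hx
    rw [mem_sF] at hx
    rw [mem_singleton]; by_contra hne; exact hx (by simp [hne])
  · intro g hg
    rw [dotF_sub_left, h2 D le_rfl g hg]
    simp [dotF, Pi.single_apply]; ring

lemma sub_cst_eq (ℓ : Fn r) (a : F3) : ℓ - cstF a = ∑ c : F3, (c - a) • eqi ℓ c := by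
  ext x; simp [cstF, eqi, Finset.sum_apply]

lemma sum_eqi (ℓ : Fn r) : ∑ c : F3, eqi ℓ c = 1 := by
  ext x; simp [eqi, Finset.sum_apply]

open Classical in
lemma con_of_nonsplit {D : ℕ} {γ : Fn r} (ℓ : P1 r)
    (h : (univ.filter fun c : F3 => γ * eqi (ℓ : Fn r) c ∉ dl r D).card ≤ 1) : ℓ ∈ conM D γ := by
  obtain ⟨a, ha⟩ := (card_le_one_iff_subset_singleton).1 h
  refine ⟨a, ?_⟩
  rw [sub_cst_eq, mul_sum]
  refine Submodule.sum_mem _ fun c _ => ?_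
  by_cases hc : c = a
  · rw [hc]; simp
  · rw [mul_smul_comm]
    refine Submodule.smul_mem _ _ ?_
    by_contra hn
    have := ha (mem_filter.2 ⟨mem_univ c, hn⟩)
    exact hc (mem_singleton.1 this)

/-! ### Hashes -/
section hash
variable {ι : Type} [Fintype ι] [DecidableEq ι]

def cell (h : Pt r → ι) (b : ι) : Fn r := fun x => if h x = b then 1 else 0

lemma sum_cell (h : Pt r → ι) : ∑ b, cell h b = (1 : Fn r) := by
  ext x; simp [cell, Finset.sum_apply]

open Classical in
noncomputable def NN (D : ℕ) (h : Pt r → ι) (β : Fn r) : ℕ :=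
  (univ.filter fun b => β * cell h b ∉ dl r D).card

def ext1 (h : Pt r → ι) (ℓ : Fn r) : Pt r → ι × F3 := fun x => (h x, ℓ x)

lemma cell_ext1 (h : Pt r → ι) (ℓ : Fn r) (b : ι) (c : F3) :
    cell (ext1 h ℓ) (b, c) = cell h b * eqi ℓ c := by
  ext x; simp only [cell, ext1, Pi.mul_apply, eqi, Prod.mk.injEq]
  split_ifs <;> simp_all

open Classical in
lemma NN_ext1 (D : ℕ) (h : Pt r → ι) (ℓ : Fn r) (β : Fn r) :
    NN D (ext1 h ℓ) β =
      ∑ b : ι, (univ.filter fun c : F3 => (β * cell h b) * eqi ℓ c ∉ dl r D).card := by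
  unfold NN
  rw [card_filter, Fintype.sum_prod_type]
  refine sum_congr rfl fun b _ => ?_
  rw [card_filter]
  refine sum_congr rfl fun c _ => ?_
  rw [cell_ext1, mul_assoc]

open Classical in
lemma child_pos {D : ℕ} {γ : Fn r} (hγ : γ ∉ dl r D) (ℓ : Fn r) :
    1 ≤ (univ.filter fun c : F3 => γ * eqi ℓ c ∉ dl r D).card := by
  by_contra h
  have h0 : (univ.filter fun c : F3 => γ * eqi ℓ c ∉ dl r D) = ∅ := by
    rw [← card_eq_zero]; omega
  apply hγ
  rw [← mul_one γ, ← sum_eqi ℓ, mul_sum]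
  refine Submodule.sum_mem _ fun c _ => ?_
  by_contra hn
  have : c ∈ (univ.filter fun c : F3 => γ * eqi ℓ c ∉ dl r D) := mem_filter.2 ⟨mem_univ _, hn⟩
  rw [h0] at this; simp at this

open Classical in
lemma NN_eq_sum (D : ℕ) (h : Pt r → ι) (β : Fn r) :
    NN D h β = ∑ b : ι, if β * cell h b ∉ dl r D then 1 else 0 := by
  unfold NN; rw [card_filter]

lemma NN_mono (D : ℕ) (h : Pt r → ι) (ℓ : Fn r) (β : Fn r) : NN D h β ≤ NN D (ext1 h ℓ) β := by
  classical
  rw [NN_eq_sum, NN_ext1]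
  refine sum_le_sum fun b _ => ?_
  by_cases hb : β * cell h b ∉ dl r D
  · rw [if_pos hb]; exact child_pos hb ℓ
  · rw [if_neg hb]; exact Nat.zero_le _

lemma NN_split (D : ℕ) (h : Pt r → ι) (ℓ : P1 r) (β : Fn r) (b : ι) (hb : β * cell h b ∉ dl r D)
    (hℓ : ℓ ∉ conM D (β * cell h b)) : NN D h β + 1 ≤ NN D (ext1 h ℓ) β := by
  classical
  rw [NN_eq_sum, NN_ext1, Nat.add_one_le_iff]
  refine sum_lt_sum (fun b _ => ?_) ⟨b, mem_univ _, ?_⟩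
  · by_cases hb : β * cell h b ∉ dl r D
    · rw [if_pos hb]; exact child_pos hb ℓ
    · rw [if_neg hb]; exact Nat.zero_le _
  · rw [if_pos hb]
    by_contra hn
    exact hℓ (con_of_nonsplit ℓ (not_lt.1 hn))

lemma exists_splittable {κ D : ℕ} {h : Pt r → ι} {β : Fn r} (hβ : ¬ Sm κ D β) (hN : NN D h β ≤ κ) :
    ∃ b, β * cell h b ∉ dl r D ∧ ∃ ℓ, ℓ ∉ conM D (β * cell h b) := by
  classical
  by_contra hcon
  push Not at hcon
  apply hβ
  have h1 : ∀ b, ∃ γ : Fn r, supp γ ≤ (if β * cell h b ∉ dl r D then 1 else 0) ∧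
      β * cell h b - γ ∈ dl r D := by
    intro b
    by_cases hb : β * cell h b ∉ dl r D
    · rw [if_pos hb]; exact point_of_con (hcon b hb)
    · rw [if_neg hb]
      refine ⟨0, ?_, ?_⟩
      · rw [supp_eq_zero.2 rfl]
      · rw [sub_zero]; exact not_not.1 hb
  choose γ h2 h3 using h1
  refine ⟨∑ b, γ b, ?_, ?_⟩
  · refine le_trans ?_ hN
    rw [NN_eq_sum]
    refine le_trans ?_ (sum_le_sum fun b _ => h2 b)
    have : ∀ s : Finset ι, supp (∑ b ∈ s, γ b) ≤ ∑ b ∈ s, supp (γ b) := by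
      intro s
      induction s using Finset.induction_on with
      | empty => rw [sum_empty, sum_empty, supp_eq_zero.2 rfl]
      | insert a s ha ih =>
        rw [sum_insert ha, sum_insert ha]
        exact (supp_add_le _ _).trans (by omega)
    exact this univ
  · have : β - ∑ b, γ b = ∑ b, (β * cell h b - γ b) := by
      rw [sum_sub_distrib, ← mul_sum, sum_cell, mul_one]
    rw [this]
    exact Submodule.sum_mem _ fun b _ => h3 b

noncomputable def FF (s : ℝ) (κ N : ℕ) : ℝ := max (s ^ N - s ^ (κ + 1)) 0

lemma FF_nonneg (s : ℝ) (κ N : ℕ) : 0 ≤ FF s κ N := le_max_right _ _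

lemma FF_anti {s : ℝ} (h0 : 0 ≤ s) (h1 : s ≤ 1) (κ : ℕ) {N N' : ℕ} (h : N ≤ N') :
    FF s κ N' ≤ FF s κ N := by
  unfold FF
  exact max_le_max (by linarith [pow_le_pow_of_le_one h0 h1 h]) le_rfl

lemma FF_split {s : ℝ} (h0 : 0 ≤ s) (h1 : s ≤ 1) (κ : ℕ) {N N' : ℕ} (h : N + 1 ≤ N') :
    FF s κ N' ≤ s * FF s κ N := by
  refine (FF_anti h0 h1 κ h).trans ?_
  unfold FF
  refine max_le ?_ (mul_nonneg h0 (le_max_right _ _))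
  have h2 : s * (s ^ N - s ^ (κ + 1)) ≤ s * max (s ^ N - s ^ (κ + 1)) 0 :=
    mul_le_mul_of_nonneg_left (le_max_left _ _) h0
  refine le_trans ?_ h2
  have : s * s ^ (κ + 1) ≤ 1 * s ^ (κ + 1) := mul_le_mul_of_nonneg_right h1 (pow_nonneg h0 _)
  rw [pow_succ]; nlinarith

lemma FF_zero {s : ℝ} (h0 : 0 ≤ s) (h1 : s ≤ 1) {κ N : ℕ} (h : κ < N) : FF s κ N = 0 := by
  unfold FF
  apply max_eq_right
  have : s ^ N ≤ s ^ (κ + 1) := pow_le_pow_of_le_one h0 h1 (by omega)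
  linarith

lemma FF_le_one {s : ℝ} (h0 : 0 ≤ s) (h1 : s ≤ 1) (κ N : ℕ) : FF s κ N ≤ 1 := by
  unfold FF
  refine max_le ?_ (by norm_num)
  linarith [pow_le_one₀ h0 h1 (n := N), pow_nonneg h0 (κ + 1)]

lemma FF_step {s : ℝ} (h0 : 0 ≤ s) (h1 : s ≤ 1) {κ D : ℕ} (h : Pt r → ι) {β : Fn r}
    (hβ : ¬ Sm κ D β) :
    𝔼 ℓ : P1 r, FF s κ (NN D (ext1 h ℓ) β) ≤ (1 + 2 * s) / 3 * FF s κ (NN D h β) := by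
  have hF := FF_nonneg s κ (NN D h β)
  by_cases hN : NN D h β ≤ κ
  · obtain ⟨b, hb, ℓ0, hℓ0⟩ := exists_splittable hβ hN
    have hp := prob_proper (conM D (β * cell h b)) ℓ0 hℓ0
    have hpt : ∀ ℓ : P1 r, FF s κ (NN D (ext1 h ℓ) β) ≤
        s * FF s κ (NN D h β) + (1 - s) * FF s κ (NN D h β) * ind (ℓ ∈ conM D (β * cell h b)) := by
      intro ℓ
      by_cases hℓ : ℓ ∈ conM D (β * cell h b)
      · rw [ind_true hℓ]
        have := FF_anti h0 h1 κ (NN_mono D h ℓ β)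
        linarith
      · rw [ind_false hℓ]
        have := FF_split h0 h1 κ (NN_split D h ℓ β b hb hℓ)
        linarith
    refine (expect_le_expect fun ℓ _ => hpt ℓ).trans ?_
    rw [expect_add_distrib, expect_const univ_nonempty, ← mul_expect]
    have : (1 - s) * FF s κ (NN D h β) * 𝔼 ℓ : P1 r, ind (ℓ ∈ conM D (β * cell h b)) ≤
        (1 - s) * FF s κ (NN D h β) * (1 / 3) :=
      mul_le_mul_of_nonneg_left hp (mul_nonneg (by linarith) hF)
    linarith
  · push Not at hN
    rw [FF_zero h0 h1 hN]
    have : ∀ ℓ : P1 r, FF s κ (NN D (ext1 h ℓ) β) = 0 := fun ℓ =>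
      FF_zero h0 h1 (lt_of_lt_of_le hN (NN_mono D h ℓ β))
    simp [this]

noncomputable def pot (s : ℝ) (κ D : ℕ) (W : Pt r → Pt r → ℝ) (M : Finset (Fn r)) (w : Fn r → ℝ)
    (h : Pt r → ι) : ℝ :=
  (∑ x, ∑ y, W x y * ind (x ≠ y ∧ h x = h y)) + ∑ β ∈ M, w β * FF s κ (NN D h β)


lemma coll_step {s : ℝ} (h0 : 0 ≤ s) (h : Pt r → ι) (x y : Pt r) :
    𝔼 ℓ : P1 r, ind (x ≠ y ∧ ext1 h (ℓ : Fn r) x = ext1 h ℓ y) ≤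
      (1 + 2 * s) / 3 * ind (x ≠ y ∧ h x = h y) := by
  by_cases hxy : x ≠ y ∧ h x = h y
  · rw [ind_true hxy]
    have h3 : 𝔼 ℓ : P1 r, ind (x ≠ y ∧ ext1 h (ℓ : Fn r) x = ext1 h ℓ y) ≤
        𝔼 ℓ : P1 r, ind ((ℓ : Fn r) x = (ℓ : Fn r) y) := by
      refine expect_le_expect fun ℓ _ => ind_mono ?_
      rintro ⟨-, h'⟩
      exact congrArg Prod.snd h'
    have h4 := prob_coll hxy.1
    linarith
  · rw [ind_false hxy, mul_zero]
    have : ∀ ℓ : P1 r, ind (x ≠ y ∧ ext1 h (ℓ : Fn r) x = ext1 h ℓ y) = 0 := by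
      intro ℓ; apply ind_false
      rintro ⟨h1, h2⟩
      exact hxy ⟨h1, congrArg Prod.fst h2⟩
    simp [this]

lemma pot_step {s : ℝ} (h0 : 0 ≤ s) (h1 : s ≤ 1) {κ D : ℕ} {W : Pt r → Pt r → ℝ} {M : Finset (Fn r)}
    {w : Fn r → ℝ} (hW : ∀ x y, 0 ≤ W x y) (hw : ∀ β ∈ M, 0 ≤ w β) (hM : ∀ β ∈ M, ¬ Sm κ D β)
    (h : Pt r → ι) :
    ∃ ℓ : P1 r, pot s κ D W M w (ext1 h ℓ) ≤ (1 + 2 * s) / 3 * pot s κ D W M w h := by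
  have key : 𝔼 ℓ : P1 r, pot s κ D W M w (ext1 h ℓ) ≤ (1 + 2 * s) / 3 * pot s κ D W M w h := by
    unfold pot
    rw [expect_add_distrib, expect_sum_comm, expect_sum_comm, mul_add, mul_sum, mul_sum]
    refine add_le_add (sum_le_sum fun x _ => ?_) (sum_le_sum fun β hβ => ?_)
    · rw [expect_sum_comm, mul_sum]
      refine sum_le_sum fun y _ => ?_
      rw [← mul_expect]
      have := coll_step h0 h x y
      calc _ ≤ W x y * ((1 + 2 * s) / 3 * ind (x ≠ y ∧ h x = h y)) :=
            mul_le_mul_of_nonneg_left this (hW x y)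
        _ = _ := by ring
    · rw [← mul_expect]
      calc _ ≤ w β * ((1 + 2 * s) / 3 * FF s κ (NN D h β)) :=
            mul_le_mul_of_nonneg_left (FF_step h0 h1 h (hM β hβ)) (hw β hβ)
        _ = _ := by ring
  obtain ⟨ℓ, -, hℓ⟩ := exists_le_of_expect_le univ_nonempty key
  exact ⟨ℓ, hℓ⟩
end hash

lemma hash_exists {s : ℝ} (h0 : 0 ≤ s) (h1 : s ≤ 1) {κ D : ℕ} {W : Pt r → Pt r → ℝ} {M : Finset (Fn r)}
    {w : Fn r → ℝ} (hW : ∀ x y, 0 ≤ W x y) (hw : ∀ β ∈ M, 0 ≤ w β) (hM : ∀ β ∈ M, ¬ Sm κ D β)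
    (j : ℕ) :
    ∃ (ι : Type) (_ : Fintype ι) (_ : DecidableEq ι) (h : Pt r → ι),
      (∀ b, cell h b ∈ P r (2 * j)) ∧
      pot s κ D W M w h ≤ ((1 + 2 * s) / 3) ^ j * ((∑ x, ∑ y, W x y) + ∑ β ∈ M, w β) := by
  induction j with
  | zero =>
    refine ⟨Unit, inferInstance, inferInstance, fun _ => (), fun b => ?_, ?_⟩
    · have : cell (fun _ : Pt r => ()) b = 1 := by ext; simp [cell]
      rw [this]; exact one_mem_P _
    · rw [pow_zero, one_mul]
      unfold pot
      refine add_le_add (sum_le_sum fun x _ => sum_le_sum fun y _ => ?_) (sum_le_sum fun β hβ => ?_)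
      · exact mul_le_of_le_one_right (hW x y) (ind_le_one _)
      · exact mul_le_of_le_one_right (hw β hβ) (FF_le_one h0 h1 _ _)
  | succ j ih =>
    obtain ⟨ι, i1, i2, h, hc, hp⟩ := ih
    obtain ⟨ℓ, hℓ⟩ := pot_step h0 h1 hW hw hM h
    refine ⟨ι × F3, inferInstance, inferInstance, ext1 h ℓ, ?_, ?_⟩
    · rintro ⟨b, c⟩
      rw [cell_ext1]
      exact P_mul_le (hc b) (eqi_mem ℓ.2 c) (by omega)
    · refine hℓ.trans ?_
      rw [pow_succ, mul_comm (_ ^ j), mul_assoc]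
      exact mul_le_mul_of_nonneg_left hp (by positivity)

/-! ### The multiplier `v` -/

lemma v_exists {ι : Type*} (T : Finset ι) (w : ι → ℝ) (hw : ∀ i ∈ T, 0 ≤ w i) (η : ι → Fn r)
    (W : Pt r → ℝ) (hW : ∀ x, 0 ≤ W x) (D E : ℕ) (h1 : ∀ i ∈ T, η i ∈ dl r D)
    (h2 : ∀ i ∈ T, η i ∉ dl r E) (hDE : D ≤ E) (M : ℕ) (hM : M ≤ D) (m : ℕ) (hm : m ≤ M) :
    ∃ v ∈ P r m, (2 / 3 : ℝ) ^ (M - m) * (∑ x, W x * ind (v x ≠ 0)) +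
        ∑ i ∈ T, w i * ind (η i * v ∈ dl r (E - m)) ≤
      (2 / 3 : ℝ) ^ M * ∑ x, W x + m * (1 / 3 : ℝ) ^ ((D - M) / 2) * ∑ i ∈ T, w i := by
  induction m with
  | zero =>
    refine ⟨1, one_mem_P _, ?_⟩
    have : ∑ i ∈ T, w i * ind (η i * 1 ∈ dl r (E - 0)) = 0 := by
      refine sum_eq_zero fun i hi => ?_
      rw [ind_false, mul_zero]
      rw [mul_one]; exact h2 i hi
    rw [this]
    simp [ind]
  | succ m ih =>
    obtain ⟨v, hv, hb⟩ := ih (by omega)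
    have key : 𝔼 ℓ : P1 r, ((2 / 3 : ℝ) ^ (M - (m + 1)) * (∑ x, W x * ind ((v * (ℓ : Fn r)) x ≠ 0)) +
        ∑ i ∈ T, w i * ind (η i * (v * (ℓ : Fn r)) ∈ dl r (E - (m + 1)))) ≤
        (2 / 3 : ℝ) ^ M * ∑ x, W x + (m + 1 : ℕ) * (1 / 3 : ℝ) ^ ((D - M) / 2) * ∑ i ∈ T, w i := by
      rw [expect_add_distrib, ← mul_expect, expect_sum_comm, expect_sum_comm]
      have e1 : ∀ x, 𝔼 ℓ : P1 r, W x * ind ((v * (ℓ : Fn r)) x ≠ 0) =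
          2 / 3 * (W x * ind (v x ≠ 0)) := by
        intro x
        rw [← mul_expect]
        by_cases hx : v x = 0
        · have : ∀ ℓ : P1 r, ind ((v * (ℓ : Fn r)) x ≠ 0) = 0 := by
            intro ℓ; apply ind_false; simp [hx]
          simp only [this]; rw [ind_false (by simpa using hx)]; simp
        · have : ∀ ℓ : P1 r, ind ((v * (ℓ : Fn r)) x ≠ 0) = ind ((ℓ : Fn r) x ≠ 0) := by
            intro ℓ; apply ind_congr; simp [hx]
          simp only [this]; rw [prob_zero, ind_true hx]; ring
      have e2 : ∀ i ∈ T, 𝔼 ℓ : P1 r, w i * ind (η i * (v * (ℓ : Fn r)) ∈ dl r (E - (m + 1))) ≤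
          w i * ind (η i * v ∈ dl r (E - m)) + (1 / 3 : ℝ) ^ ((D - M) / 2) * w i := by
        intro i hi
        rw [← mul_expect]
        have : 𝔼 ℓ : P1 r, ind (η i * (v * (ℓ : Fn r)) ∈ dl r (E - (m + 1))) ≤
            ind (η i * v ∈ dl r (E - m)) + (1 / 3 : ℝ) ^ ((D - M) / 2) := by
          by_cases h : η i * v ∈ dl r (E - m)
          · rw [ind_true h]
            refine (expect_le_expect fun ℓ _ => ind_le_one _).trans ?_
            rw [expect_const univ_nonempty]
            have : (0 : ℝ) ≤ (1 / 3 : ℝ) ^ ((D - M) / 2) := by positivity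
            linarith
          · rw [ind_false h, zero_add]
            have h3 : E - m = (E - (m + 1)) + 1 := by omega
            rw [h3] at h
            have h4 : η i * v ∈ dl r (D - m) := dl_mul (h1 i hi) hv (by omega)
            have := top_cor h4 h
            simp only [mul_assoc] at this
            refine this.trans (pow_le_pow_of_le_one (by norm_num) (by norm_num) (by omega))
        calc _ ≤ w i * (ind (η i * v ∈ dl r (E - m)) + (1 / 3 : ℝ) ^ ((D - M) / 2)) :=
              mul_le_mul_of_nonneg_left this (hw i hi)
          _ = _ := by ring
      simp only [e1]
      have e3 := sum_le_sum e2
      rw [sum_add_distrib, ← mul_sum] at e3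
      rw [← mul_sum]
      have e4 : (2 / 3 : ℝ) ^ (M - (m + 1)) * (2 / 3 * ∑ x, W x * ind (v x ≠ 0)) =
          (2 / 3 : ℝ) ^ (M - m) * (∑ x, W x * ind (v x ≠ 0)) := by
        rw [show M - m = (M - (m + 1)) + 1 by omega, pow_succ]; ring
      rw [e4]
      push_cast
      linarith
    obtain ⟨ℓ, -, hℓ⟩ := exists_le_of_expect_le univ_nonempty key
    refine ⟨v * (ℓ : Fn r), ?_, hℓ⟩
    exact P_mul hv (by rw [P_one]; exact ℓ.2)

end
end S5

open scoped BigOperators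
set_option linter.unusedVariables false
set_option linter.unusedSectionVars false
namespace S5
open Finset
section
variable {r : ℕ}
local notation "conj" => starRingEnd ℂ

lemma expect_prod_pi {α : Type*} [Fintype α] [DecidableEq α] (g : α → F3 → ℂ) :
    𝔼 f : α → F3, ∏ x, g x (f x) = ∏ x, 𝔼 t : F3, g x t := by
  simp only [Fintype.expect_eq_sum_div_card]
  rw [prod_div_distrib, prod_univ_sum, Fintype.piFinset_univ]
  simp

noncomputable def lam (d : ℕ) (β : Fn r) : ℂ := 𝔼 p : P r d, chi β (shift p 1)

noncomputable def tau (c : F3) : ℂ := 𝔼 t : F3, ee (c * (t ^ 2 + 1))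

lemma ee_sum {α : Type*} (s : Finset α) (g : α → F3) : ee (∑ x ∈ s, g x) = ∏ x ∈ s, ee (g x) := by
  classical
  induction s using Finset.induction_on with
  | empty => simp [ee_zero]
  | insert a s ha ih => rw [sum_insert ha, prod_insert ha, ee_add, ih]

lemma chi_prod (β f : Fn r) : chi β f = ∏ x, ee (β x * f x) := by
  rw [chi_eq, dotF, ee_sum]

lemma lam_low {d q : ℕ} (hq : 2 * q ≤ d) {β : Fn r} (hβ : supp β < 2 ^ (q + 1)) :
    lam d β = ∏ x, tau (β x) := by
  unfold lam tau
  rw [law (P r d) (sF β) ?_ (fun p => chi β (shift p 1)) ?_]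
  · rw [← expect_prod_pi (fun x t => ee (β x * (t ^ 2 + 1)))]
    refine expect_congr rfl fun f _ => ?_
    rw [chi_prod]
    simp [shift]
  · intro K
    obtain ⟨p, hp, h⟩ := interp q (sF β) hβ K
    exact ⟨p, P_mono hq hp, h⟩
  · intro f g h
    rw [chi_prod, chi_prod]
    refine prod_congr rfl fun x _ => ?_
    by_cases hx : β x = 0
    · simp [hx]
    · simp [shift, h x (mem_sF.2 hx)]

lemma shift_mem {d : ℕ} {p : Fn r} (hp : p ∈ P r d) (a : F3) : shift p a ∈ P r (2 * d) := by
  have : shift p a = a • (p * p + 1) := by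
    ext x; simp only [shift, Pi.smul_apply, Pi.add_apply, Pi.mul_apply, Pi.one_apply, smul_eq_mul]; ring
  rw [this]
  exact Submodule.smul_mem _ _ (add_mem (P_mul_le hp hp (by omega)) (one_mem_P _))

lemma lam_sq (d : ℕ) (β : Fn r) : ‖lam d β‖ ^ 2 ≤ 𝔼 s : P r d, ind (β * (s : Fn r) ∈ dl r d) := by
  classical
  have h1 : (lam d β) * conj (lam d β) =
      𝔼 s : P r d, chi β ((s : Fn r) * s) * if β * (s : Fn r) ∈ dl r d then 1 else 0 := by
    unfold lam
    rw [map_expect, expect_mul_expect]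
    have h2 : ∀ p : P r d, 𝔼 q : P r d, chi β (shift q 1) * conj (chi β (shift p 1)) =
        𝔼 s : P r d, chi β ((s : Fn r) * s) * chi (β * (s : Fn r)) ((2 : F3) • (p : Fn r)) := by
      intro p
      rw [← expect_trans p.2 (fun q : Fn r => chi β (shift q 1) * conj (chi β (shift p 1)))]
      refine expect_congr rfl fun s _ => ?_
      simp only [chi_eq]
      rw [dotF_mul, ← ee_neg, ← ee_add, ← ee_add, ← dotF_neg_right, ← dotF_add_right,
        ← dotF_add_right]
      congr 2
      ext x
      simp [shift]; ring
    rw [expect_comm]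
    simp only [h2]
    rw [expect_comm]
    refine expect_congr rfl fun s _ => ?_
    rw [← mul_expect]
    congr 1
    have h3 := expect_chi (P r d) ((2 : F3) • (β * (s : Fn r)))
    have h4 : ((2 : F3) • (β * (s : Fn r)) ∈ perp (P r d)) ↔ β * (s : Fn r) ∈ dl r d := by
      exact Submodule.smul_mem_iff _ (by decide)
    simp only [h4] at h3
    rw [← h3]
    refine expect_congr rfl fun p _ => ?_
    simp only [chi_eq, dotF_smul_left, dotF_smul_right]
  have h5 : ‖lam d β‖ ^ 2 = ‖(lam d β) * conj (lam d β)‖ := by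
    rw [norm_mul, RCLike.norm_conj]; ring
  rw [h5, h1]
  refine (RCLike.norm_expect_le (K := ℂ)).trans (expect_le_expect fun s _ => ?_)
  rw [norm_mul, norm_chi, one_mul]
  unfold ind
  split_ifs <;> simp

lemma prob_coset {X : Type*} [AddCommGroup X] [Fintype X] (V S : Submodule F3 (Fn r))
    (φ : X →+ Fn r) (hφ : ∀ x, φ x ∈ V) :
    𝔼 s : V, ind ((s : Fn r) ∈ S) ≤ 𝔼 x : X, ind (φ x ∈ S) := by
  calc 𝔼 s : V, ind ((s : Fn r) ∈ S) = 𝔼 _x : X, 𝔼 s : V, ind ((s : Fn r) ∈ S) := by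
        rw [expect_const univ_nonempty]
    _ = 𝔼 x : X, 𝔼 s : V, ind ((s : Fn r) + φ x ∈ S) :=
        expect_congr rfl fun x _ => (expect_trans (hφ x) (fun f => ind (f ∈ S))).symm
    _ = 𝔼 s : V, 𝔼 x : X, ind ((s : Fn r) + φ x ∈ S) := expect_comm _ _ _
    _ ≤ 𝔼 _s : V, 𝔼 x : X, ind (φ x ∈ S) := by
        refine expect_le_expect fun s _ => ?_
        by_cases h : ∃ x0, (s : Fn r) + φ x0 ∈ S
        · obtain ⟨x0, h0⟩ := h
          have : 𝔼 x : X, ind ((s : Fn r) + φ x ∈ S) = 𝔼 x : X, ind (φ x ∈ S) := by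
            symm
            refine Fintype.expect_equiv (Equiv.addRight x0) _ _ fun x => ind_congr ?_
            simp only [Equiv.coe_addRight, map_add]
            rw [show (s : Fn r) + (φ x + φ x0) = φ x + ((s : Fn r) + φ x0) by abel]
            exact (S.add_mem_iff_left h0).symm
          rw [this]
        · push Not at h
          have : ∀ x, ind ((s : Fn r) + φ x ∈ S) = 0 := fun x => ind_false (h x)
          simp only [this, expect_const_zero]
          exact expect_nonneg fun x _ => ind_nonneg _
    _ = _ := by rw [expect_const univ_nonempty]

lemma prob_ker {X T : Type*} [AddCommGroup X] [Fintype X] [AddCommGroup T] [Fintype T]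
    (L : AddSubgroup X) (res : X →+ T) :
    𝔼 x : X, ind (x ∈ L) ≤ (Fintype.card T : ℝ) * 𝔼 x : X, ind (x ∈ L ∧ res x = 0) := by
  classical
  have h1 : ∀ x : X, ind (x ∈ L) = ∑ t : T, ind (x ∈ L ∧ res x = t) := by
    intro x
    rw [sum_eq_single (res x)]
    · exact ind_congr (by simp)
    · intro t _ ht; exact ind_false fun h => ht h.2.symm
    · simp
  simp only [h1]
  rw [expect_sum_comm]
  have h2 : ∀ t : T, 𝔼 x : X, ind (x ∈ L ∧ res x = t) ≤ 𝔼 x : X, ind (x ∈ L ∧ res x = 0) := by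
    intro t
    by_cases h : ∃ x0, x0 ∈ L ∧ res x0 = t
    · obtain ⟨x0, h0, h0'⟩ := h
      refine le_of_eq ?_
      symm
      refine Fintype.expect_equiv (Equiv.addRight x0) _ _ fun x => ind_congr ?_
      simp only [Equiv.coe_addRight, map_add, h0', L.add_mem_cancel_right h0]
      simp
    · push Not at h
      have : ∀ x, ind (x ∈ L ∧ res x = t) = 0 := fun x => ind_false fun hx => h x hx.1 hx.2
      simp only [this, expect_const_zero]
      exact expect_nonneg fun x _ => ind_nonneg _
  refine (sum_le_sum fun t _ => h2 t).trans ?_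
  rw [sum_const, nsmul_eq_mul, card_univ]

lemma prob_mid {ι : Type} [Fintype ι] [DecidableEq ι] {d j D : ℕ} (hd : 2 * j + D ≤ d)
    (h : Pt r → ι) (hc : ∀ b, cell h b ∈ P r (2 * j)) (β : Fn r) :
    𝔼 s : P r d, ind (β * (s : Fn r) ∈ dl r d) ≤ (1 / 3 : ℝ) ^ (NN D h β) := by
  classical
  let Bd := {b : ι // β * cell h b ∉ dl r D}
  let φ : (Bd → F3) →+ Fn r :=
    { toFun := fun t => ∑ b : Bd, t b • cell h b
      map_zero' := by simp
      map_add' := by intro s t; simp [add_smul, sum_add_distrib] }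
  have hφ : ∀ t, φ t ∈ P r d := fun t => Submodule.sum_mem _ fun b _ =>
    Submodule.smul_mem _ _ (P_mono (by omega) (hc b))
  refine (prob_coset (P r d) (mker β d) φ hφ).trans ?_
  have h1 : ∀ t : Bd → F3, ind (φ t ∈ mker β d) ≤ if t = 0 then 1 else 0 := by
    intro t
    by_cases ht : t = 0
    · rw [if_pos ht]; exact ind_le_one _
    · rw [if_neg ht, ind_false]
      intro hmem
      obtain ⟨b, hb⟩ := Function.ne_iff.1 ht
      have hb2 : ¬ ∀ p ∈ P r D, dotF (β * cell h b) p = 0 := b.2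
      push Not at hb2
      obtain ⟨p, hp, hne⟩ := hb2
      have h3 := hmem (cell h b * p) (P_mul_le (hc b) hp hd)
      have h4 : β * φ t * cell h b = t b • (β * cell h b) := by
        ext x
        simp only [φ, AddMonoidHom.coe_mk, ZeroHom.coe_mk, Pi.mul_apply, Finset.sum_apply,
          Pi.smul_apply, smul_eq_mul, cell]
        by_cases hx : h x = b
        · rw [sum_eq_single b]
          · simp [hx]; ring
          · intro c _ hcb
            rw [if_neg, mul_zero]
            rw [hx]; exact fun h' => hcb (Subtype.ext h'.symm)
          · simp
        · simp [hx]
      rw [← dotF_mul, h4, dotF_smul_left] at h3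
      rcases mul_eq_zero.1 h3 with h5 | h5
      · exact hb h5
      · exact hne h5
  refine (expect_le_expect fun t _ => h1 t).trans ?_
  rw [Fintype.expect_eq_sum_div_card]
  rw [sum_ite_eq', if_pos (mem_univ _)]
  have h2 : (Fintype.card (Bd → F3) : ℝ) = 3 ^ NN D h β := by
    rw [Fintype.card_fun, ZMod.card]
    unfold NN
    rw [Fintype.card_subtype]; push_cast; rfl
  rw [h2, one_div_pow]

lemma exists_mult {η : Fn r} {a b : ℕ} (h : η ∉ dl r (a + b)) : ∃ w ∈ P r a, η * w ∉ dl r b := by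
  by_contra hcon
  push Not at hcon
  apply h
  intro g hg
  unfold P at hg
  rw [pow_add] at hg
  refine Submodule.mul_induction_on hg ?_ ?_
  · intro w hw q hq
    rw [← dotF_mul]; exact hcon w hw q hq
  · intro x y hx hy; rw [dotF_add_right, hx, hy, add_zero]

lemma prob_top {d D κ : ℕ} (hD : D ≤ d) (hd : 1 ≤ d) {β β' : Fn r} (hs : supp β' ≤ κ) (h1 : β - β' ∈ dl r D)
    (h2 : β - β' ∉ dl r (2 * d)) :
    𝔼 s : P r d, ind (β * (s : Fn r) ∈ dl r d) ≤ 3 ^ κ * (1 / 3 : ℝ) ^ (D / 2) := by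
  classical
  set η := β - β' with hη
  obtain ⟨e, he1, he2, he3, he4⟩ := exists_level h1 h2
  obtain ⟨w, hw, e', hee1, hee2, hw3, hw4⟩ : ∃ w ∈ P r (d - 1), ∃ e', D ≤ e' ∧ e' ≤ d ∧
      η * w ∈ dl r e' ∧ η * w ∉ dl r (e' + 1) := by
    by_cases hed : e ≤ d
    · exact ⟨1, one_mem_P _, e, he1, hed, by rwa [mul_one], by rwa [mul_one]⟩
    · rw [show e + 1 = (e - d) + (d + 1) by omega] at he4
      obtain ⟨w, hw, hw'⟩ := exists_mult he4
      exact ⟨w, P_mono (by omega) hw, d, hD, le_rfl, dl_mul he3 hw (by omega), hw'⟩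
  let φ : P1 r →+ Fn r :=
    { toFun := fun ℓ => w * (ℓ : Fn r)
      map_zero' := by simp
      map_add' := by intro a b; simp [mul_add] }
  have hφ : ∀ ℓ, φ ℓ ∈ P r d := fun ℓ =>
    P_mul_le (D := d - 1) (E := 1) hw (by rw [P_one]; exact ℓ.2) (by omega)
  refine (prob_coset (P r d) (mker β d) φ hφ).trans ?_
  let res : P1 r →+ (sF β' → F3) :=
    { toFun := fun ℓ x => w x * (ℓ : Fn r) x
      map_zero' := by ext; simp
      map_add' := by intro a b; ext; simp [mul_add] }
  refine (prob_ker ((mker β d).toAddSubgroup.comap φ) res).trans ?_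
  have h3 : (Fintype.card (sF β' → F3) : ℝ) ≤ 3 ^ κ := by
    rw [Fintype.card_fun, ZMod.card, Fintype.card_coe]
    push_cast
    exact pow_le_pow_right₀ (by norm_num) hs
  have h4 : 𝔼 ℓ : P1 r, ind (ℓ ∈ (mker β d).toAddSubgroup.comap φ ∧ res ℓ = 0) ≤
      (1 / 3 : ℝ) ^ (D / 2) := by
    have h5 : 𝔼 ℓ : P1 r, ind (ℓ ∈ (mker β d).toAddSubgroup.comap φ ∧ res ℓ = 0) ≤
        𝔼 ℓ : P1 r, ind (η * w * (ℓ : Fn r) ∈ dl r e') := by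
      refine expect_le_expect fun ℓ _ => ind_mono ?_
      rintro ⟨h6, h7⟩
      have h8 : β * (w * (ℓ : Fn r)) ∈ dl r d := h6
      have h9 : η * w * (ℓ : Fn r) = β * (w * (ℓ : Fn r)) := by
        ext x
        by_cases hx : β' x = 0
        · simp [hη, hx]; ring
        · have : w x * (ℓ : Fn r) x = 0 := congrFun h7 ⟨x, mem_sF.2 hx⟩
          simp [mul_assoc, this]
      rw [h9]; exact dl_anti hee2 h8
    refine h5.trans ((top_lemma (η * w) e' hw3 hw4).trans ?_)
    exact pow_le_pow_of_le_one (by norm_num) (by norm_num) (by omega)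
  exact mul_le_mul h3 h4 (expect_nonneg fun x _ => ind_nonneg _) (by positivity)

lemma lam_high {d D κ j : ℕ} (hd : 2 * j + D ≤ d) (hd1 : 1 ≤ d) (hκ : 2 * κ + 1 ≤ D / 2)
    (hj : (2 / 3 : ℝ) ^ j < (1 / 2) ^ (κ + 1)) {β : Fn r} (hβ : ¬ Sm κ (2 * d) β) :
    ‖lam d β‖ ^ 2 ≤ (1 / 3 : ℝ) ^ (κ + 1) := by
  refine (lam_sq d β).trans ?_
  by_cases hS : Sm κ D β
  · obtain ⟨β', h1, h2⟩ := hS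
    refine (prob_top (by omega) hd1 h1 h2 fun h => hβ ⟨β', h1, h⟩).trans ?_
    calc (3 : ℝ) ^ κ * (1 / 3) ^ (D / 2) ≤ 3 ^ κ * (1 / 3) ^ (κ + (κ + 1)) := by
          refine mul_le_mul_of_nonneg_left ?_ (by positivity)
          exact pow_le_pow_of_le_one (by norm_num) (by norm_num) (by omega)
      _ = _ := by rw [pow_add, ← mul_assoc, ← mul_pow]; norm_num
  · obtain ⟨ι, i1, i2, h, hc, hp⟩ := hash_exists (s := 1 / 2) (κ := κ) (D := D) (W := fun _ _ => 0)
      (M := {β}) (w := fun _ => 1) (by norm_num) (by norm_num) (fun _ _ => le_rfl)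
      (fun _ _ => by norm_num) (by simpa using hS) j
    have hp' : FF (1 / 2) κ (NN D h β) ≤ (2 / 3 : ℝ) ^ j := by
      unfold pot at hp
      norm_num at hp ⊢
      exact hp
    refine (prob_mid hd h hc β).trans (pow_le_pow_of_le_one (by norm_num) (by norm_num) ?_)
    by_contra hlt
    push Not at hlt
    have h3 : (1 / 2 : ℝ) ^ κ ≤ (1 / 2) ^ (NN D h β) :=
      pow_le_pow_of_le_one (by norm_num) (by norm_num) (by omega)
    have h4 : (1 / 2 : ℝ) ^ (κ + 1) ≤ FF (1 / 2) κ (NN D h β) := by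
      refine le_trans ?_ (le_max_left _ _)
      rw [pow_succ] at *
      linarith
    linarith
end
end S5

open scoped BigOperators
set_option linter.unusedVariables false
set_option linter.unusedSectionVars false
namespace S5
open Finset
section
variable {r : ℕ}
local notation "conj" => starRingEnd ℂ

lemma expect_nonneg' {ι : Type*} [Fintype ι] {F : ι → ℝ} (h : ∀ i, 0 ≤ F i) : 0 ≤ 𝔼 i, F i :=
  expect_nonneg fun i _ => h i

lemma expect_le_const {ι : Type*} [Fintype ι] [Nonempty ι] {F : ι → ℝ} {c : ℝ} (h : ∀ i, F i ≤ c) :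
    𝔼 i, F i ≤ c := by
  calc 𝔼 i, F i ≤ 𝔼 _i : ι, c := expect_le_expect fun i _ => h i
    _ = c := expect_const univ_nonempty _

lemma chi_mul_swap (β v g : Fn r) : chi β (v * g) = chi (β * v) g := by
  rw [chi_eq, chi_eq, dotF_mul]

/-- averaging along a family of directions `v * g` -/
lemma avg_dir {F D : ℕ} {v : Fn r} (hv : ∀ g ∈ P r D, v * g ∈ P r F) (A : Fn r → ℝ)
    (hA : ∀ f ∈ P r F, 0 ≤ A f ∧ A f ≤ 1) :
    ∃ A' : Fn r → ℝ, (∀ f ∈ P r F, 0 ≤ A' f ∧ A' f ≤ 1) ∧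
      ∀ β, hat (P r F) (fun f => (A' f : ℂ)) β =
        (ind (β * v ∈ dl r D) : ℂ) * hat (P r F) (fun f => (A f : ℂ)) β := by
  refine ⟨fun f => 𝔼 g : P r D, A (f + v * g), fun f hf => ⟨?_, ?_⟩, fun β => ?_⟩
  · exact expect_nonneg' fun g => (hA _ (add_mem hf (hv g g.2))).1
  · exact expect_le_const fun g => (hA _ (add_mem hf (hv g g.2))).2
  · have h := hat_noise (V := P r F) (fun f => (A f : ℂ)) (fun g : P r D => v * (g : Fn r))
      (fun g => hv g g.2) β
    simp only [chi_mul_swap] at h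
    rw [expect_chi] at h
    push_cast
    rw [h, mul_comm]
    congr 1
    unfold ind dl
    split_ifs <;> simp

lemma avg_cells {ι : Type} [Fintype ι] [DecidableEq ι] {s : ℝ} (h0 : 0 ≤ s) (h1 : s ≤ 1) {F j D : ℕ}
    (hF : 2 * j + D ≤ F) (h : Pt r → ι) (hc : ∀ b, cell h b ∈ P r (2 * j)) (A : Fn r → ℝ)
    (hA : ∀ f ∈ P r F, 0 ≤ A f ∧ A f ≤ 1) (T : Finset ι) :
    ∃ A' : Fn r → ℝ, (∀ f ∈ P r F, 0 ≤ A' f ∧ A' f ≤ 1) ∧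
      ∀ β, hat (P r F) (fun f => (A' f : ℂ)) β =
        ((∏ b ∈ T, (s + (1 - s) * ind (β * cell h b ∈ dl r D)) : ℝ) : ℂ) *
          hat (P r F) (fun f => (A f : ℂ)) β := by
  induction T using Finset.induction_on with
  | empty => exact ⟨A, hA, fun β => by simp⟩
  | insert b T hb ih =>
    obtain ⟨A1, hA1, hh1⟩ := ih
    obtain ⟨A2, hA2, hh2⟩ := avg_dir (F := F) (D := D) (v := cell h b)
      (fun g hg => P_mul_le (hc b) hg hF) A1 hA1
    refine ⟨fun f => s * A1 f + (1 - s) * A2 f, fun f hf => ⟨?_, ?_⟩, fun β => ?_⟩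
    · have := (hA1 f hf).1; have := (hA2 f hf).1
      have : 0 ≤ 1 - s := by linarith
      positivity
    · have := (hA1 f hf).2; have := (hA2 f hf).2
      nlinarith
    · push_cast
      rw [hat_add, hat_smul, hat_smul, hh2, hh1, prod_insert hb]
      push_cast
      ring

lemma prod_NN {ι : Type} [Fintype ι] [DecidableEq ι] (s : ℝ) (D : ℕ) (h : Pt r → ι) (β : Fn r) :
    ∏ b, (s + (1 - s) * ind (β * cell h b ∈ dl r D)) = s ^ NN D h β := by
  classical
  unfold NN
  rw [← prod_const, prod_filter]
  refine prod_congr rfl fun b _ => ?_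
  by_cases hb : β * cell h b ∈ dl r D
  · rw [ind_true hb, if_neg (by simpa using hb)]; ring
  · rw [ind_false hb, if_pos hb]; ring

lemma NN_of_inj {ι : Type} [Fintype ι] [DecidableEq ι] (D : ℕ) (h : Pt r → ι) (β : Fn r)
    (hinj : ∀ x y, β x ≠ 0 → β y ≠ 0 → x ≠ y → h x ≠ h y) : NN D h β = supp β := by
  classical
  rw [supp_eq]
  unfold NN
  rw [← card_image_of_injOn (s := sF β) (f := h)]
  · congr 1
    ext b
    simp only [mem_filter, mem_univ, true_and, mem_image, mem_sF]
    constructor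
    · intro hb
      by_contra hcon
      push Not at hcon
      apply hb
      have : β * cell h b = 0 := by
        ext x
        by_cases hx : β x = 0
        · simp [hx]
        · simp [cell, hcon x hx]
      rw [this]; exact zero_mem _
    · rintro ⟨x, hx, rfl⟩ hmem
      have h1 : ∀ y, y ≠ x → (β * cell h (h x)) y = 0 := by
        intro y hy
        by_cases hyy : β y = 0
        · simp [hyy]
        · simp [cell, hinj y x hyy hx hy]
      refine interp_dual 0 (β * cell h (h x)) ?_ ?_ (dl_anti (Nat.zero_le _) hmem)
      · intro h0
        have := congrFun h0 x
        simp [cell] at this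
        exact hx this
      · rw [supp_eq]
        refine lt_of_le_of_lt (card_le_card (t := {x}) ?_) (by simp)
        intro y hy
        rw [mem_sF] at hy
        by_contra hne
        exact hy (h1 y (by simpa using hne))
  · intro x hx y hy hxy
    by_contra hne
    exact hinj x y (mem_sF.1 hx) (mem_sF.1 hy) hne hxy

lemma ind_le_sum {α : Type*} [Fintype α] (Q : α → Prop) : ind (∃ x, Q x) ≤ ∑ x, ind (Q x) := by
  by_cases h : ∃ x, Q x
  · obtain ⟨x, hx⟩ := h
    refine (ind_le_one _).trans ?_
    rw [← ind_true hx]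
    exact single_le_sum (f := fun x => ind (Q x)) (fun y _ => ind_nonneg _) (mem_univ x)
  · rw [ind_false h]; exact sum_nonneg fun x _ => ind_nonneg _

lemma sum_ind_supp (β : Fn r) : ∑ x, ind (β x ≠ 0) = supp β := by
  classical
  rw [supp_eq, sF, card_filter]
  push_cast
  refine sum_congr rfl fun x _ => ?_
  unfold ind; split_ifs <;> rfl

noncomputable def base (κ D : ℕ) (β : Fn r) : Fn r := by
  classical
  exact if supp β ≤ κ then β else if h : Sm κ D β then h.choose else 0

lemma base_low {κ D : ℕ} {β : Fn r} (h : supp β ≤ κ) : base κ D β = β := by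
  unfold base; rw [if_pos h]

lemma base_supp (κ D : ℕ) (β : Fn r) : supp (base κ D β) ≤ κ := by
  unfold base
  split_ifs with h1 h2
  · exact h1
  · exact h2.choose_spec.1
  · rw [supp_eq_zero.2 rfl]; omega

lemma base_dl {κ D : ℕ} {β : Fn r} (h : Sm κ D β) : β - base κ D β ∈ dl r D := by
  unfold base
  split_ifs with h1
  · simp
  · exact h.choose_spec.2

lemma sq_le_of_unit {x y : ℝ} (hx0 : 0 ≤ x) (hx1 : x ≤ 1) (hy0 : 0 ≤ y) (hy1 : y ≤ 1) :
    (x - y) ^ 2 ≤ 1 := by nlinarith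

lemma err_bound {ι : Type} [Fintype ι] [DecidableEq ι] {s : ℝ} (h0 : 0 ≤ s) (h1 : s ≤ 1)
    {κ D E m : ℕ} (h : Pt r → ι) (v β : Fn r) :
    (s ^ NN D h β * ind (β * v ∈ dl r (E - m)) - ind (supp β ≤ κ) * s ^ supp β) ^ 2 ≤
      ind (supp β ≤ κ) * (∑ x, ∑ y, ind (β x ≠ 0 ∧ β y ≠ 0) * ind (x ≠ y ∧ h x = h y)) +
      (∑ x, ind (base κ D β x ≠ 0) * ind (v x ≠ 0)) +
      ind (¬ Sm κ D β) * (s ^ (κ + 1) + FF s κ (NN D h β)) +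
      ind (¬ supp β ≤ κ ∧ Sm κ D β) * ind ((β - base κ D β) * v ∈ dl r (E - m)) := by
  have hN0 : 0 ≤ s ^ NN D h β := by positivity
  have hN1 : s ^ NN D h β ≤ 1 := pow_le_one₀ h0 h1
  have hS0 : 0 ≤ s ^ supp β := by positivity
  have hS1 : s ^ supp β ≤ 1 := pow_le_one₀ h0 h1
  have hi0 := ind_nonneg (β * v ∈ dl r (E - m))
  have hi1 := ind_le_one (β * v ∈ dl r (E - m))
  have hp0 : 0 ≤ s ^ NN D h β * ind (β * v ∈ dl r (E - m)) := mul_nonneg hN0 hi0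
  have hp1 : s ^ NN D h β * ind (β * v ∈ dl r (E - m)) ≤ 1 := mul_le_one₀ hN1 hi0 hi1
  have hc0 : 0 ≤ ∑ x, ∑ y, ind (β x ≠ 0 ∧ β y ≠ 0) * ind (x ≠ y ∧ h x = h y) :=
    sum_nonneg fun x _ => sum_nonneg fun y _ => mul_nonneg (ind_nonneg _) (ind_nonneg _)
  have hv0 : 0 ≤ ∑ x, ind (base κ D β x ≠ 0) * ind (v x ≠ 0) :=
    sum_nonneg fun x _ => mul_nonneg (ind_nonneg _) (ind_nonneg _)
  have hvb : (∃ x, base κ D β x ≠ 0 ∧ v x ≠ 0) →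
      1 ≤ ∑ x, ind (base κ D β x ≠ 0) * ind (v x ≠ 0) := by
    rintro ⟨x, hx, hx'⟩
    calc (1 : ℝ) = ind (base κ D β x ≠ 0) * ind (v x ≠ 0) := by
          rw [ind_true hx, ind_true hx', one_mul]
      _ ≤ _ := single_le_sum (f := fun x => ind (base κ D β x ≠ 0) * ind (v x ≠ 0))
          (fun y _ => mul_nonneg (ind_nonneg _) (ind_nonneg _)) (mem_univ x)
  by_cases hlow : supp β ≤ κ
  · have hSm : Sm κ D β := ⟨β, hlow, by simp⟩
    rw [ind_true hlow, ind_false (not_not.2 hSm), ind_false (Q := ¬ supp β ≤ κ ∧ Sm κ D β) (fun hh => hh.1 hlow), one_mul, one_mul]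
    by_cases hv : ∃ x, base κ D β x ≠ 0 ∧ v x ≠ 0
    · have := hvb hv
      have := sq_le_of_unit hp0 hp1 hS0 hS1
      linarith
    · by_cases hcol : ∃ x y, β x ≠ 0 ∧ β y ≠ 0 ∧ x ≠ y ∧ h x = h y
      · obtain ⟨x, y, hx, hy, hxy, hh⟩ := hcol
        have h2 : (1 : ℝ) ≤ ∑ x, ∑ y, ind (β x ≠ 0 ∧ β y ≠ 0) * ind (x ≠ y ∧ h x = h y) := by
          calc (1 : ℝ) = ind (β x ≠ 0 ∧ β y ≠ 0) * ind (x ≠ y ∧ h x = h y) := by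
                rw [ind_true ⟨hx, hy⟩, ind_true ⟨hxy, hh⟩, one_mul]
            _ ≤ ∑ y, ind (β x ≠ 0 ∧ β y ≠ 0) * ind (x ≠ y ∧ h x = h y) :=
                single_le_sum (f := fun y => ind (β x ≠ 0 ∧ β y ≠ 0) * ind (x ≠ y ∧ h x = h y))
                  (fun y _ => mul_nonneg (ind_nonneg _) (ind_nonneg _)) (mem_univ y)
            _ ≤ _ := single_le_sum
                (f := fun x => ∑ y, ind (β x ≠ 0 ∧ β y ≠ 0) * ind (x ≠ y ∧ h x = h y))
                (fun x _ => sum_nonneg fun y _ => mul_nonneg (ind_nonneg _) (ind_nonneg _))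
                (mem_univ x)
        have := sq_le_of_unit hp0 hp1 hS0 hS1
        linarith
      · have hNN : NN D h β = supp β := NN_of_inj D h β fun x y hx hy hxy hh =>
          hcol ⟨x, y, hx, hy, hxy, hh⟩
        rw [base_low hlow] at hv
        have hz : β * v = 0 := by
          ext x
          by_contra hx
          exact hv ⟨x, left_ne_zero_of_mul hx, right_ne_zero_of_mul hx⟩
        rw [hNN, hz, ind_true (zero_mem _)]
        simp only [mul_one, sub_self]
        simp only [ne_eq, OfNat.ofNat_ne_zero, not_false_eq_true, zero_pow]
        linarith
  · rw [ind_false hlow, zero_mul, zero_mul, sub_zero, zero_add]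
    by_cases hSm : Sm κ D β
    · rw [ind_false (not_not.2 hSm), ind_true (Q := ¬ supp β ≤ κ ∧ Sm κ D β) ⟨hlow, hSm⟩, zero_mul, add_zero, one_mul]
      by_cases hv : ∃ x, base κ D β x ≠ 0 ∧ v x ≠ 0
      · have := hvb hv
        have := ind_nonneg ((β - base κ D β) * v ∈ dl r (E - m))
        nlinarith
      · have hz : (β - base κ D β) * v = β * v := by
          ext x
          by_cases hx : base κ D β x = 0
          · simp [hx]
          · have : v x = 0 := by by_contra hne; exact hv ⟨x, hx, hne⟩
            simp [this]
        rw [hz, mul_pow, ind_sq]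
        have : (s ^ NN D h β) ^ 2 ≤ 1 := pow_le_one₀ hN0 hN1
        nlinarith
    · rw [ind_true hSm, ind_false (Q := ¬ supp β ≤ κ ∧ Sm κ D β) (fun hh => hSm hh.2), one_mul, zero_mul, add_zero]
      have h3 : s ^ NN D h β ≤ s ^ (κ + 1) + FF s κ (NN D h β) := by
        have : s ^ NN D h β - s ^ (κ + 1) ≤ FF s κ (NN D h β) := le_max_left _ _
        linarith
      have h4 : (s ^ NN D h β * ind (β * v ∈ dl r (E - m))) ^ 2 ≤ s ^ NN D h β := by
        nlinarith
      linarith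

/-- the truncated, noise-damped Fourier coefficients -/
noncomputable def tc (s : ℝ) (κ : ℕ) (V : Submodule F3 (Fn r)) (A : Fn r → ℝ) (β : Fn r) : ℂ :=
  ((ind (supp β ≤ κ) * s ^ supp β : ℝ) : ℂ) * hat V (fun f => (A f : ℂ)) β

lemma sum_ind_pair {κ : ℕ} {β : Fn r} (h : supp β ≤ κ) :
    ∑ x, ∑ y, ind (β x ≠ 0 ∧ β y ≠ 0) ≤ (κ : ℝ) ^ 2 := by
  have h1 : ∀ x y, ind (β x ≠ 0 ∧ β y ≠ 0) = ind (β x ≠ 0) * ind (β y ≠ 0) := by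
    intro x y
    by_cases hx : β x ≠ 0
    · rw [ind_true hx, one_mul]; exact ind_congr (by simp [hx])
    · rw [ind_false hx, zero_mul]; exact ind_false fun h => hx h.1
  simp only [h1]
  rw [← sum_mul_sum, sum_ind_supp, ← sq]
  have : (supp β : ℝ) ≤ κ := by exact_mod_cast h
  gcongr

lemma smoothing {s : ℝ} (h0 : 0 ≤ s) (h1 : s ≤ 1) {κ F j D M : ℕ} (hF : 2 * j + D ≤ F) (hM : M ≤ D)
    {Λ : Finset (Fn r)} (hΛ : Reps (P r F) Λ)
    (hmin : ∀ β ∈ Λ, ∀ γ : Fn r, β - γ ∈ dl r F → supp β ≤ supp γ)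
    (A : Fn r → ℝ) (hA : ∀ f ∈ P r F, 0 ≤ A f ∧ A f ≤ 1) :
    ∃ A' : Fn r → ℝ, (∀ f ∈ P r F, 0 ≤ A' f ∧ A' f ≤ 1) ∧
      𝔼 f : P r F, ‖(A' f : ℂ) - ∑ β ∈ Λ, tc s κ (P r F) A β * chi β f‖ ^ 2 ≤
        ((1 + 2 * s) / 3) ^ j * ((κ : ℝ) ^ 2 + 1) + s ^ (κ + 1) + (2 / 3) ^ M * κ +
          M * (1 / 3) ^ ((D - M) / 2) := by
  classical
  set V := P r F with hV
  set p : Fn r → ℝ := fun β => ‖hat V (fun f => (A f : ℂ)) β‖ ^ 2 with hp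
  have hp0 : ∀ β, 0 ≤ p β := fun β => by positivity
  have hp1 : ∑ β ∈ Λ, p β ≤ 1 := by
    rw [hp, ← parseval_hat hΛ]
    refine expect_le_const fun f => ?_
    rw [Complex.norm_real, Real.norm_eq_abs, sq_abs]
    have := hA f f.2
    nlinarith
  set Lw := Λ.filter fun β => supp β ≤ κ
  set Md := Λ.filter fun β => ¬ Sm κ D β
  set Tp := Λ.filter fun β => ¬ supp β ≤ κ ∧ Sm κ D β
  have hsub : ∀ (Q : Fn r → Prop) [DecidablePred Q], ∑ β ∈ Λ.filter Q, p β ≤ 1 := fun Q _ =>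
    (sum_le_sum_of_subset_of_nonneg (filter_subset _ _) fun _ _ _ => hp0 _).trans hp1
  obtain ⟨ι, i1, i2, h, hc, hpot⟩ := hash_exists (s := s) (κ := κ) (D := D)
    (W := fun x y => ∑ β ∈ Lw, p β * ind (β x ≠ 0 ∧ β y ≠ 0)) (M := Md) (w := p) h0 h1
    (fun x y => sum_nonneg fun β _ => mul_nonneg (hp0 β) (ind_nonneg _)) (fun β _ => hp0 β)
    (fun β hβ => (mem_filter.1 hβ).2) j
  have hpotb : (∑ x, ∑ y, ∑ β ∈ Lw, p β * ind (β x ≠ 0 ∧ β y ≠ 0)) + ∑ β ∈ Md, p β ≤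
      (κ : ℝ) ^ 2 + 1 := by
    refine add_le_add ?_ (hsub _)
    have : ∑ x : Pt r, ∑ y : Pt r, ∑ β ∈ Lw, p β * ind (β x ≠ 0 ∧ β y ≠ 0) =
        ∑ β ∈ Lw, p β * ∑ x, ∑ y, ind (β x ≠ 0 ∧ β y ≠ 0) := by
      simp only [mul_sum]
      rw [sum_comm]
      rw [sum_congr rfl fun y _ => sum_comm]
      rw [sum_comm]
      refine sum_congr rfl fun β _ => sum_comm
    rw [this]
    calc ∑ β ∈ Lw, p β * ∑ x, ∑ y, ind (β x ≠ 0 ∧ β y ≠ 0) ≤ ∑ β ∈ Lw, p β * (κ : ℝ) ^ 2 :=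
          sum_le_sum fun β hβ => mul_le_mul_of_nonneg_left (sum_ind_pair (mem_filter.1 hβ).2) (hp0 β)
      _ = (∑ β ∈ Lw, p β) * (κ : ℝ) ^ 2 := by rw [sum_mul]
      _ ≤ 1 * (κ : ℝ) ^ 2 := mul_le_mul_of_nonneg_right (hsub _) (by positivity)
      _ = _ := one_mul _
  obtain ⟨v, hv, hvb⟩ := v_exists Tp p (fun β _ => hp0 β) (fun β => β - base κ D β)
    (fun x => ∑ β ∈ Λ, p β * ind (base κ D β x ≠ 0))
    (fun x => sum_nonneg fun β _ => mul_nonneg (hp0 β) (ind_nonneg _)) D F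
    (fun β hβ => base_dl (mem_filter.1 hβ).2.2)
    (fun β hβ hh => (mem_filter.1 hβ).2.1
      ((hmin β (mem_filter.1 hβ).1 _ hh).trans (base_supp _ _ _))) (by omega) M hM M le_rfl
  obtain ⟨A1, hA1, hh1⟩ := avg_cells h0 h1 hF h hc A hA univ
  obtain ⟨A2, hA2, hh2⟩ := avg_dir (F := F) (D := F - M) (v := v)
      (fun g hg => P_mul_le hv hg (by omega)) A1 hA1
  refine ⟨A2, hA2, ?_⟩
  have e1 : ∀ f : V, (A2 f : ℂ) - ∑ β ∈ Λ, tc s κ V A β * chi β f =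
      ∑ β ∈ Λ, (hat V (fun f => (A2 f : ℂ)) β - tc s κ V A β) * chi β f := by
    intro f
    rw [inversion hΛ (fun f => (A2 f : ℂ)) f.2, ← sum_sub_distrib]
    exact sum_congr rfl fun β _ => by ring
  simp only [e1]
  rw [parseval_sum hΛ]
  have e2 : ∀ β, ‖hat V (fun f => (A2 f : ℂ)) β - tc s κ V A β‖ ^ 2 =
      p β * (s ^ NN D h β * ind (β * v ∈ dl r (F - M)) - ind (supp β ≤ κ) * s ^ supp β) ^ 2 := by
    intro β
    rw [hh2, hh1, prod_NN, tc, hp]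
    have : (ind (β * v ∈ dl r (F - M)) : ℂ) * (((s ^ NN D h β : ℝ) : ℂ) *
        hat (P r F) (fun f => (A f : ℂ)) β) - ((ind (supp β ≤ κ) * s ^ supp β : ℝ) : ℂ) *
        hat V (fun f => (A f : ℂ)) β = ((s ^ NN D h β * ind (β * v ∈ dl r (F - M)) -
          ind (supp β ≤ κ) * s ^ supp β : ℝ) : ℂ) * hat V (fun f => (A f : ℂ)) β := by
      push_cast; ring
    rw [this, norm_mul, Complex.norm_real, mul_pow, Real.norm_eq_abs, sq_abs, mul_comm]
  have e3 : ∀ (Q : Fn r → Prop) [DecidablePred Q], ∀ g : Fn r → ℝ,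
      ∑ β ∈ Λ, p β * (ind (Q β) * g β) = ∑ β ∈ Λ.filter Q, p β * g β := by
    intro Q _ g
    rw [sum_filter]
    refine sum_congr rfl fun β _ => ?_
    by_cases hq : Q β
    · rw [if_pos hq, ind_true hq, one_mul]
    · rw [if_neg hq, ind_false hq, zero_mul, mul_zero]
  calc ∑ β ∈ Λ, ‖hat V (fun f => (A2 f : ℂ)) β - tc s κ V A β‖ ^ 2
      ≤ ∑ β ∈ Λ, p β * (ind (supp β ≤ κ) * (∑ x, ∑ y, ind (β x ≠ 0 ∧ β y ≠ 0) * ind (x ≠ y ∧ h x = h y)) +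
      (∑ x, ind (base κ D β x ≠ 0) * ind (v x ≠ 0)) +
      ind (¬ Sm κ D β) * (s ^ (κ + 1) + FF s κ (NN D h β)) +
      ind (¬ supp β ≤ κ ∧ Sm κ D β) * ind ((β - base κ D β) * v ∈ dl r (F - M))) := by
        refine sum_le_sum fun β _ => ?_
        rw [e2]
        exact mul_le_mul_of_nonneg_left (err_bound h0 h1 h v β) (hp0 β)
    _ = ∑ β ∈ Lw, p β * (∑ x, ∑ y, ind (β x ≠ 0 ∧ β y ≠ 0) * ind (x ≠ y ∧ h x = h y)) +
        ∑ β ∈ Λ, p β * (∑ x, ind (base κ D β x ≠ 0) * ind (v x ≠ 0)) +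
        ∑ β ∈ Md, p β * (s ^ (κ + 1) + FF s κ (NN D h β)) +
        ∑ β ∈ Tp, p β * ind ((β - base κ D β) * v ∈ dl r (F - M)) := by
        simp only [mul_add, sum_add_distrib]
        rw [e3, e3, e3, e3]
    _ ≤ _ := by
        unfold pot at hpot
        have f1 : ∑ x : Pt r, ∑ y : Pt r, (∑ β ∈ Lw, p β * ind (β x ≠ 0 ∧ β y ≠ 0)) *
            ind (x ≠ y ∧ h x = h y) =
            ∑ β ∈ Lw, p β * (∑ x, ∑ y, ind (β x ≠ 0 ∧ β y ≠ 0) * ind (x ≠ y ∧ h x = h y)) := by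
          simp only [mul_sum, sum_mul]
          rw [sum_comm]
          rw [sum_congr rfl fun y _ => sum_comm]
          rw [sum_comm]
          refine sum_congr rfl fun β _ => ?_
          rw [sum_comm]
          refine sum_congr rfl fun x _ => sum_congr rfl fun y _ => by ring
        have f2 : ∑ x : Pt r, (∑ β ∈ Λ, p β * ind (base κ D β x ≠ 0)) * ind (v x ≠ 0) =
            ∑ β ∈ Λ, p β * (∑ x, ind (base κ D β x ≠ 0) * ind (v x ≠ 0)) := by
          simp only [mul_sum, sum_mul]
          rw [sum_comm]
          refine sum_congr rfl fun x _ => sum_congr rfl fun y _ => by ring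
        have f3 : ∑ β ∈ Md, p β * (s ^ (κ + 1) + FF s κ (NN D h β)) ≤
            s ^ (κ + 1) + ∑ β ∈ Md, p β * FF s κ (NN D h β) := by
          simp only [mul_add, sum_add_distrib]
          rw [← sum_mul]
          have := mul_le_mul_of_nonneg_right (hsub fun β => ¬ Sm κ D β)
            (show 0 ≤ s ^ (κ + 1) by positivity)
          linarith
        have f4 : ∑ x : Pt r, ∑ β ∈ Λ, p β * ind (base κ D β x ≠ 0) ≤ κ := by
          rw [sum_comm]
          simp only [← mul_sum, sum_ind_supp]
          calc ∑ β ∈ Λ, p β * (supp (base κ D β) : ℝ) ≤ ∑ β ∈ Λ, p β * (κ : ℝ) :=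
                sum_le_sum fun β _ => mul_le_mul_of_nonneg_left
                  (by exact_mod_cast base_supp _ _ _) (hp0 β)
            _ = (∑ β ∈ Λ, p β) * (κ : ℝ) := by rw [sum_mul]
            _ ≤ 1 * (κ : ℝ) := mul_le_mul_of_nonneg_right hp1 (by positivity)
            _ = _ := one_mul _
        rw [Nat.sub_self, pow_zero, one_mul, f2] at hvb
        rw [f1] at hpot
        have f5 := mul_le_mul_of_nonneg_left hpotb
          (show 0 ≤ ((1 + 2 * s) / 3) ^ j by positivity)
        have f6 := mul_le_mul_of_nonneg_left f4 (show (0:ℝ) ≤ (2 / 3) ^ M by positivity)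
        have f7 := mul_le_mul_of_nonneg_left (hsub fun β => ¬ supp β ≤ κ ∧ Sm κ D β)
          (show (0:ℝ) ≤ M * (1 / 3) ^ ((D - M) / 2) by positivity)
        linarith
end
end S5

open scoped BigOperators
set_option linter.unusedVariables false
set_option linter.unusedSectionVars false
namespace S5
open Finset
section
variable {r : ℕ}
local notation "conj" => starRingEnd ℂ

/-- abstract hypercontractive inequality for a system of functions -/
def HC {Ω B : Type*} [Fintype Ω] [Fintype B] (w : B → ℝ) (φ : B → Ω → ℂ) : Prop :=
  ∀ c : B → ℂ, 𝔼 o, ‖∑ b, c b * φ b o‖ ^ 4 ≤ (∑ b, w b * ‖c b‖ ^ 2) ^ 2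

lemma expect_cs {Ω : Type*} [Fintype Ω] [Nonempty Ω] (f g : Ω → ℝ) {a b : ℝ} (ha : 0 ≤ a) (hb : 0 ≤ b)
    (hf : 𝔼 o, f o ^ 2 ≤ a ^ 2) (hg : 𝔼 o, g o ^ 2 ≤ b ^ 2) : 𝔼 o, f o * g o ≤ a * b := by
  rw [Fintype.expect_eq_sum_div_card] at *
  have hN : (0 : ℝ) < Fintype.card Ω := by exact_mod_cast Fintype.card_pos
  rw [div_le_iff₀ hN] at *
  refine abs_le_of_sq_le_sq' ?_ (by positivity) |>.2
  calc (∑ o, f o * g o) ^ 2 ≤ (∑ o, f o ^ 2) * ∑ o, g o ^ 2 := sum_mul_sq_le_sq_mul_sq _ _ _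
    _ ≤ (a ^ 2 * Fintype.card Ω) * (b ^ 2 * Fintype.card Ω) :=
        mul_le_mul hf hg (sum_nonneg fun _ _ => by positivity) (by positivity)
    _ = _ := by ring

lemma expect_prod_type {α β E : Type*} [Fintype α] [Fintype β] [AddCommMonoid E] [Module ℚ≥0 E]
    (F : α × β → E) : 𝔼 x, F x = 𝔼 a, 𝔼 b, F (a, b) := by
  rw [← univ_product_univ, expect_product]

lemma HC_prod {Ω1 Ω2 B1 B2 : Type*} [Fintype Ω1] [Fintype Ω2] [Fintype B1] [Fintype B2] [Nonempty Ω1]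
    {w1 : B1 → ℝ} {w2 : B2 → ℝ} {φ1 : B1 → Ω1 → ℂ} {φ2 : B2 → Ω2 → ℂ}
    (hw1 : ∀ b, 0 ≤ w1 b) (hw2 : ∀ b, 0 ≤ w2 b) (h1 : HC w1 φ1) (h2 : HC w2 φ2) :
    HC (fun b : B1 × B2 => w1 b.1 * w2 b.2) (fun b (o : Ω1 × Ω2) => φ1 b.1 o.1 * φ2 b.2 o.2) := by
  intro c
  rw [expect_prod_type]
  set F : B2 → Ω1 → ℂ := fun b2 o1 => ∑ b1, c (b1, b2) * φ1 b1 o1 with hF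
  set S : B2 → ℝ := fun b2 => ∑ b1, w1 b1 * ‖c (b1, b2)‖ ^ 2 with hS
  have hS0 : ∀ b2, 0 ≤ S b2 := fun b2 => sum_nonneg fun b1 _ => mul_nonneg (hw1 _) (by positivity)
  have e1 : ∀ o1 o2, ∑ b : B1 × B2, c b * (φ1 b.1 o1 * φ2 b.2 o2) = ∑ b2, F b2 o1 * φ2 b2 o2 := by
    intro o1 o2
    rw [Fintype.sum_prod_type, sum_comm]
    refine sum_congr rfl fun b2 _ => ?_
    rw [hF, sum_mul]
    exact sum_congr rfl fun b1 _ => by ring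
  simp only [e1]
  calc 𝔼 o1, 𝔼 o2, ‖∑ b2, F b2 o1 * φ2 b2 o2‖ ^ 4
      ≤ 𝔼 o1, (∑ b2, w2 b2 * ‖F b2 o1‖ ^ 2) ^ 2 :=
        expect_le_expect fun o1 _ => h2 fun b2 => F b2 o1
    _ = ∑ b, ∑ b', w2 b * w2 b' * 𝔼 o1, ‖F b o1‖ ^ 2 * ‖F b' o1‖ ^ 2 := by
        simp only [mul_expect]
        simp only [← expect_sum_comm]
        refine expect_congr rfl fun o1 _ => ?_
        rw [sq, sum_mul_sum]
        exact sum_congr rfl fun b _ => sum_congr rfl fun b' _ => by ring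
    _ ≤ ∑ b, ∑ b', w2 b * w2 b' * (S b * S b') := by
        refine sum_le_sum fun b _ => sum_le_sum fun b' _ =>
          mul_le_mul_of_nonneg_left ?_ (mul_nonneg (hw2 _) (hw2 _))
        refine expect_cs _ _ (hS0 b) (hS0 b') ?_ ?_
        · refine le_trans (le_of_eq ?_) (h1 fun b1 => c (b1, b))
          exact expect_congr rfl fun o _ => by rw [hF]; ring
        · refine le_trans (le_of_eq ?_) (h1 fun b1 => c (b1, b'))
          exact expect_congr rfl fun o _ => by rw [hF]; ring
    _ = (∑ b, w2 b * S b) ^ 2 := by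
        rw [sq, sum_mul_sum]
        exact sum_congr rfl fun b _ => sum_congr rfl fun b' _ => by ring
    _ = _ := by
        congr 1
        rw [Fintype.sum_prod_type, sum_comm]
        refine sum_congr rfl fun b2 _ => ?_
        rw [hS, mul_sum]
        exact sum_congr rfl fun b1 _ => by ring

lemma HC_equiv {Ω Ω' B B' : Type*} [Fintype Ω] [Fintype Ω'] [Fintype B] [Fintype B']
    (e : Ω ≃ Ω') (e' : B ≃ B') {w : B → ℝ} {w' : B' → ℝ} {φ : B → Ω → ℂ} {φ' : B' → Ω' → ℂ}
    (hw : ∀ b, w' (e' b) = w b) (hφ : ∀ b o, φ' (e' b) (e o) = φ b o) (h : HC w φ) : HC w' φ' := by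
  intro c
  have := h fun b => c (e' b)
  rw [← Fintype.expect_equiv e _ (fun o => ‖∑ b, c b * φ' b o‖ ^ 4) fun o => rfl,
    ← Equiv.sum_comp e' (fun b => w' b * ‖c b‖ ^ 2)]
  simp only [hw]
  refine le_trans (le_of_eq ?_) this
  refine expect_congr rfl fun o _ => ?_
  rw [← Equiv.sum_comp e' (fun b => c b * φ' b (e o))]
  simp only [hφ]

def w3 (c : F3) : ℝ := if c = 0 then 1 else 4

lemma w3_nonneg (c : F3) : 0 ≤ w3 c := by unfold w3; split_ifs <;> norm_num

lemma omega_val : ω = ⟨-1 / 2, Real.sqrt 3 / 2⟩ := by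
  unfold ω
  rw [show (2 * (Real.pi : ℂ) * Complex.I / 3) = ((2 * Real.pi / 3 : ℝ) : ℂ) * Complex.I by
    push_cast; ring, Complex.exp_mul_I, ← Complex.ofReal_cos, ← Complex.ofReal_sin,
    show 2 * Real.pi / 3 = Real.pi - Real.pi / 3 by ring, Real.cos_pi_sub, Real.sin_pi_sub,
    Real.cos_pi_div_three, Real.sin_pi_div_three]
  apply Complex.ext <;> simp
  norm_num

lemma sum_F3 {E : Type*} [AddCommMonoid E] (F : F3 → E) : ∑ t : F3, F t = F 0 + F 1 + F 2 := by
  exact Fin.sum_univ_three F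

lemma expect_F3 (F : F3 → ℝ) : 𝔼 t : F3, F t = (F 0 + F 1 + F 2) / 3 := by
  rw [Fintype.expect_eq_sum_div_card, sum_F3]; simp [ZMod.card]

lemma ee_one_val : ee 1 = ⟨-1 / 2, Real.sqrt 3 / 2⟩ := by rw [ee_one, omega_val]

lemma ee_two_val : ee 2 = ⟨-1 / 2, -(Real.sqrt 3 / 2)⟩ := by
  rw [show (2 : F3) = -1 by decide, ee_neg, ee_one_val]
  rfl

lemma sq_add_three (x y z : ℝ) : (x + y + z) ^ 2 ≤ 3 * (x ^ 2 + y ^ 2 + z ^ 2) := by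
  nlinarith [sq_nonneg (x - y), sq_nonneg (x - z), sq_nonneg (y - z)]

lemma tp_aux2 {U V W q : ℝ} (hU0 : 0 ≤ U) (hV0 : 0 ≤ V) (hW0 : 0 ≤ W)
    (h : q ≤ 3 * (U * V + U * W + V * W)) :
    (U + V + W) ^ 2 + 2 * q ≤ (U + 4 * V + 4 * W) ^ 2 := by
  nlinarith [mul_nonneg hU0 hV0, mul_nonneg hU0 hW0, mul_nonneg hV0 hW0, sq_nonneg V, sq_nonneg W]

lemma tp_aux (u1 u2 v1 v2 w1 w2 : ℝ) :
    (u1 ^ 2 + u2 ^ 2 + (v1 ^ 2 + v2 ^ 2) + (w1 ^ 2 + w2 ^ 2)) ^ 2 +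
      2 * (((v1 * u1 + v2 * u2) + (u1 * w1 + u2 * w2) + (w1 * v1 + w2 * v2)) ^ 2 +
        ((v2 * u1 - v1 * u2) + (u2 * w1 - u1 * w2) + (w2 * v1 - w1 * v2)) ^ 2) ≤
    (u1 ^ 2 + u2 ^ 2 + 4 * (v1 ^ 2 + v2 ^ 2) + 4 * (w1 ^ 2 + w2 ^ 2)) ^ 2 := by
  refine tp_aux2 (by positivity) (by positivity) (by positivity) ?_
  refine (add_le_add (sq_add_three _ _ _) (sq_add_three _ _ _)).trans (le_of_eq ?_)
  ring

lemma three_point (u v w : ℂ) :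
    𝔼 t : F3, ‖u + v * ee t + w * ee (2 * t)‖ ^ 4 ≤ (‖u‖ ^ 2 + 4 * ‖v‖ ^ 2 + 4 * ‖w‖ ^ 2) ^ 2 := by
  rw [expect_F3]
  rw [show (2 : F3) * 0 = 0 by decide, show (2 : F3) * 1 = 2 by decide, show (2 : F3) * 2 = 1 by decide]
  rw [ee_zero, ee_one_val, ee_two_val]
  obtain ⟨u1, u2⟩ := u
  obtain ⟨v1, v2⟩ := v
  obtain ⟨w1, w2⟩ := w
  have hs : Real.sqrt 3 ^ 2 = 3 := Real.sq_sqrt (by norm_num)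
  set s := Real.sqrt 3
  have hn : ∀ z : ℂ, ‖z‖ ^ 2 = z.re ^ 2 + z.im ^ 2 := by
    intro z; rw [← Complex.normSq_eq_norm_sq, Complex.normSq_apply]; ring
  have h4 : ∀ z : ℂ, ‖z‖ ^ 4 = (z.re ^ 2 + z.im ^ 2) ^ 2 := by
    intro z; rw [← hn]; ring
  simp only [h4, hn]
  simp only [Complex.add_re, Complex.add_im, Complex.mul_re, Complex.mul_im, Complex.one_re,
    Complex.one_im, mul_one, mul_zero, sub_zero, zero_add, add_zero]
  set N := u1 ^ 2 + u2 ^ 2 + (v1 ^ 2 + v2 ^ 2) + (w1 ^ 2 + w2 ^ 2) with hN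
  -- p = v ū + u w̄ + w v̄ = a + i b
  set a := (v1 * u1 + v2 * u2) + (u1 * w1 + u2 * w2) + (w1 * v1 + w2 * v2) with ha
  set b := (v2 * u1 - v1 * u2) + (u2 * w1 - u1 * w2) + (w2 * v1 - w1 * v2) with hb
  have r0 : (u1 + v1 + w1) ^ 2 + (u2 + v2 + w2) ^ 2 = N + 2 * a := by rw [hN, ha]; ring
  have r1 : (u1 + (v1 * (-1 / 2) - v2 * (s / 2)) + (w1 * (-1 / 2) - w2 * -(s / 2))) ^ 2 +
      (u2 + (v1 * (s / 2) + v2 * (-1 / 2)) + (w1 * -(s / 2) + w2 * (-1 / 2))) ^ 2 = N - a - s * b := by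
    rw [hN, ha, hb]
    linear_combination ((v1 - w1) ^ 2 / 4 + (v2 - w2) ^ 2 / 4) * hs
  have r2 : (u1 + (v1 * (-1 / 2) - v2 * -(s / 2)) + (w1 * (-1 / 2) - w2 * (s / 2))) ^ 2 +
      (u2 + (v1 * -(s / 2) + v2 * (-1 / 2)) + (w1 * (s / 2) + w2 * (-1 / 2))) ^ 2 = N - a + s * b := by
    rw [hN, ha, hb]
    linear_combination ((v1 - w1) ^ 2 / 4 + (v2 - w2) ^ 2 / 4) * hs
  rw [r0, r1, r2]
  have r3 : ((N + 2 * a) ^ 2 + (N - a - s * b) ^ 2 + (N - a + s * b) ^ 2) / 3 =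
      N ^ 2 + 2 * (a ^ 2 + b ^ 2) := by
    linear_combination (2 * b ^ 2 / 3) * hs
  rw [r3]
  exact tp_aux u1 u2 v1 v2 w1 w2

lemma HC_F3 : HC w3 (fun b (t : F3) => ee (b * t)) := by
  intro c
  have := three_point (c 0) (c 1) (c 2)
  simp only [sum_F3, w3]
  rw [if_pos trivial, if_neg (by decide), if_neg (by decide), one_mul]
  refine le_trans (le_of_eq ?_) this
  refine expect_congr rfl fun t _ => ?_
  rw [zero_mul, ee_zero, one_mul, mul_one]

lemma HC_Fin (n : ℕ) : HC (fun b : Fin n → F3 => ∏ x, w3 (b x))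
    (fun b (t : Fin n → F3) => ∏ x, ee (b x * t x)) := by
  induction n with
  | zero =>
    intro c
    simp only [Fintype.sum_unique, univ_eq_empty, prod_empty, mul_one, one_mul]
    rw [Fintype.expect_eq_sum_div_card]
    simp
    exact le_of_eq (by ring)
  | succ n ih =>
    refine HC_equiv (Fin.consEquiv fun _ => F3) (Fin.consEquiv fun _ => F3) ?_ ?_
      (HC_prod w3_nonneg (fun b => prod_nonneg fun _ _ => w3_nonneg _) HC_F3 ih)
    · intro b; rw [Fin.prod_univ_succ]; simp
    · intro b o; rw [Fin.prod_univ_succ]; simp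

lemma HC_Fn : HC (fun b : Fn r => ∏ x, w3 (b x)) (fun b (t : Fn r) => ∏ x, ee (b x * t x)) := by
  let e := Fintype.equivFin (Pt r)
  refine HC_equiv (Equiv.arrowCongr e.symm (Equiv.refl F3)) (Equiv.arrowCongr e.symm (Equiv.refl F3))
    ?_ ?_ (HC_Fin (Fintype.card (Pt r)))
  · intro b
    rw [← Equiv.prod_comp e (fun x => w3 (b x))]
    rfl
  · intro b o
    rw [← Equiv.prod_comp e (fun x => ee (b x * o x))]
    rfl

lemma prod_w3 (β : Fn r) : ∏ x, w3 (β x) = 4 ^ supp β := by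
  rw [supp_eq, sF, ← prod_const, prod_filter]
  refine prod_congr rfl fun x _ => ?_
  unfold w3
  by_cases h : β x = 0 <;> simp [h]

lemma hyper {κ : ℕ} {c : Fn r → ℂ} (hc : ∀ β, κ < supp β → c β = 0) :
    𝔼 f : Fn r, ‖LL c f‖ ^ 4 ≤ 16 ^ κ * (∑ β, ‖c β‖ ^ 2) ^ 2 := by
  have h := HC_Fn (r := r) c
  simp only [← chi_prod, prod_w3] at h
  refine h.trans ?_
  calc (∑ b, (4 : ℝ) ^ supp b * ‖c b‖ ^ 2) ^ 2 ≤ (∑ b, (4 : ℝ) ^ κ * ‖c b‖ ^ 2) ^ 2 := by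
        gcongr ?_ ^ 2
        refine sum_le_sum fun b _ => ?_
        by_cases hb : supp b ≤ κ
        · gcongr; norm_num
        · rw [hc b (by omega)]; simp
    _ = _ := by
        rw [← mul_sum, mul_pow, ← pow_mul, mul_comm κ 2, pow_mul]; norm_num
end
end S5

open scoped BigOperators
set_option linter.unusedVariables false
set_option linter.unusedSectionVars false
namespace S5
open Finset
section

noncomputable def gg (s : ℝ) : ℝ := if 0 < s then s ^ 3 / (1 + s) else 0

lemma gg_nonneg (s : ℝ) : 0 ≤ gg s := by
  unfold gg; split_ifs with h
  · positivity
  · exact le_rfl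

lemma gg_of_nonneg {s : ℝ} (h : 0 ≤ s) : gg s = s ^ 3 / (1 + s) := by
  unfold gg; split_ifs with h1
  · rfl
  · have : s = 0 := le_antisymm (not_lt.1 h1) h
    rw [this]; simp

lemma gg_of_nonpos {s : ℝ} (h : s ≤ 0) : gg s = 0 := by
  unfold gg; rw [if_neg (not_lt.2 h)]

lemma gg_le_cube {s : ℝ} (h : 0 ≤ s) : gg s ≤ s ^ 3 := by
  rw [gg_of_nonneg h]
  exact div_le_self (by positivity) (by linarith)

lemma gg_le_sq (s : ℝ) : gg s ≤ s ^ 2 := by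
  rcases le_total s 0 with h | h
  · rw [gg_of_nonpos h]; positivity
  · rw [gg_of_nonneg h, div_le_iff₀ (by linarith)]
    nlinarith [sq_nonneg s]

noncomputable def ga (x : ℝ) : ℝ := if 0 < x then x ^ 2 * (3 + 2 * x) / (1 + x) ^ 2 else 0
noncomputable def gb (x : ℝ) : ℝ := if 0 < x then x * (3 + 3 * x + x ^ 2) / (1 + x) ^ 3 else 0

lemma gg_taylor (x h : ℝ) : |gg (x + h) - gg x - ga x * h - gb x * h ^ 2| ≤ 7 * |h| ^ 3 := by
  have hh : 0 ≤ |h| ^ 3 := by positivity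
  by_cases hx : 0 < x
  · have hx1 : 0 < 1 + x := by linarith
    rw [gg_of_nonneg hx.le, ga, gb, if_pos hx, if_pos hx]
    rcases le_total 0 (x + h) with hy | hy
    · have hy1 : 0 < 1 + (x + h) := by linarith
      rw [gg_of_nonneg hy]
      have e : (x + h) ^ 3 / (1 + (x + h)) - x ^ 3 / (1 + x) - x ^ 2 * (3 + 2 * x) / (1 + x) ^ 2 * h -
          x * (3 + 3 * x + x ^ 2) / (1 + x) ^ 3 * h ^ 2 = h ^ 3 / ((1 + x) ^ 3 * (1 + (x + h))) := by
        field_simp; ring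
      rw [e, abs_div, abs_pow]
      have : 1 ≤ |(1 + x) ^ 3 * (1 + (x + h))| := by
        rw [abs_of_pos (by positivity)]
        exact one_le_mul_of_one_le_of_one_le (one_le_pow₀ (by linarith)) (by linarith)
      exact (div_le_self hh this).trans (by linarith)
    · rw [gg_of_nonpos hy]
      have hxh : x ≤ |h| := by rw [abs_of_nonpos (by linarith)]; linarith
      have a1 : x ^ 3 / (1 + x) ≤ |h| ^ 3 :=
        (div_le_self (by positivity) (by linarith)).trans (by gcongr)
      have a2 : x ^ 2 * (3 + 2 * x) / (1 + x) ^ 2 ≤ 3 * |h| ^ 2 := by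
        refine le_trans ?_ (show 3 * x ^ 2 ≤ 3 * |h| ^ 2 by gcongr)
        rw [div_le_iff₀ (by positivity)]
        have : 0 ≤ x ^ 3 := by positivity
        have : 0 ≤ x ^ 4 := by positivity
        nlinarith
      have a3 : x * (3 + 3 * x + x ^ 2) / (1 + x) ^ 3 ≤ 3 * |h| := by
        refine le_trans ?_ (show 3 * x ≤ 3 * |h| by gcongr)
        rw [div_le_iff₀ (by positivity)]
        have : 0 ≤ x ^ 3 := by positivity
        have : 0 ≤ x ^ 4 := by positivity
        have : 0 ≤ x ^ 2 := by positivity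
        nlinarith
      have b1 : 0 ≤ x ^ 3 / (1 + x) := by positivity
      have b2 : 0 ≤ x ^ 2 * (3 + 2 * x) / (1 + x) ^ 2 := by positivity
      have b3 : 0 ≤ x * (3 + 3 * x + x ^ 2) / (1 + x) ^ 3 := by positivity
      have hneg : h = -|h| := by rw [abs_of_nonpos (by linarith)]; ring
      set k := |h| with hk
      have hk0 : 0 ≤ k := abs_nonneg h
      rw [hneg]
      have c2 := mul_le_mul_of_nonneg_right a2 hk0
      have c3 := mul_le_mul_of_nonneg_right a3 (sq_nonneg k)
      have d2 := mul_nonneg b2 hk0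
      have d3 := mul_nonneg b3 (sq_nonneg k)
      rw [abs_le]
      constructor <;> nlinarith
  · push Not at hx
    rw [gg_of_nonpos hx, ga, gb, if_neg (not_lt.2 hx), if_neg (not_lt.2 hx)]
    simp only [sub_zero, zero_mul]
    rw [abs_of_nonneg (gg_nonneg _)]
    rcases le_total (x + h) 0 with hy | hy
    · rw [gg_of_nonpos hy]; positivity
    · refine (gg_le_cube hy).trans ?_
      have : (x + h) ^ 3 ≤ |h| ^ 3 := by
        gcongr
        exact (by linarith : x + h ≤ h).trans (le_abs_self h)
      linarith

noncomputable def psi (t : ℝ) : ℝ := gg (-t) + gg (t - 1)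

lemma psi_nonneg (t : ℝ) : 0 ≤ psi t := add_nonneg (gg_nonneg _) (gg_nonneg _)

noncomputable def pa (x : ℝ) : ℝ := - ga (-x) + ga (x - 1)
noncomputable def pb (x : ℝ) : ℝ := gb (-x) + gb (x - 1)

lemma psi_taylor (x h : ℝ) : |psi (x + h) - psi x - pa x * h - pb x * h ^ 2| ≤ 14 * |h| ^ 3 := by
  have h1 := gg_taylor (-x) (-h)
  have h2 := gg_taylor (x - 1) h
  rw [abs_neg] at h1
  unfold psi pa pb
  rw [show -(x + h) = -x + -h by ring, show x + h - 1 = x - 1 + h by ring]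
  calc _ = |(gg (-x + -h) - gg (-x) - ga (-x) * -h - gb (-x) * (-h) ^ 2) +
        (gg (x - 1 + h) - gg (x - 1) - ga (x - 1) * h - gb (x - 1) * h ^ 2)| := by congr 1; ring
    _ ≤ _ := abs_add_le _ _
    _ ≤ _ := by linarith

lemma psi_le {t y : ℝ} (h0 : 0 ≤ y) (h1 : y ≤ 1) : psi t ≤ (t - y) ^ 2 := by
  unfold psi
  rcases le_total t 0 with h | h
  · rw [gg_of_nonpos (by linarith : t - 1 ≤ 0), add_zero]
    refine (gg_le_sq _).trans ?_
    nlinarith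
  · rw [gg_of_nonpos (by linarith : -t ≤ 0), zero_add]
    rcases le_total t 1 with h2 | h2
    · rw [gg_of_nonpos (by linarith)]; positivity
    · refine (gg_le_sq _).trans ?_
      nlinarith

noncomputable def clip (t : ℝ) : ℝ := max 0 (min t 1)

lemma clip_nonneg (t : ℝ) : 0 ≤ clip t := le_max_left _ _
lemma clip_le_one (t : ℝ) : clip t ≤ 1 := max_le zero_le_one (min_le_right _ _)

lemma gg_lower {s η : ℝ} (hs : 0 ≤ s) (h0 : 0 < η) (h1 : η ≤ 1) : s ^ 2 ≤ η ^ 2 + 2 * gg s / η := by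
  rcases le_total s η with h | h
  · have : 0 ≤ 2 * gg s / η := by have := gg_nonneg s; positivity
    nlinarith
  · have hs0 : 0 < s := lt_of_lt_of_le h0 h
    rw [gg_of_nonneg hs]
    have : s ^ 2 ≤ 2 * (s ^ 3 / (1 + s)) / η := by
      rw [le_div_iff₀ h0, ← mul_div_assoc, le_div_iff₀ (by linarith)]
      have : 0 ≤ s ^ 2 := by positivity
      have h3 : η * (1 + s) ≤ 2 * s := by nlinarith
      nlinarith
    nlinarith [sq_nonneg η]

lemma clip_dist {t η : ℝ} (h0 : 0 < η) (h1 : η ≤ 1) : (t - clip t) ^ 2 ≤ η ^ 2 + 2 * psi t / η := by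
  unfold psi clip
  rcases le_total t 0 with h | h
  · rw [gg_of_nonpos (by linarith : t - 1 ≤ 0), add_zero, min_eq_left (by linarith), max_eq_left h]
    have := gg_lower (s := -t) (by linarith) h0 h1
    rw [show (t - 0) ^ 2 = (-t) ^ 2 by ring]; exact this
  · rw [gg_of_nonpos (by linarith : -t ≤ 0), zero_add]
    rcases le_total t 1 with h2 | h2
    · rw [min_eq_left h2, max_eq_right h, gg_of_nonpos (by linarith)]
      simp; positivity
    · rw [min_eq_right h2, max_eq_right zero_le_one]
      exact gg_lower (by linarith) h0 h1
end
end S5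

open scoped BigOperators
set_option linter.unusedVariables false
set_option linter.unusedSectionVars false
namespace S5
open Finset
section
variable {r : ℕ}
local notation "conj" => starRingEnd ℂ

lemma taylor_one {γ : Type*} [Fintype γ] [Nonempty γ] (x : ℝ) (Z : γ → ℝ) :
    |𝔼 a, psi (x + Z a) - (psi x + pa x * 𝔼 a, Z a + pb x * 𝔼 a, Z a ^ 2)| ≤
      14 * 𝔼 a, |Z a| ^ 3 := by
  have e : 𝔼 a, psi (x + Z a) - (psi x + pa x * 𝔼 a, Z a + pb x * 𝔼 a, Z a ^ 2) =
      𝔼 a, (psi (x + Z a) - psi x - pa x * Z a - pb x * Z a ^ 2) := by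
    rw [expect_sub_distrib, expect_sub_distrib, expect_sub_distrib, ← mul_expect, ← mul_expect,
      expect_const univ_nonempty]
    ring
  rw [e, mul_expect]
  refine (abs_expect_le _ _).trans (expect_le_expect fun a _ => psi_taylor _ _)

/-- comparison of two random perturbations with matching first two moments -/
lemma taylor_compare {α β : Type*} [Fintype α] [Fintype β] [Nonempty α] [Nonempty β]
    (x : ℝ) (X : α → ℝ) (Y : β → ℝ)
    (h1 : 𝔼 a, X a = 𝔼 b, Y b) (h2 : 𝔼 a, X a ^ 2 = 𝔼 b, Y b ^ 2) :
    |𝔼 a, psi (x + X a) - 𝔼 b, psi (x + Y b)| ≤ 14 * (𝔼 a, |X a| ^ 3 + 𝔼 b, |Y b| ^ 3) := by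
  have kX := taylor_one x X
  have kY := taylor_one x Y
  rw [← h1, ← h2] at kY
  rw [abs_le] at *
  constructor <;> linarith

noncomputable def uu (u : ℂ) (c : F3) : ℂ := if c = 0 then 1 else if c = 1 then u else conj u

lemma F3_cases (c : F3) : c = 0 ∨ c = 1 ∨ c = 2 := by revert c; decide

lemma uu_zero (u : ℂ) : uu u 0 = 1 := by simp [uu]
lemma uu_one (u : ℂ) : uu u 1 = u := by simp [uu]
lemma uu_two (u : ℂ) : uu u 2 = conj u := by
  unfold uu; rw [if_neg (by decide), if_neg (by decide)]

lemma uu_neg (u : ℂ) (c : F3) : uu u (-c) = conj (uu u c) := by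
  rcases F3_cases c with rfl | rfl | rfl
  · simp [uu_zero]
  · rw [show (-1 : F3) = 2 by decide, uu_two, uu_one]
  · rw [show (-2 : F3) = 1 by decide, uu_two, uu_one, Complex.conj_conj]

lemma norm_uu {u : ℂ} (hu : ‖u‖ = 1) (c : F3) : ‖uu u c‖ = 1 := by
  unfold uu; split_ifs <;> simp [hu]

lemma uu_mul_neg {u : ℂ} (hu : ‖u‖ = 1) (c : F3) : uu u c * uu u (-c) = 1 := by
  rw [uu_neg, ← norm_sq_eq, norm_uu hu]; simp

noncomputable def tw (u : ℂ) (J : Finset (Pt r)) (β : Fn r) : ℂ := ∏ x ∈ J, uu u (β x)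

lemma tw_neg (u : ℂ) (J : Finset (Pt r)) (β : Fn r) : tw u J (-β) = conj (tw u J β) := by
  unfold tw
  rw [map_prod]
  exact prod_congr rfl fun x _ => by rw [Pi.neg_apply, uu_neg]

lemma norm_tw {u : ℂ} (hu : ‖u‖ = 1) (J : Finset (Pt r)) (β : Fn r) : ‖tw u J β‖ = 1 := by
  unfold tw
  rw [norm_prod]
  exact prod_eq_one fun x _ => norm_uu hu _

lemma tw_one {u : ℂ} {J : Finset (Pt r)} {β : Fn r} (h : ∀ x ∈ J, β x = 0) : tw u J β = 1 :=
  prod_eq_one fun x hx => by rw [h x hx, uu_zero]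

lemma tw_mul_one {u : ℂ} (hu : ‖u‖ = 1) {J : Finset (Pt r)} {β γ : Fn r}
    (h : ∀ x ∈ J, (β + γ) x = 0) : tw u J β * tw u J γ = 1 := by
  unfold tw
  rw [← prod_mul_distrib]
  refine prod_eq_one fun x hx => ?_
  have h2 := h x hx
  rw [Pi.add_apply, add_comm, add_eq_zero_iff_eq_neg] at h2
  rw [h2, uu_mul_neg hu]

def CS (c : Fn r → ℂ) : Prop := ∀ β, c (-β) = conj (c β)

lemma LL_real {c : Fn r → ℂ} (hc : CS c) (f : Fn r) : conj (LL c f) = LL c f := by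
  unfold LL
  rw [map_sum, ← Equiv.sum_comp (Equiv.neg (Fn r))]
  refine sum_congr rfl fun β _ => ?_
  rw [Equiv.neg_apply, map_mul, hc, chi_neg_left, Complex.conj_conj, Complex.conj_conj]

lemma LL_re {c : Fn r → ℂ} (hc : CS c) (f : Fn r) : (((LL c f).re : ℝ) : ℂ) = LL c f :=
  Complex.conj_eq_iff_re.1 (LL_real hc f)

lemma LL_add (c c' : Fn r → ℂ) (f : Fn r) : LL (fun β => c β + c' β) f = LL c f + LL c' f := by
  unfold LL; rw [← sum_add_distrib]; exact sum_congr rfl fun β _ => by ring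

/-- `z` is a random shift which kills exactly the characters in `Act` -/
def Good {α : Type*} [Fintype α] (κ : ℕ) (Act : Fn r → Prop) (z : α → Fn r) : Prop :=
  (∀ γ, Act γ → supp γ ≤ 2 * κ → 𝔼 a, chi γ (z a) = 0) ∧ (∀ γ, ¬ Act γ → ∀ a, chi γ (z a) = 1)

lemma good_mom1 {α : Type*} [Fintype α] {κ : ℕ} {Act : Fn r → Prop} {z : α → Fn r}
    (hz : Good κ Act z) {c : Fn r → ℂ} (hc : ∀ β, κ < supp β → c β = 0)
    (hA : ∀ β, ¬ Act β → c β = 0) (y : Fn r) : 𝔼 a, LL c (y + z a) = 0 := by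
  unfold LL
  rw [expect_sum_comm]
  refine sum_eq_zero fun β _ => ?_
  simp only [chi_add_right, ← mul_expect]
  by_cases h1 : Act β
  · by_cases h2 : supp β ≤ κ
    · rw [hz.1 β h1 (by omega)]; ring
    · rw [hc β (by omega)]; ring
  · rw [hA β h1]; ring

lemma good_mom2 {α : Type*} [Fintype α] [Nonempty α] {κ : ℕ} {Act : Fn r → Prop} {z : α → Fn r}
    (hz : Good κ Act z) {c : Fn r → ℂ} (hc : ∀ β, κ < supp β → c β = 0) (y : Fn r) :
    𝔼 a, LL c (y + z a) ^ 2 = ∑ β, ∑ γ, c β * c γ * chi (β + γ) y * (ind (¬ Act (β + γ)) : ℂ) := by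
  have e : ∀ a, LL c (y + z a) ^ 2 = ∑ β, ∑ γ, c β * c γ * chi (β + γ) y * chi (β + γ) (z a) := by
    intro a
    unfold LL
    rw [sq, sum_mul_sum]
    refine sum_congr rfl fun β _ => sum_congr rfl fun γ _ => ?_
    rw [chi_add_right, chi_add_right, chi_add_left, chi_add_left]; ring
  simp only [e]
  rw [expect_sum_comm]
  refine sum_congr rfl fun β _ => ?_
  rw [expect_sum_comm]
  refine sum_congr rfl fun γ _ => ?_
  rw [← mul_expect]
  by_cases h1 : supp β ≤ κ
  · by_cases h2 : supp γ ≤ κ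
    · congr 1
      by_cases h3 : Act (β + γ)
      · rw [hz.1 _ h3 ((supp_add_le _ _).trans (by omega)), ind_false (not_not.2 h3)]; simp
      · rw [ind_true h3]
        simp only [hz.2 _ h3]
        rw [expect_const univ_nonempty]; simp
    · rw [hc γ (by omega)]; ring
  · rw [hc β (by omega)]; ring

lemma LL_shift0 {α : Type*} [Fintype α] {κ : ℕ} {Act : Fn r → Prop} {z : α → Fn r}
    (hz : Good κ Act z) {c : Fn r → ℂ} (hA : ∀ β, Act β → c β = 0) (y : Fn r) (a : α) :
    LL c (y + z a) = LL c y := by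
  unfold LL
  refine sum_congr rfl fun β _ => ?_
  by_cases h : Act β
  · rw [hA β h]; ring
  · rw [chi_add_right, hz.2 β h a, mul_one]

lemma norm_eq_re {c : Fn r → ℂ} (hc : CS c) (f : Fn r) : |(LL c f).re| = ‖LL c f‖ := by
  rw [← LL_re hc f, Complex.norm_real, Real.norm_eq_abs, Complex.ofReal_re]

lemma point_step {α β : Type*} [Fintype α] [Fintype β] [Nonempty α] [Nonempty β] {κ : ℕ}
    {Act : Fn r → Prop} {z : α → Fn r} {z' : β → Fn r} (hz : Good κ Act z) (hz' : Good κ Act z')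
    {c0 c1 t : Fn r → ℂ} (h0 : CS c0) (h1 : CS c1) (ht : CS t)
    (hc : ∀ β, κ < supp β → c1 β = 0) (hA0 : ∀ β, Act β → c0 β = 0) (hA1 : ∀ β, ¬ Act β → c1 β = 0)
    (htt : ∀ β γ, ¬ Act (β + γ) → t β * t γ = 1) (y : Fn r) :
    |𝔼 a, psi (LL (fun β => c0 β + c1 β) (y + z a)).re -
      𝔼 b, psi (LL (fun β => c0 β + c1 β * t β) (y + z' b)).re| ≤
      14 * (𝔼 a, ‖LL c1 (y + z a)‖ ^ 3 + 𝔼 b, ‖LL (fun β => c1 β * t β) (y + z' b)‖ ^ 3) := by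
  have h1' : CS (fun β => c1 β * t β) := fun β => by
    simp only [h1 β, ht β, map_mul]
  have hc' : ∀ β, κ < supp β → (fun β => c1 β * t β) β = 0 := fun β h => by simp [hc β h]
  have hA1' : ∀ β, ¬ Act β → (fun β => c1 β * t β) β = 0 := fun β h => by simp [hA1 β h]
  have e1 : ∀ a, (LL (fun β => c0 β + c1 β) (y + z a)).re = (LL c0 y).re + (LL c1 (y + z a)).re := by
    intro a; rw [LL_add, Complex.add_re, LL_shift0 hz hA0]
  have e2 : ∀ b, (LL (fun β => c0 β + c1 β * t β) (y + z' b)).re =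
      (LL c0 y).re + (LL (fun β => c1 β * t β) (y + z' b)).re := by
    intro a; rw [LL_add c0 (fun β => c1 β * t β), Complex.add_re, LL_shift0 hz' hA0]
  simp only [e1, e2]
  refine (taylor_compare _ _ _ ?_ ?_).trans ?_
  · apply Complex.ofReal_injective
    push_cast
    simp only [LL_re h1, LL_re h1']
    rw [good_mom1 hz hc hA1, good_mom1 hz' hc' hA1']
  · apply Complex.ofReal_injective
    push_cast
    simp only [LL_re h1, LL_re h1']
    rw [good_mom2 hz hc, good_mom2 hz' hc']
    refine sum_congr rfl fun β _ => sum_congr rfl fun γ _ => ?_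
    by_cases h : Act (β + γ)
    · rw [ind_false (not_not.2 h)]; simp
    · have := htt β γ h
      linear_combination (-(c1 β * c1 γ * chi (β + γ) y * (ind (¬ Act (β + γ)) : ℂ))) * this
  · simp only [norm_eq_re h1, norm_eq_re h1']
    exact le_rfl
end
end S5

open scoped BigOperators
set_option linter.unusedVariables false
set_option linter.unusedSectionVars false
namespace S5
open Finset
section
variable {r : ℕ}
local notation "conj" => starRingEnd ℂ

lemma cube_le {a s : ℝ} (ha : 0 ≤ a) (hs : 0 < s) : a ^ 3 ≤ (s * a ^ 2 + a ^ 4 / s) / 2 := by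
  have h : a ^ 4 / s * s = a ^ 4 := div_mul_cancel₀ _ hs.ne'
  have h2 : 0 ≤ (s * a - a ^ 2) ^ 2 / s := by positivity
  have h3 : (s * a - a ^ 2) ^ 2 / s = s * a ^ 2 - 2 * a ^ 3 + a ^ 4 / s := by field_simp; ring
  linarith

lemma mom3 {d κ : ℕ} (hκ : 4 * κ < 2 ^ (d + 1)) {c : Fn r → ℂ} (hc : ∀ β, κ < supp β → c β = 0)
    {s : ℝ} (hs : 0 < s) (y : Fn r) :
    𝔼 f : P r (2 * d), ‖LL c (f + y)‖ ^ 3 ≤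
      (s * (∑ β, ‖c β‖ ^ 2) + 16 ^ κ * (∑ β, ‖c β‖ ^ 2) ^ 2 / s) / 2 := by
  calc 𝔼 f : P r (2 * d), ‖LL c (f + y)‖ ^ 3
      ≤ 𝔼 f : P r (2 * d), (s * ‖LL c (f + y)‖ ^ 2 + ‖LL c (f + y)‖ ^ 4 / s) / 2 :=
        expect_le_expect fun f _ => cube_le (norm_nonneg _) hs
    _ = (s * 𝔼 f : P r (2 * d), ‖LL c (f + y)‖ ^ 2 +
          (𝔼 f : P r (2 * d), ‖LL c (f + y)‖ ^ 4) / s) / 2 := by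
        rw [← expect_div, expect_add_distrib, ← mul_expect, ← expect_div]
    _ ≤ _ := by
        rw [mom2 (by omega) hc, mom4 hκ hc, parseval_LL]
        have := hyper hc
        gcongr

def Act (I : Finset (Pt r)) (e β : Fn r) : Prop := ∃ x, x ∉ I ∧ e x ≠ 0 ∧ β x ≠ 0

def offI (I : Finset (Pt r)) : Fn r := fun x => if x ∈ I then 0 else 1

def VI (I : Finset (Pt r)) (D : ℕ) : Submodule F3 (Fn r) where
  carrier := {g | g ∈ P r D ∧ ∀ x ∈ I, g x = 0}
  add_mem' := fun {a b} ha hb => ⟨add_mem ha.1 hb.1, fun x hx => by simp [ha.2 x hx, hb.2 x hx]⟩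
  zero_mem' := ⟨zero_mem _, fun x _ => rfl⟩
  smul_mem' := fun c a ha => ⟨Submodule.smul_mem _ _ ha.1, fun x hx => by simp [ha.2 x hx]⟩

lemma good_V {κ q : ℕ} {I : Finset (Pt r)} (hI : I.card + 2 * κ < 2 ^ (q + 1)) (e : Fn r) :
    Good κ (Act I e) (fun g : VI I (2 * q) => e * (g : Fn r)) := by
  classical
  constructor
  · intro γ hγ hs
    simp only [chi_mul_swap]
    rw [expect_chi, if_neg]
    intro hmem
    obtain ⟨x, hxI, hex, hx⟩ := hγ
    obtain ⟨p, hp, hpx⟩ := interp q (I ∪ sF γ)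
      (lt_of_le_of_lt (card_union_le _ _) (by rw [← supp_eq]; omega)) (Pi.single x 1)
    have h1 : p ∈ VI I (2 * q) := ⟨hp, fun y hy => by
      rw [hpx y (mem_union_left _ hy), Pi.single_eq_of_ne]
      rintro rfl; exact hxI hy⟩
    have h2 := (mem_perp.1 hmem) p h1
    unfold dotF at h2
    rw [sum_eq_single x] at h2
    · rw [hpx x (mem_union_right _ (mem_sF.2 hx)), Pi.single_eq_same, mul_one, Pi.mul_apply] at h2
      exact (mul_ne_zero hx hex) h2
    · intro y _ hy
      by_cases hy0 : γ y = 0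
      · simp [hy0]
      · rw [hpx y (mem_union_right _ (mem_sF.2 hy0)), Pi.single_eq_of_ne hy, mul_zero]
    · simp
  · intro γ hγ g
    have : dotF γ (e * (g : Fn r)) = 0 := by
      unfold dotF
      refine sum_eq_zero fun x _ => ?_
      by_cases hx : x ∈ I
      · simp [g.2.2 x hx]
      · by_cases he : e x = 0
        · simp [he]
        · by_cases hg : γ x = 0
          · simp [hg]
          · exact absurd ⟨x, hx, he, hg⟩ hγ
    rw [chi_eq, this, ee_zero]

lemma good_G {κ : ℕ} {I : Finset (Pt r)} (e : Fn r) :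
    Good κ (Act I e) (fun G : Fn r => (e * offI I) * G) := by
  classical
  constructor
  · intro γ hγ hs
    simp only [chi_mul_swap]
    rw [← expect_top (fun f => chi (γ * (e * offI I)) f), expect_chi, if_neg]
    intro hmem
    obtain ⟨x, hxI, hex, hx⟩ := hγ
    have h2 := (mem_perp.1 hmem) (Pi.single x 1) trivial
    unfold dotF at h2
    rw [sum_eq_single x] at h2
    · rw [Pi.single_eq_same, mul_one, Pi.mul_apply, Pi.mul_apply, offI, if_neg hxI, mul_one] at h2
      exact (mul_ne_zero hx hex) h2
    · intro y _ hy
      rw [Pi.single_eq_of_ne hy, mul_zero]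
    · simp
  · intro γ hγ g
    have : dotF γ ((e * offI I) * (g : Fn r)) = 0 := by
      unfold dotF
      refine sum_eq_zero fun x _ => ?_
      by_cases hx : x ∈ I
      · simp [offI, hx]
      · by_cases he : e x = 0
        · simp [he]
        · by_cases hg : γ x = 0
          · simp [hg]
          · exact absurd ⟨x, hx, he, hg⟩ hγ
    rw [chi_eq, this, ee_zero]

noncomputable def infA (c : Fn r → ℂ) (Q : Fn r → Prop) : ℝ := ∑ β, ind (Q β) * ‖c β‖ ^ 2

lemma step {κ d j q : ℕ} (hκ : 4 * κ < 2 ^ (d + 1)) {I J : Finset (Pt r)}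
    (hI : I.card + 2 * κ < 2 ^ (q + 1)) (hjq : 2 * j + 2 * q ≤ 2 * d) {e m : Fn r}
    (he : e ∈ P r (2 * j)) (he2 : e * e = e) (hme : m * e = 0)
    (hJ : ∀ x ∈ J, x ∉ I ∧ e x ≠ 0) {c : Fn r → ℂ} (hCS : CS c)
    (hc : ∀ β, κ < supp β → c β = 0) {u : ℂ} (hu : ‖u‖ = 1) {s : ℝ} (hs : 0 < s) :
    |𝔼 G : Fn r, 𝔼 f : P r (2 * d), psi (LL c (f + m * G)).re -
      𝔼 G : Fn r, 𝔼 f : P r (2 * d), psi (LL (fun β => c β * tw u J β) (f + (m + e * offI I) * G)).re| ≤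
      14 * (s * infA c (Act I e) + 16 ^ κ * (infA c (Act I e)) ^ 2 / s) := by
  classical
  set A := Act I e with hA
  set V := VI I (2 * q) with hV
  set n := offI I with hn
  have hnn : n * n = n := by ext x; simp [hn, offI]
  have heV : ∀ g : V, e * (g : Fn r) ∈ P r (2 * d) := fun g => P_mul_le he g.2.1 hjq
  have hAneg : ∀ β, A (-β) ↔ A β := by intro β; simp [hA, Act]
  set c0 : Fn r → ℂ := fun β => if A β then 0 else c β with hc0
  set c1 : Fn r → ℂ := fun β => if A β then c β else 0 with hc1
  have hs0 : CS c0 := fun β => by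
    simp only [hc0, hAneg, hCS β]; split_ifs <;> simp
  have hs1 : CS c1 := fun β => by
    simp only [hc1, hAneg, hCS β]; split_ifs <;> simp
  have hst : CS (tw u J) := tw_neg u J
  have hcl : ∀ β, κ < supp β → c1 β = 0 := fun β h => by simp [hc1, hc β h]
  have hcl' : ∀ β, κ < supp β → (fun β => c1 β * tw u J β) β = 0 := fun β h => by simp [hc1, hc β h]
  have hX : ∑ β, ‖c1 β‖ ^ 2 = infA c A := by
    unfold infA
    refine sum_congr rfl fun β _ => ?_
    simp only [hc1]
    split_ifs with h
    · rw [ind_true h, one_mul]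
    · rw [ind_false h]; simp
  have hX' : ∑ β, ‖(fun β => c1 β * tw u J β) β‖ ^ 2 = infA c A := by
    rw [← hX]
    refine sum_congr rfl fun β _ => ?_
    simp only [norm_mul, norm_tw hu, mul_one]
  have ec : c = fun β => c0 β + c1 β := by
    ext β; simp only [hc0, hc1]; split_ifs <;> simp
  have ec' : (fun β => c β * tw u J β) = fun β => c0 β + c1 β * tw u J β := by
    ext β; simp only [hc0, hc1]
    split_ifs with h
    · simp
    · rw [tw_one, mul_one]
      · simp
      · intro x hx
        by_contra h0
        exact h ⟨x, (hJ x hx).1, (hJ x hx).2, h0⟩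
  have L1 : 𝔼 G : Fn r, 𝔼 f : P r (2 * d), psi (LL c (f + m * G)).re =
      𝔼 G : Fn r, 𝔼 f : P r (2 * d), 𝔼 g : V, psi (LL c (f + m * G + e * g)).re := by
    refine expect_congr rfl fun G _ => ?_
    rw [expect_comm]
    calc 𝔼 f : P r (2 * d), psi (LL c (f + m * G)).re
        = 𝔼 _g : V, 𝔼 f : P r (2 * d), psi (LL c (f + m * G)).re := by
          rw [expect_const univ_nonempty]
      _ = _ := by
          refine expect_congr rfl fun g _ => ?_
          rw [← expect_trans (heV g) (fun f => psi (LL c (f + m * G)).re)]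
          refine expect_congr rfl fun f _ => ?_
          rw [add_right_comm]
  set c' := fun β => c β * tw u J β with hc'
  have L2 : 𝔼 G : Fn r, 𝔼 f : P r (2 * d), psi (LL c' (f + (m + e * n) * G)).re =
      𝔼 G : Fn r, 𝔼 f : P r (2 * d), 𝔼 G' : Fn r, psi (LL c' (f + m * G + (e * n) * G')).re := by
    have a1 : ∀ G' : Fn r, 𝔼 G : Fn r, 𝔼 f : P r (2 * d), psi (LL c' (f + (m + e * n) * G)).re =
        𝔼 G : Fn r, 𝔼 f : P r (2 * d), psi (LL c' (f + m * G + (e * n) * (G' + G))).re := by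
      intro G'
      rw [← expect_trans_top (e * n * G') (fun G => 𝔼 f : P r (2 * d), psi (LL c' (f + (m + e * n) * G)).re)]
      refine expect_congr rfl fun G _ => expect_congr rfl fun f _ => ?_
      congr 3
      linear_combination (n * G') * hme + (n * n * G') * he2 + e * G' * hnn
    calc 𝔼 G : Fn r, 𝔼 f : P r (2 * d), psi (LL c' (f + (m + e * n) * G)).re
        = 𝔼 _G' : Fn r, 𝔼 G : Fn r, 𝔼 f : P r (2 * d), psi (LL c' (f + (m + e * n) * G)).re := by
          rw [expect_const univ_nonempty]
      _ = 𝔼 G' : Fn r, 𝔼 G : Fn r, 𝔼 f : P r (2 * d),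
            psi (LL c' (f + m * G + (e * n) * (G' + G))).re := expect_congr rfl fun G' _ => a1 G'
      _ = 𝔼 G : Fn r, 𝔼 G' : Fn r, 𝔼 f : P r (2 * d),
            psi (LL c' (f + m * G + (e * n) * (G' + G))).re := expect_comm _ _ _
      _ = 𝔼 G : Fn r, 𝔼 G' : Fn r, 𝔼 f : P r (2 * d),
            psi (LL c' (f + m * G + (e * n) * G')).re :=
          expect_congr rfl fun G _ => expect_trans_top G
            (fun G' => 𝔼 f : P r (2 * d), psi (LL c' (f + m * G + (e * n) * G')).re)
      _ = _ := expect_congr rfl fun G _ => expect_comm _ _ _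
  rw [L1, L2, ← expect_sub_distrib]
  simp only [← expect_sub_distrib]
  have hgV := good_V (κ := κ) hI e
  have hgG := good_G (κ := κ) (I := I) e
  have PS : ∀ y : Fn r, |𝔼 g : V, psi (LL c (y + e * g)).re -
      𝔼 G' : Fn r, psi (LL c' (y + (e * n) * G')).re| ≤
      14 * (𝔼 g : V, ‖LL c1 (y + e * g)‖ ^ 3 +
        𝔼 G' : Fn r, ‖LL (fun β => c1 β * tw u J β) (y + (e * n) * G')‖ ^ 3) := by
    intro y
    have := point_step hgV hgG hs0 hs1 hst hcl (fun β h => by simp only [hc0]; rw [if_pos h])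
      (fun β h => by simp only [hc1]; rw [if_neg h])
      (fun β γ h => tw_mul_one hu fun x hx => by
        by_contra h0
        exact h ⟨x, (hJ x hx).1, (hJ x hx).2, h0⟩) y
    rw [← ec, ← ec'] at this
    exact this
  calc |𝔼 G : Fn r, 𝔼 f : P r (2 * d), (𝔼 g : V, psi (LL c (f + m * G + e * g)).re -
          𝔼 G' : Fn r, psi (LL c' (f + m * G + (e * n) * G')).re)|
      ≤ 𝔼 G : Fn r, |𝔼 f : P r (2 * d), (𝔼 g : V, psi (LL c (f + m * G + e * g)).re -
          𝔼 G' : Fn r, psi (LL c' (f + m * G + (e * n) * G')).re)| := abs_expect_le _ _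
    _ ≤ 𝔼 G : Fn r, 𝔼 f : P r (2 * d), |𝔼 g : V, psi (LL c (f + m * G + e * g)).re -
          𝔼 G' : Fn r, psi (LL c' (f + m * G + (e * n) * G')).re| :=
        expect_le_expect fun G _ => abs_expect_le _ _
    _ ≤ 𝔼 G : Fn r, 𝔼 f : P r (2 * d), 14 * (𝔼 g : V, ‖LL c1 (f + m * G + e * g)‖ ^ 3 +
        𝔼 G' : Fn r, ‖LL (fun β => c1 β * tw u J β) (f + m * G + (e * n) * G')‖ ^ 3) :=
        expect_le_expect fun G _ => expect_le_expect fun f _ => PS _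
    _ ≤ 𝔼 _G : Fn r, 14 * (s * infA c A + 16 ^ κ * (infA c A) ^ 2 / s) := by
        refine expect_le_expect fun G _ => ?_
        rw [← mul_expect]
        refine mul_le_mul_of_nonneg_left ?_ (by norm_num)
        rw [expect_add_distrib, expect_comm, expect_comm (t := (univ : Finset (Fn r)))]
        have b1 : 𝔼 g : V, 𝔼 f : P r (2 * d), ‖LL c1 (f + m * G + e * g)‖ ^ 3 ≤
            (s * infA c A + 16 ^ κ * (infA c A) ^ 2 / s) / 2 := by
          refine expect_le_const fun g => ?_
          have := mom3 hκ hcl hs (m * G + e * g)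
          rw [hX] at this
          simpa only [add_assoc] using this
        have b2 : 𝔼 G' : Fn r, 𝔼 f : P r (2 * d),
            ‖LL (fun β => c1 β * tw u J β) (f + m * G + (e * n) * G')‖ ^ 3 ≤
            (s * infA c A + 16 ^ κ * (infA c A) ^ 2 / s) / 2 := by
          refine expect_le_const fun g => ?_
          have := mom3 hκ hcl' hs (m * G + (e * n) * g)
          rw [hX'] at this
          simpa only [add_assoc] using this
        linarith
    _ = _ := expect_const univ_nonempty _
end
end S5

open scoped BigOperators
set_option linter.unusedVariables false
set_option linter.unusedSectionVars false
namespace S5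
open Finset
section
variable {r : ℕ}
local notation "conj" => starRingEnd ℂ

lemma infA_tw {c : Fn r → ℂ} {u : ℂ} (hu : ‖u‖ = 1) (J : Finset (Pt r)) (Q : Fn r → Prop) :
    infA (fun β => c β * tw u J β) Q = infA c Q := by
  unfold infA
  refine sum_congr rfl fun β _ => ?_
  simp only [norm_mul, norm_tw hu, mul_one]

def mS {ι : Type} [DecidableEq ι] (I : Finset (Pt r)) (h : Pt r → ι) (S : Finset ι) : Fn r :=
  fun x => if x ∉ I ∧ h x ∈ S then 1 else 0

lemma lind {κ d j q : ℕ} (hκ : 4 * κ < 2 ^ (d + 1)) {I J : Finset (Pt r)}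
    (hI : I.card + 2 * κ < 2 ^ (q + 1)) (hjq : 2 * j + 2 * q ≤ 2 * d)
    {ι : Type} [Fintype ι] [DecidableEq ι] {h : Pt r → ι} (hcell : ∀ b, cell h b ∈ P r (2 * j))
    (hJ : ∀ x ∈ J, x ∉ I) {c : Fn r → ℂ} (hCS : CS c)
    (hc : ∀ β, κ < supp β → c β = 0) {u : ℂ} (hu : ‖u‖ = 1) {s : ℝ} (hs : 0 < s) (S : Finset ι) :
    |𝔼 G : Fn r, 𝔼 f : P r (2 * d), psi (LL c (f + 0 * G)).re -
      𝔼 G : Fn r, 𝔼 f : P r (2 * d),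
        psi (LL (fun β => c β * tw u (J.filter fun x => h x ∈ S) β) (f + mS I h S * G)).re| ≤
      ∑ b ∈ S, 14 * (s * infA c (Act I (cell h b)) + 16 ^ κ * (infA c (Act I (cell h b))) ^ 2 / s) := by
  classical
  induction S using Finset.induction_on with
  | empty =>
    have h1 : mS I h ∅ = 0 := by ext x; simp [mS]
    have h2 : (fun β => c β * tw u (J.filter fun x => h x ∈ (∅ : Finset ι)) β) = c := by
      ext β; simp [tw]
    rw [h1, h2]; simp
  | insert b S hb ih =>
    rw [sum_insert hb]
    set cS : Fn r → ℂ := fun β => c β * tw u (J.filter fun x => h x ∈ S) β with hcS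
    have hcsS : CS cS := fun β => by
      simp only [hcS]; rw [hCS β, tw_neg, map_mul]
    have hcS0 : ∀ β, κ < supp β → cS β = 0 := fun β hβ => by simp [hcS, hc β hβ]
    have := step hκ hI hjq (e := cell h b) (m := mS I h S) (J := J.filter fun x => h x = b)
      (hcell b) (by ext x; simp [cell])
      (by
        ext x
        simp only [mS, cell, Pi.mul_apply, Pi.zero_apply]
        split_ifs with h1 h2 <;> simp
        exact hb (h2 ▸ h1.2))
      (by
        intro x hx
        rw [mem_filter] at hx
        exact ⟨hJ x hx.1, by simp [cell, hx.2]⟩) hcsS hcS0 hu hs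
    have e1 : (fun β => cS β * tw u (J.filter fun x => h x = b) β) =
        fun β => c β * tw u (J.filter fun x => h x ∈ insert b S) β := by
      ext β
      simp only [hcS]
      rw [mul_assoc]
      congr 1
      unfold tw
      rw [← prod_union]
      · congr 1
        ext x; simp only [mem_union, mem_filter, mem_insert]; tauto
      · rw [disjoint_left]
        intro x hx hx'
        rw [mem_filter] at hx hx'
        exact hb (hx'.2 ▸ hx.2)
    have e2 : mS I h S + cell h b * offI I = mS I h (insert b S) := by
      ext x
      simp only [mS, cell, offI, Pi.add_apply, Pi.mul_apply, mem_insert]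
      by_cases h1 : x ∈ I <;> by_cases h2 : h x = b <;> by_cases h3 : h x ∈ S <;> simp [h1, h2, h3]
      · exact absurd (h2 ▸ h3) hb
      · exact hb
    rw [e1, e2, infA_tw hu] at this
    refine le_trans (abs_sub_le _ _ _) (le_trans (add_le_add ih this) (le_of_eq (add_comm _ _)))

lemma full_mix (V : Submodule F3 (Fn r)) (I : Finset (Pt r))
    (hV : ∀ K : Fn r, ∃ p ∈ V, ∀ x ∈ I, p x = K x) (F : Fn r → ℝ) :
    𝔼 G : Fn r, 𝔼 f : V, F (f + offI I * G) = 𝔼 f : Fn r, F f := by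
  have h1 : ∀ f0 : Fn r, 𝔼 G : Fn r, F (f0 + offI I * G) =
      𝔼 G : Fn r, F ((1 - offI I) * f0 + offI I * G) := by
    intro f0
    rw [← expect_trans_top (-f0) (fun G => F (f0 + offI I * G))]
    refine expect_congr rfl fun G _ => ?_
    congr 1; ring
  calc 𝔼 G : Fn r, 𝔼 f : V, F (f + offI I * G)
      = 𝔼 f : V, 𝔼 G : Fn r, F (f + offI I * G) := expect_comm _ _ _
    _ = 𝔼 f : Fn r, 𝔼 G : Fn r, F (f + offI I * G) :=
        law V I hV (fun f => 𝔼 G : Fn r, F (f + offI I * G)) (by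
          intro f g hfg
          show 𝔼 G : Fn r, F (f + offI I * G) = 𝔼 G : Fn r, F (g + offI I * G)
          rw [h1 f, h1 g]
          have : (1 - offI I) * f = (1 - offI I) * g := by
            ext x
            by_cases hx : x ∈ I
            · simp [hfg x hx]
            · simp [offI, hx]
          rw [this])
    _ = 𝔼 G : Fn r, 𝔼 f : Fn r, F (f + offI I * G) := expect_comm _ _ _
    _ = 𝔼 G : Fn r, 𝔼 f : Fn r, F f := expect_congr rfl fun G _ => expect_trans_top _ F
    _ = _ := expect_const univ_nonempty _

lemma infA_nonneg (c : Fn r → ℂ) (Q : Fn r → Prop) : 0 ≤ infA c Q :=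
  sum_nonneg fun β _ => mul_nonneg (ind_nonneg _) (sq_nonneg _)

noncomputable def Ix (c : Fn r → ℂ) (x : Pt r) : ℝ := infA c (fun β => β x ≠ 0)

lemma Ix_nonneg (c : Fn r → ℂ) (x : Pt r) : 0 ≤ Ix c x := infA_nonneg _ _

lemma sum_Ix {κ : ℕ} {c : Fn r → ℂ} (hc : ∀ β, κ < supp β → c β = 0)
    (h1 : ∑ β, ‖c β‖ ^ 2 ≤ 1) : ∑ x, Ix c x ≤ κ := by
  unfold Ix infA
  rw [sum_comm]
  calc ∑ β, ∑ x, ind (β x ≠ 0) * ‖c β‖ ^ 2 ≤ ∑ β : Fn r, (κ : ℝ) * ‖c β‖ ^ 2 := by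
        refine sum_le_sum fun β _ => ?_
        rw [← sum_mul, sum_ind_supp]
        by_cases h : κ < supp β
        · rw [hc β h]; simp
        · gcongr; omega
    _ ≤ κ := by
        rw [← mul_sum]
        exact mul_le_of_le_one_right (Nat.cast_nonneg _) h1

lemma infA_act {ι : Type} [DecidableEq ι] (c : Fn r → ℂ) (I : Finset (Pt r)) (h : Pt r → ι) (b : ι) :
    infA c (Act I (cell h b)) ≤ ∑ x, ind (x ∉ I ∧ h x = b) * Ix c x := by
  unfold Ix infA
  simp only [mul_sum]
  rw [sum_comm]
  refine sum_le_sum fun β _ => ?_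
  by_cases hA : Act I (cell h b) β
  · rw [ind_true hA, one_mul]
    obtain ⟨x, hx, hx2, hx3⟩ := hA
    have hb : h x = b := by
      by_contra hne
      exact hx2 (by simp [cell, hne])
    refine le_trans (le_of_eq ?_) (single_le_sum (f := fun x => ind (x ∉ I ∧ h x = b) * (ind (β x ≠ 0) * ‖c β‖ ^ 2))
      (fun y _ => mul_nonneg (ind_nonneg _) (mul_nonneg (ind_nonneg _) (sq_nonneg _))) (mem_univ x))
    simp only [ind_true hx3, ind_true (show x ∉ I ∧ h x = b from ⟨hx, hb⟩), one_mul]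
  · rw [ind_false hA, zero_mul]
    exact sum_nonneg fun y _ => mul_nonneg (ind_nonneg _) (mul_nonneg (ind_nonneg _) (sq_nonneg _))

lemma sum_ind_eq {ι : Type} [Fintype ι] [DecidableEq ι] (b0 : ι) : ∑ b, ind (b0 = b) = 1 := by
  rw [sum_eq_single b0]
  · exact ind_true rfl
  · intro b _ hb; exact ind_false (Ne.symm hb)
  · simp

lemma sum_ind_eq_pt (x : Pt r) : ∑ y, ind (x = y) = 1 := by
  rw [sum_eq_single x]
  · exact ind_true rfl
  · intro b _ hb; exact ind_false (Ne.symm hb)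
  · simp

lemma invariance {κ d j q : ℕ} (hκ : 4 * κ < 2 ^ (d + 1)) {I J : Finset (Pt r)}
    (hI : I.card + 2 * κ < 2 ^ (q + 1)) (hjq : 2 * j + 2 * q ≤ 2 * d)
    (hJ : ∀ x ∈ J, x ∉ I) {c : Fn r → ℂ} (hCS : CS c)
    (hc : ∀ β, κ < supp β → c β = 0) (hc1 : ∑ β, ‖c β‖ ^ 2 ≤ 1) {u : ℂ} (hu : ‖u‖ = 1)
    {s δ' : ℝ} (hs : 0 < s) (hinf : ∀ x, x ∉ I → Ix c x ≤ δ') (hδ : 0 ≤ δ') :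
    𝔼 f : Fn r, psi (LL (fun β => c β * tw u J β) f).re ≤
      𝔼 f : P r (2 * d), psi (LL c f).re +
        14 * (s * κ + 16 ^ κ * (δ' * κ + (1 / 3) ^ j * κ ^ 2) / s) := by
  classical
  obtain ⟨ι, _, _, h, hcell, hpot⟩ := hash_exists (r := r) (s := 0) le_rfl zero_le_one (κ := 0) (D := 0)
    (W := fun x y => Ix c x * Ix c y) (M := ∅) (w := fun _ => 0)
    (fun x y => mul_nonneg (Ix_nonneg c x) (Ix_nonneg c y)) (by simp) (by simp) j
  unfold pot at hpot
  rw [sum_empty, sum_empty, add_zero, add_zero] at hpot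
  have hsum := sum_Ix hc hc1
  have hsum0 : 0 ≤ ∑ x, Ix c x := sum_nonneg fun x _ => Ix_nonneg c x
  have hcoll : ∑ x, ∑ y, Ix c x * Ix c y * ind (x ≠ y ∧ h x = h y) ≤ (1 / 3) ^ j * (κ : ℝ) ^ 2 := by
    refine hpot.trans ?_
    norm_num
    have : ∑ x, ∑ y, Ix c x * Ix c y = (∑ x, Ix c x) ^ 2 := by
      rw [sq, sum_mul_sum]
    rw [this]
    gcongr
  have hX1 : ∑ b, infA c (Act I (cell h b)) ≤ κ := by
    refine le_trans (sum_le_sum fun b _ => infA_act c I h b) ?_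
    rw [sum_comm]
    refine le_trans (sum_le_sum fun x _ => ?_) hsum
    rw [← sum_mul]
    refine mul_le_of_le_one_left (Ix_nonneg c x) ?_
    rw [← sum_ind_eq (h x)]
    exact sum_le_sum fun b _ => ind_mono (fun h => h.2)
  have hX2 : ∑ b, infA c (Act I (cell h b)) ^ 2 ≤ δ' * κ + (1 / 3) ^ j * (κ : ℝ) ^ 2 := by
    calc ∑ b, infA c (Act I (cell h b)) ^ 2
        ≤ ∑ b, (∑ x, ind (x ∉ I ∧ h x = b) * Ix c x) ^ 2 := by
          refine sum_le_sum fun b _ => pow_le_pow_left₀ (infA_nonneg _ _) (infA_act c I h b) 2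
      _ = ∑ b, ∑ x, ∑ y, (ind (x ∉ I ∧ h x = b) * Ix c x) * (ind (y ∉ I ∧ h y = b) * Ix c y) := by
          refine sum_congr rfl fun b _ => ?_
          rw [sq, sum_mul_sum]
      _ = ∑ x, ∑ y, ∑ b, (ind (x ∉ I ∧ h x = b) * Ix c x) * (ind (y ∉ I ∧ h y = b) * Ix c y) := by
          rw [sum_comm]
          exact sum_congr rfl fun x _ => sum_comm
      _ ≤ ∑ x, ∑ y, (δ' * Ix c x * ind (x = y) + Ix c x * Ix c y * ind (x ≠ y ∧ h x = h y)) := by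
          refine sum_le_sum fun x _ => sum_le_sum fun y _ => ?_
          have hx0 := Ix_nonneg c x
          have hy0 := Ix_nonneg c y
          have hpt : ∀ b, (ind (x ∉ I ∧ h x = b) * Ix c x) * (ind (y ∉ I ∧ h y = b) * Ix c y) ≤
              ind (h x = b) * (δ' * Ix c x * ind (x = y) + Ix c x * Ix c y * ind (x ≠ y ∧ h x = h y)) := by
            intro b
            by_cases h1 : x ∉ I ∧ h x = b
            · by_cases h2 : y ∉ I ∧ h y = b
              · rw [ind_true h1, ind_true h2, ind_true h1.2, one_mul, one_mul, one_mul]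
                by_cases hxy : x = y
                · subst hxy
                  rw [ind_true rfl, ind_false (by simp)]
                  have := hinf x h1.1
                  nlinarith
                · rw [ind_false hxy, ind_true ⟨hxy, h1.2.trans h2.2.symm⟩]
                  linarith
              · rw [ind_false h2]
                have a1 := ind_nonneg (h x = b)
                have a2 := ind_nonneg (x = y)
                have a3 := ind_nonneg (x ≠ y ∧ h x = h y)
                have : 0 ≤ ind (h x = b) * (δ' * Ix c x * ind (x = y) + Ix c x * Ix c y * ind (x ≠ y ∧ h x = h y)) := by positivity
                linarith
            · rw [ind_false h1]
              have a1 := ind_nonneg (h x = b)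
              have a2 := ind_nonneg (x = y)
              have a3 := ind_nonneg (x ≠ y ∧ h x = h y)
              have : 0 ≤ ind (h x = b) * (δ' * Ix c x * ind (x = y) + Ix c x * Ix c y * ind (x ≠ y ∧ h x = h y)) := by positivity
              linarith
          refine le_trans (sum_le_sum fun b _ => hpt b) ?_
          rw [← sum_mul, sum_ind_eq, one_mul]
      _ = δ' * (∑ x, Ix c x) + ∑ x, ∑ y, Ix c x * Ix c y * ind (x ≠ y ∧ h x = h y) := by
          simp only [sum_add_distrib, ← mul_sum, sum_ind_eq_pt, mul_one]
      _ ≤ _ := by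
          gcongr
  have hL := lind hκ hI hjq hcell hJ hCS hc hu hs univ
  have e1 : (J.filter fun x => h x ∈ (univ : Finset ι)) = J := by simp
  have e2 : mS I h univ = offI I := by
    ext x; simp only [mS, offI, mem_univ, and_true]
    split_ifs <;> simp_all
  rw [e1, e2, full_mix (P r (2 * d)) I (fun K => by
      obtain ⟨p, hp, hpx⟩ := interp q I (by omega) K
      exact ⟨p, P_mono (by omega) hp, hpx⟩)
    (fun f => psi (LL (fun β => c β * tw u J β) f).re)] at hL
  simp only [zero_mul, add_zero] at hL
  rw [expect_const univ_nonempty] at hL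
  have hL2 := (abs_sub_le_iff.1 hL).2
  have hf : ∑ b, 14 * (s * infA c (Act I (cell h b)) + 16 ^ κ * (infA c (Act I (cell h b))) ^ 2 / s) ≤
      14 * (s * κ + 16 ^ κ * (δ' * κ + (1 / 3) ^ j * κ ^ 2) / s) := by
    rw [← mul_sum, sum_add_distrib, ← mul_sum, ← sum_div, ← mul_sum]
    gcongr
  linarith

end
end S5

open scoped BigOperators
set_option linter.unusedVariables false
set_option linter.unusedSectionVars false
namespace S5
open Finset
section
variable {r : ℕ}
local notation "conj" => starRingEnd ℂ

def RH {Ω : Type*} [Fintype Ω] (k : Ω → Ω → ℝ) : Prop :=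
  ∀ f g : Ω → ℝ, (∀ o, 0 ≤ f o) → (∀ o, 0 ≤ g o) →
    (𝔼 o, f o) ^ 4 * (𝔼 o, g o) ^ 4 ≤ 𝔼 x, 𝔼 y, k x y * (f x ^ 4 * g y ^ 4)

lemma RH_prod {Ω1 Ω2 : Type*} [Fintype Ω1] [Fintype Ω2]
    {k1 : Ω1 → Ω1 → ℝ} {k2 : Ω2 → Ω2 → ℝ} (hk1 : ∀ x y, 0 ≤ k1 x y) (h1 : RH k1) (h2 : RH k2) :
    RH (fun x y : Ω1 × Ω2 => k1 x.1 y.1 * k2 x.2 y.2) := by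
  intro f g hf hg
  have hf' : ∀ x, 0 ≤ 𝔼 x2, f (x, x2) := fun x => expect_nonneg fun _ _ => hf _
  have hg' : ∀ x, 0 ≤ 𝔼 x2, g (x, x2) := fun x => expect_nonneg fun _ _ => hg _
  calc (𝔼 o, f o) ^ 4 * (𝔼 o, g o) ^ 4
      = (𝔼 x, 𝔼 x2, f (x, x2)) ^ 4 * (𝔼 x, 𝔼 x2, g (x, x2)) ^ 4 := by
        rw [expect_prod_type, expect_prod_type]
    _ ≤ 𝔼 x, 𝔼 y, k1 x y * ((𝔼 x2, f (x, x2)) ^ 4 * (𝔼 y2, g (y, y2)) ^ 4) := h1 _ _ hf' hg'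
    _ ≤ 𝔼 x, 𝔼 y, k1 x y * 𝔼 x2, 𝔼 y2, k2 x2 y2 * (f (x, x2) ^ 4 * g (y, y2) ^ 4) := by
        refine expect_le_expect fun x _ => expect_le_expect fun y _ => ?_
        exact mul_le_mul_of_nonneg_left (h2 _ _ (fun _ => hf _) (fun _ => hg _)) (hk1 x y)
    _ = _ := by
        simp only [expect_prod_type]
        symm
        refine expect_congr rfl fun x _ => (expect_comm _ _ _).trans ?_
        refine expect_congr rfl fun y _ => ?_
        simp only [mul_expect]
        exact expect_congr rfl fun x2 _ => expect_congr rfl fun y2 _ => by ring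

lemma RH_equiv {Ω Ω' : Type*} [Fintype Ω] [Fintype Ω'] (e : Ω ≃ Ω') {k : Ω → Ω → ℝ} {k' : Ω' → Ω' → ℝ}
    (hk : ∀ x y, k' (e x) (e y) = k x y) (h : RH k) : RH k' := by
  intro f g hf hg
  have := h (fun o => f (e o)) (fun o => g (e o)) (fun o => hf _) (fun o => hg _)
  rw [← Fintype.expect_equiv e (fun o => f (e o)) f fun o => rfl,
    ← Fintype.expect_equiv e (fun o => g (e o)) g fun o => rfl]
  refine this.trans (le_of_eq ?_)
  refine Fintype.expect_equiv e _ _ fun x => Fintype.expect_equiv e _ _ fun y => ?_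
  rw [hk]

noncomputable def k3 (x y : F3) : ℝ := 9 / 5 * ind (x = y) + 2 / 5

lemma k3_nonneg (x y : F3) : 0 ≤ k3 x y := by
  have := ind_nonneg (x = y)
  unfold k3; positivity

lemma expect_F3R (f : F3 → ℝ) : 𝔼 x, f x = (f 0 + f 1 + f 2) / 3 := by
  rw [Fintype.expect_eq_sum_div_card]
  simp only [ZMod.card]
  congr 1
  exact Fin.sum_univ_three f

lemma RH_F3_norm (f g : F3 → ℝ) (hf : ∀ o, 0 ≤ f o) (hg : ∀ o, 0 ≤ g o)
    (hf1 : 𝔼 o, f o = 1) (hg1 : 𝔼 o, g o = 1) :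
    1 ≤ 𝔼 x, 𝔼 y, k3 x y * (f x ^ 4 * g y ^ 4) := by
  have h4 : ∀ a : ℝ, 0 ≤ a → 1 + 4 * (a - 1) + 3 * (a - 1) ^ 2 ≤ a ^ 4 := by
    intro a ha
    have : a ^ 4 - (1 + 4 * (a - 1) + 3 * (a - 1) ^ 2) = (a - 1) ^ 2 * (a * (a + 2)) := by ring
    have : 0 ≤ (a - 1) ^ 2 * (a * (a + 2)) := by positivity
    linarith
  have h5 : ∀ a : ℝ, 1 + 4 * (a - 1) ≤ a ^ 4 := by
    intro a
    nlinarith [sq_nonneg (a ^ 2 - 1), sq_nonneg (a - 1)]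
  have e : 𝔼 x, 𝔼 y, k3 x y * (f x ^ 4 * g y ^ 4) =
      3 / 5 * 𝔼 x, (f x * g x) ^ 4 + 2 / 5 * ((𝔼 x, f x ^ 4) * 𝔼 y, g y ^ 4) := by
    simp only [expect_F3R]
    have d1 : (0 : F3) ≠ 1 := by decide
    have d2 : (0 : F3) ≠ 2 := by decide
    have d3 : (1 : F3) ≠ 2 := by decide
    simp only [k3, ind_true trivial, ind_false d1, ind_false d2, ind_false d3, ind_false d1.symm,
      ind_false d2.symm, ind_false d3.symm]
    ring
  rw [e]
  simp only [expect_F3R] at *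
  have f0 := hf 0
  have f1 := hf 1
  have f2 := hf 2
  have g0 := hg 0
  have g1 := hg 1
  have g2 := hg 2
  generalize f 0 = a0 at *
  generalize f 1 = a1 at *
  generalize f 2 = a2 at *
  generalize g 0 = b0 at *
  generalize g 1 = b1 at *
  generalize g 2 = b2 at *
  set FA := (a0 - 1) ^ 2 + (a1 - 1) ^ 2 + (a2 - 1) ^ 2 with hFA
  set GB := (b0 - 1) ^ 2 + (b1 - 1) ^ 2 + (b2 - 1) ^ 2 with hGB
  have hFA0 : 0 ≤ FA := by positivity
  have hGB0 : 0 ≤ GB := by positivity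
  have p1 : 1 + FA ≤ (a0 ^ 4 + a1 ^ 4 + a2 ^ 4) / 3 := by
    have := h4 a0 f0; have := h4 a1 f1; have := h4 a2 f2
    linarith
  have p2 : 1 + GB ≤ (b0 ^ 4 + b1 ^ 4 + b2 ^ 4) / 3 := by
    have := h4 b0 g0; have := h4 b1 g1; have := h4 b2 g2
    linarith
  have p3 : 1 + FA + GB ≤ (a0 ^ 4 + a1 ^ 4 + a2 ^ 4) / 3 * ((b0 ^ 4 + b1 ^ 4 + b2 ^ 4) / 3) := by
    have := mul_le_mul p1 p2 (by positivity) (by positivity)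
    nlinarith [mul_nonneg hFA0 hGB0]
  have p4 : 1 - 2 / 3 * (FA + GB) ≤ ((a0 * b0) ^ 4 + (a1 * b1) ^ 4 + (a2 * b2) ^ 4) / 3 := by
    have := h5 (a0 * b0); have := h5 (a1 * b1); have := h5 (a2 * b2)
    nlinarith [sq_nonneg (a0 - 1 + (b0 - 1)), sq_nonneg (a1 - 1 + (b1 - 1)), sq_nonneg (a2 - 1 + (b2 - 1))]
  linarith

lemma RH_F3 : RH k3 := by
  intro f g hf hg
  have hf0 : 0 ≤ 𝔼 o, f o := expect_nonneg fun _ _ => hf _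
  have hg0 : 0 ≤ 𝔼 o, g o := expect_nonneg fun _ _ => hg _
  have hR : 0 ≤ 𝔼 x, 𝔼 y, k3 x y * (f x ^ 4 * g y ^ 4) :=
    expect_nonneg fun x _ => expect_nonneg fun y _ => mul_nonneg (k3_nonneg x y) (by positivity)
  rcases hf0.eq_or_lt with h | hfp
  · rw [← h]; simpa using hR
  rcases hg0.eq_or_lt with h | hgp
  · rw [← h]; simpa using hR
  set a := 𝔼 o, f o with ha
  set b := 𝔼 o, g o with hb
  have := RH_F3_norm (fun o => f o / a) (fun o => g o / b) (fun o => div_nonneg (hf o) hf0)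
    (fun o => div_nonneg (hg o) hg0) (by rw [← expect_div, ← ha, div_self hfp.ne'])
    (by rw [← expect_div, ← hb, div_self hgp.ne'])
  have e : 𝔼 x, 𝔼 y, k3 x y * ((f x / a) ^ 4 * (g y / b) ^ 4) =
      (𝔼 x, 𝔼 y, k3 x y * (f x ^ 4 * g y ^ 4)) / (a ^ 4 * b ^ 4) := by
    simp only [expect_div]
    refine expect_congr rfl fun x _ => expect_congr rfl fun y _ => ?_
    field_simp
  rw [e, le_div_iff₀ (by positivity), one_mul] at this
  exact this

lemma RH_Fin (n : ℕ) : RH (fun x y : Fin n → F3 => ∏ i, k3 (x i) (y i)) := by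
  induction n with
  | zero =>
    intro f g hf hg
    have h : ∀ F : (Fin 0 → F3) → ℝ, 𝔼 x, F x = F default := by
      intro F; rw [Fintype.expect_eq_sum_div_card]; simp
      exact congrArg F (Subsingleton.elim _ _)
    simp [h]
  | succ n ih =>
    refine RH_equiv (Fin.consEquiv fun _ => F3) ?_ (RH_prod k3_nonneg RH_F3 ih)
    intro b o; rw [Fin.prod_univ_succ]; simp

noncomputable def kk (X Y : Fn r) : ℝ := ∏ x, k3 (X x) (Y x)

lemma RH_Fn : RH (kk (r := r)) := by
  let e := Fintype.equivFin (Pt r)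
  refine RH_equiv (Equiv.arrowCongr e.symm (Equiv.refl F3)) ?_ (RH_Fin (Fintype.card (Pt r)))
  intro b o
  unfold kk
  rw [← Equiv.prod_comp e]
  rfl

lemma kk_nonneg (X Y : Fn r) : 0 ≤ kk X Y := prod_nonneg fun _ _ => k3_nonneg _ _

lemma k3_fourier (x y : F3) :
    ((k3 x y : ℝ) : ℂ) = ∑ c : F3, (((if c = 0 then 1 else 3 / 5 : ℝ)) : ℂ) * ee (c * (y - x)) := by
  rw [sum_F3, if_pos rfl, if_neg (by decide), if_neg (by decide)]
  have hs := omega_sum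
  have key : ∀ t : F3, ((9 / 5 * ind (t = 0) + 2 / 5 : ℝ) : ℂ) =
      1 * ee (0 * t) + ((3 / 5 : ℝ) : ℂ) * ee (1 * t) + ((3 / 5 : ℝ) : ℂ) * ee (2 * t) := by
    intro t
    have h2 : (2 : F3) * 2 = 1 := by decide
    rcases F3_cases t with rfl | rfl | rfl
    · rw [ind_true rfl]; simp [ee_zero]; norm_num
    · rw [ind_false (by decide)]
      simp only [zero_mul, one_mul, mul_one, ee_zero, ee_one, ee_two]
      push_cast
      linear_combination (-3 / 5 : ℂ) * hs
    · rw [ind_false (by decide)]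
      simp only [zero_mul, one_mul, h2, ee_zero, ee_one, ee_two]
      push_cast
      linear_combination (-3 / 5 : ℂ) * hs
  have := key (y - x)
  unfold k3
  rw [ind_congr (show x = y ↔ y - x = 0 by rw [sub_eq_zero, eq_comm])]
  simpa using this

lemma kk_fourier (X Y : Fn r) :
    ((kk X Y : ℝ) : ℂ) = ∑ β : Fn r, (((3 / 5 : ℝ) ^ supp β : ℝ) : ℂ) * chi β (Y - X) := by
  unfold kk
  push_cast
  simp only [k3_fourier, chi_prod]
  rw [prod_univ_sum, Fintype.piFinset_univ]
  refine sum_congr rfl fun β _ => ?_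
  rw [prod_mul_distrib]
  congr 1
  rw [supp_eq, sF, ← prod_const, prod_filter]
  refine prod_congr rfl fun x _ => ?_
  by_cases h : β x = 0 <;> simp [h]

lemma kk_expect (X : Fn r) : 𝔼 Y : Fn r, kk X Y = 1 := by
  have h : ((𝔼 Y : Fn r, kk X Y : ℝ) : ℂ) = 1 := by
    have h1 : ((𝔼 Y : Fn r, kk X Y : ℝ) : ℂ) = 𝔼 Y : Fn r, ((kk X Y : ℝ) : ℂ) := by
      simp only [Fintype.expect_eq_sum_div_card]; push_cast; rfl
    have h2 : ∀ Y, ((kk X Y : ℝ) : ℂ) =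
        LL (fun β => (((3 / 5 : ℝ) ^ supp β : ℝ) : ℂ) * conj (chi β X)) Y * conj (LL (fun β => if β = 0 then 1 else 0) Y) := by
      intro Y
      rw [kk_fourier]
      unfold LL
      simp only [ite_mul, one_mul, zero_mul, sum_ite_eq', mem_univ, if_true, chi_zero_left, map_one, mul_one]
      refine sum_congr rfl fun β _ => ?_
      rw [sub_eq_add_neg, chi_add_right, chi_neg_right]; ring
    rw [h1]
    simp only [h2]
    rw [plancherel_LL, sum_eq_single 0]
    · have : supp (0 : Fn r) = 0 := supp_eq_zero.2 rfl
      simp [chi_zero_left, this]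
    · intro b _ hb; simp [hb]
    · simp
  exact_mod_cast h

lemma kk_symm (X Y : Fn r) : kk X Y = kk Y X := by
  unfold kk k3
  refine prod_congr rfl fun x _ => ?_
  rw [ind_congr eq_comm]

noncomputable def QQ (F G : Fn r → ℝ) : ℝ := 𝔼 X : Fn r, 𝔼 Y : Fn r, kk X Y * (F X * G Y)

lemma QQ_fst (F : Fn r → ℝ) : 𝔼 X : Fn r, 𝔼 Y : Fn r, kk X Y * F X = 𝔼 X, F X := by
  refine expect_congr rfl fun X _ => ?_
  rw [← expect_mul, kk_expect, one_mul]

lemma QQ_snd (F : Fn r → ℝ) : 𝔼 X : Fn r, 𝔼 Y : Fn r, kk X Y * F Y = 𝔼 X, F X := by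
  rw [expect_comm]
  refine expect_congr rfl fun X _ => ?_
  simp only [kk_symm _ X]
  rw [← expect_mul, kk_expect, one_mul]

lemma QQ_bound (F G : Fn r → ℝ) {t : ℝ} (ht : 0 < t) :
    |QQ F G| ≤ ((𝔼 X, F X ^ 2) / t + t * 𝔼 X, G X ^ 2) / 2 := by
  have hpt : ∀ a b : ℝ, |a * b| ≤ (a ^ 2 / t + t * b ^ 2) / 2 := by
    intro a b
    have h1 : 0 ≤ (a - t * b) ^ 2 / t := by positivity
    have h2 : 0 ≤ (a + t * b) ^ 2 / t := by positivity
    have e1 : (a - t * b) ^ 2 / t = a ^ 2 / t - 2 * (a * b) + t * b ^ 2 := by field_simp; ring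
    have e2 : (a + t * b) ^ 2 / t = a ^ 2 / t + 2 * (a * b) + t * b ^ 2 := by field_simp; ring
    rw [abs_le]; constructor <;> linarith
  calc |QQ F G| ≤ 𝔼 X : Fn r, 𝔼 Y : Fn r, |kk X Y * (F X * G Y)| :=
        (abs_expect_le _ _).trans (expect_le_expect fun X _ => abs_expect_le _ _)
    _ ≤ 𝔼 X : Fn r, 𝔼 Y : Fn r, (1 / (2 * t) * (kk X Y * F X ^ 2) + t / 2 * (kk X Y * G Y ^ 2)) := by
        refine expect_le_expect fun X _ => expect_le_expect fun Y _ => ?_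
        rw [abs_mul, abs_of_nonneg (kk_nonneg X Y)]
        refine (mul_le_mul_of_nonneg_left (hpt _ _) (kk_nonneg X Y)).trans (le_of_eq ?_)
        field_simp
    _ = _ := by
        simp only [expect_add_distrib, ← mul_expect]
        rw [QQ_fst (fun X => F X ^ 2), QQ_snd (fun X => G X ^ 2)]
        field_simp

lemma QQ_RH (F G : Fn r → ℝ) (hF : ∀ f, 0 ≤ F f ∧ F f ≤ 1) (hG : ∀ f, 0 ≤ G f ∧ G f ≤ 1) :
    (𝔼 f, F f) ^ 4 * (𝔼 f, G f) ^ 4 ≤ QQ F G := by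
  have h := RH_Fn (r := r) (fun f => (F f) ^ ((1 : ℝ) / 4)) (fun f => (G f) ^ ((1 : ℝ) / 4))
    (fun f => Real.rpow_nonneg (hF f).1 _) (fun f => Real.rpow_nonneg (hG f).1 _)
  have e : ∀ a : ℝ, 0 ≤ a → (a ^ ((1 : ℝ) / 4)) ^ 4 = a := by
    intro a ha
    rw [← Real.rpow_natCast, ← Real.rpow_mul ha]; norm_num
  have hm : ∀ a : ℝ, 0 ≤ a → a ≤ 1 → a ≤ a ^ ((1 : ℝ) / 4) := by
    intro a h0 h1
    rcases h0.eq_or_lt with h | h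
    · rw [← h]; exact Real.rpow_nonneg le_rfl _
    · conv_lhs => rw [← Real.rpow_one a]
      exact Real.rpow_le_rpow_of_exponent_ge h h1 (by norm_num)
  simp only [e _ (hF _).1, e _ (hG _).1] at h
  refine le_trans ?_ h
  have m1 : 𝔼 f, F f ≤ 𝔼 f, (F f) ^ ((1 : ℝ) / 4) := expect_le_expect fun f _ => hm _ (hF f).1 (hF f).2
  have m2 : 𝔼 f, G f ≤ 𝔼 f, (G f) ^ ((1 : ℝ) / 4) := expect_le_expect fun f _ => hm _ (hG f).1 (hG f).2
  have n1 : 0 ≤ 𝔼 f, F f := expect_nonneg fun f _ => (hF f).1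
  have n2 : 0 ≤ 𝔼 f, G f := expect_nonneg fun f _ => (hG f).1
  gcongr

lemma ofReal_expect {α : Type*} [Fintype α] (F : α → ℝ) :
    ((𝔼 x, F x : ℝ) : ℂ) = 𝔼 x, ((F x : ℝ) : ℂ) := by
  simp only [Fintype.expect_eq_sum_div_card]; push_cast; rfl

lemma QQ_fourier {a b : Fn r → ℂ} (ha : CS a) (hb : CS b) :
    ((QQ (fun f => (LL a f).re) (fun f => (LL b f).re) : ℝ) : ℂ) =
      ∑ β, a β * conj ((((3 / 5 : ℝ) ^ supp β : ℝ) : ℂ) * b β) := by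
  unfold QQ
  rw [← plancherel_LL, ofReal_expect]
  refine expect_congr rfl fun X _ => ?_
  rw [ofReal_expect]
  have h2 : ∀ Y, ((kk X Y * ((LL a X).re * (LL b Y).re) : ℝ) : ℂ) =
      LL a X * (LL (fun β => (((3 / 5 : ℝ) ^ supp β : ℝ) : ℂ) * conj (chi β X)) Y * conj (LL b Y)) := by
    intro Y
    rw [Complex.ofReal_mul, Complex.ofReal_mul, LL_re ha, LL_re hb, ← LL_re hb, Complex.conj_ofReal, LL_re hb, kk_fourier]
    have : ∑ β : Fn r, (((3 / 5 : ℝ) ^ supp β : ℝ) : ℂ) * chi β (Y - X) =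
        LL (fun β => (((3 / 5 : ℝ) ^ supp β : ℝ) : ℂ) * conj (chi β X)) Y := by
      unfold LL
      refine sum_congr rfl fun β _ => ?_
      rw [sub_eq_add_neg, chi_add_right, chi_neg_right]; ring
    rw [this]; ring
  simp only [h2]
  rw [← mul_expect, plancherel_LL]
  congr 1
  unfold LL
  rw [map_sum]
  refine sum_congr rfl fun β _ => ?_
  simp only [map_mul, Complex.conj_ofReal]
  ring

lemma LL_mean {a : Fn r → ℂ} (ha : CS a) : 𝔼 f, (LL a f).re = (a 0).re := by
  have h : ((𝔼 f, (LL a f).re : ℝ) : ℂ) = a 0 := by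
    rw [ofReal_expect]
    simp only [LL_re ha]
    have h2 : ∀ Y, LL a Y = LL a Y * conj (LL (fun β => if β = 0 then 1 else 0) Y) := by
      intro Y
      simp only [LL, ite_mul, one_mul, zero_mul, sum_ite_eq', mem_univ, if_true, chi_zero_left, map_one, mul_one]
    rw [expect_congr rfl fun Y _ => h2 Y, plancherel_LL, sum_eq_single 0]
    · simp
    · intro b _ hb; simp [hb]
    · simp
  rw [← h, Complex.ofReal_re]

lemma QQ_diff (F G F' G' : Fn r → ℝ) :
    QQ F G - QQ F' G' = QQ (fun f => F f - F' f) G + QQ F' (fun f => G f - G' f) := by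
  unfold QQ
  rw [← expect_sub_distrib, ← expect_add_distrib]
  refine expect_congr rfl fun X _ => ?_
  rw [← expect_sub_distrib, ← expect_add_distrib]
  exact expect_congr rfl fun Y _ => by ring

lemma QQ_symm (F G : Fn r → ℝ) : QQ F G = QQ G F := by
  unfold QQ
  rw [expect_comm]
  exact expect_congr rfl fun X _ => expect_congr rfl fun Y _ => by rw [kk_symm]; ring

lemma core {a b : Fn r → ℂ} (ha : CS a) (hb : CS b) (ha1 : ∑ β, ‖a β‖ ^ 2 ≤ 1)
    (hb1 : ∑ β, ‖b β‖ ^ 2 ≤ 1) {ε η t μ e : ℝ} (hη : 0 < η) (hη1 : η ≤ 1) (ht : 0 < t)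
    (hpa : 𝔼 f : Fn r, psi (LL a f).re ≤ ε) (hpb : 𝔼 f : Fn r, psi (LL b f).re ≤ ε)
    (hma : μ ≤ (a 0).re) (hmb : μ ≤ (b 0).re)
    (he : ((η ^ 2 + 2 * ε / η) / t + t) / 2 ≤ e) (heμ : e ≤ μ) :
    (μ - e) ^ 8 - 2 * e ≤ (∑ β, a β * conj ((((3 / 5 : ℝ) ^ supp β : ℝ) : ℂ) * b β)).re := by
  rw [← QQ_fourier ha hb, Complex.ofReal_re]
  set F : Fn r → ℝ := fun f => (LL a f).re with hF
  set G : Fn r → ℝ := fun f => (LL b f).re with hG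
  have sq1 : ∀ {c : Fn r → ℂ}, ∑ β, ‖c β‖ ^ 2 ≤ 1 → 𝔼 f : Fn r, (LL c f).re ^ 2 ≤ 1 := by
    intro c h
    rw [← parseval_LL] at h
    refine le_trans (expect_le_expect fun f _ => ?_) h
    rw [← sq_abs]
    exact pow_le_pow_left₀ (abs_nonneg _) (Complex.abs_re_le_norm _) 2
  have clipd : ∀ {c : Fn r → ℂ}, 𝔼 f : Fn r, psi (LL c f).re ≤ ε →
      𝔼 f : Fn r, ((LL c f).re - clip (LL c f).re) ^ 2 ≤ η ^ 2 + 2 * ε / η := by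
    intro c h
    calc 𝔼 f : Fn r, ((LL c f).re - clip (LL c f).re) ^ 2
        ≤ 𝔼 f : Fn r, (η ^ 2 + 2 * psi (LL c f).re / η) :=
          expect_le_expect fun f _ => clip_dist hη hη1
      _ = η ^ 2 + 2 * (𝔼 f : Fn r, psi (LL c f).re) / η := by
          rw [expect_add_distrib, expect_const univ_nonempty, ← expect_div, ← mul_expect]
      _ ≤ _ := by gcongr
  have meand : ∀ {c : Fn r → ℂ}, CS c → 𝔼 f : Fn r, psi (LL c f).re ≤ ε → μ ≤ (c 0).re →
      μ - e ≤ 𝔼 f : Fn r, clip (LL c f).re := by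
    intro c hc h hm
    rw [← LL_mean hc] at hm
    have h1 : 𝔼 f : Fn r, ((LL c f).re - clip (LL c f).re) ≤ e := by
      refine le_trans ?_ he
      calc 𝔼 f : Fn r, ((LL c f).re - clip (LL c f).re)
          ≤ 𝔼 f : Fn r, (((LL c f).re - clip (LL c f).re) ^ 2 / t + t) / 2 := by
            refine expect_le_expect fun f _ => ?_
            set z := (LL c f).re - clip (LL c f).re
            have h1 : 0 ≤ (z - t) ^ 2 / t := by positivity
            have e1 : (z - t) ^ 2 / t = z ^ 2 / t - 2 * z + t := by field_simp; ring
            linarith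
        _ = ((𝔼 f : Fn r, ((LL c f).re - clip (LL c f).re) ^ 2) / t + t) / 2 := by
            rw [← expect_div, expect_add_distrib, expect_const univ_nonempty, ← expect_div]
        _ ≤ _ := by
            have := clipd h
            gcongr
    rw [expect_sub_distrib] at h1
    linarith
  have hR := QQ_RH (fun f => clip (F f)) (fun f => clip (G f)) (fun f => ⟨clip_nonneg _, clip_le_one _⟩)
    (fun f => ⟨clip_nonneg _, clip_le_one _⟩)
  have hd := QQ_diff F G (fun f => clip (F f)) (fun f => clip (G f))
  have b1 : |QQ (fun f => F f - clip (F f)) G| ≤ e := by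
    refine (QQ_bound _ _ ht).trans (le_trans ?_ he)
    have h1 := clipd hpa
    have h2 := sq1 hb1
    have : t * 𝔼 f : Fn r, (G f) ^ 2 ≤ t := mul_le_of_le_one_right ht.le h2
    have : (𝔼 f : Fn r, (F f - clip (F f)) ^ 2) / t ≤ (η ^ 2 + 2 * ε / η) / t := by gcongr
    linarith
  have b2 : |QQ (fun f => clip (F f)) (fun f => G f - clip (G f))| ≤ e := by
    rw [QQ_symm]
    refine (QQ_bound _ _ ht).trans (le_trans ?_ he)
    have h1 := clipd hpb
    have h2 : 𝔼 f : Fn r, (clip (F f)) ^ 2 ≤ 1 := expect_le_const fun f => by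
      have := clip_nonneg (F f); have := clip_le_one (F f)
      exact pow_le_one₀ (by assumption) (by assumption)
    have : t * 𝔼 f : Fn r, (clip (F f)) ^ 2 ≤ t := mul_le_of_le_one_right ht.le h2
    have : (𝔼 f : Fn r, (G f - clip (G f)) ^ 2) / t ≤ (η ^ 2 + 2 * ε / η) / t := by gcongr
    linarith
  have m1 := meand ha hpa hma
  have m2 := meand hb hpb hmb
  have hp : (μ - e) ^ 8 ≤ (𝔼 f, clip (F f)) ^ 4 * (𝔼 f, clip (G f)) ^ 4 := by
    rw [show (μ - e) ^ 8 = (μ - e) ^ 4 * (μ - e) ^ 4 by ring]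
    have : 0 ≤ μ - e := by linarith
    gcongr
  have := (abs_le.1 b1).1
  have := (abs_le.1 b2).1
  linarith

end
end S5

open scoped BigOperators
set_option linter.unusedVariables false
set_option linter.unusedSectionVars false
namespace S5
open Finset
section
variable {r : ℕ}
local notation "conj" => starRingEnd ℂ

noncomputable def nu : ℝ := Real.sqrt (5 / (3 * Real.sqrt 3))
noncomputable def u1 : ℂ := ((Real.sqrt 3 : ℝ) : ℂ) * tau 1

lemma nu_sq : nu ^ 2 = 5 / (3 * Real.sqrt 3) := Real.sq_sqrt (by positivity)
lemma nu_nonneg : 0 ≤ nu := Real.sqrt_nonneg _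
lemma nu_sq_le : nu ^ 2 ≤ 0.9623 := by
  rw [nu_sq, div_le_iff₀ (by positivity)]
  have : 1.73205 ≤ Real.sqrt 3 := Real.le_sqrt_of_sq_le (by norm_num)
  linarith
lemma nu_le : nu ≤ 0.981 := by
  refine abs_le_of_sq_le_sq' (a := nu) ?_ (by norm_num) |>.2
  exact nu_sq_le.trans (by norm_num)
lemma nu_rho : nu ^ 2 * (3 / 5) * Real.sqrt 3 = 1 := by
  rw [nu_sq]; field_simp

lemma tau_zero : tau 0 = 1 := by
  unfold tau
  simp only [zero_mul, ee_zero]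
  exact expect_const univ_nonempty _

lemma tau_one : tau 1 = (ee 1 + 2 * ee 2) / 3 := by
  unfold tau
  rw [Fintype.expect_eq_sum_div_card, sum_F3, ZMod.card]
  have h0 : (1 : F3) * (0 ^ 2 + 1) = 1 := by decide
  have h1 : (1 : F3) * (1 ^ 2 + 1) = 2 := by decide
  have h2 : (1 : F3) * (2 ^ 2 + 1) = 2 := by decide
  rw [h0, h1, h2]; push_cast; ring

lemma tau_two : tau 2 = conj (tau 1) := by
  unfold tau
  rw [map_expect]
  refine expect_congr rfl fun t _ => ?_
  rw [← ee_neg]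
  congr 1
  rw [← neg_mul]
  rfl

lemma norm_u1 : ‖u1‖ = 1 := by
  have h3 : Real.sqrt 3 ^ 2 = 3 := Real.sq_sqrt (by norm_num)
  have h : ‖u1‖ ^ 2 = 1 := by
    rw [← Complex.normSq_eq_norm_sq]
    unfold u1
    rw [tau_one, ee_one_val, ee_two_val, Complex.normSq_mul, Complex.normSq_div]
    simp only [Complex.normSq_apply, Complex.add_re, Complex.add_im, Complex.mul_re, Complex.mul_im,
      Complex.ofReal_re, Complex.ofReal_im]
    norm_num
    nlinarith
  nlinarith [norm_nonneg u1]

lemma tau_uu (c : F3) : tau c = (((if c = 0 then 1 else nu ^ 2 * (3 / 5) : ℝ)) : ℂ) * uu u1 c := by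
  have key : ((nu ^ 2 * (3 / 5) : ℝ) : ℂ) * ((Real.sqrt 3 : ℝ) : ℂ) = 1 := by
    rw [← Complex.ofReal_mul, nu_rho, Complex.ofReal_one]
  rcases F3_cases c with rfl | rfl | rfl
  · rw [tau_zero, uu_zero, if_pos rfl]; simp
  · rw [uu_one, if_neg (by decide), u1, ← mul_assoc, key, one_mul]
  · rw [uu_two, if_neg (by decide), u1, map_mul, Complex.conj_ofReal, ← mul_assoc, key, one_mul, tau_two]

lemma prod_tau (β : Fn r) : ∏ x, tau (β x) = (((nu ^ 2 * (3 / 5)) ^ supp β : ℝ) : ℂ) * tw u1 univ β := by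
  simp only [tau_uu, prod_mul_distrib]
  unfold tw
  congr 1
  rw [supp_eq, sF, Complex.ofReal_pow, ← prod_const, prod_filter]
  refine prod_congr rfl fun x _ => ?_
  by_cases h : β x = 0 <;> simp [h]

lemma uu_conj (u : ℂ) (c : F3) : uu (conj u) c = conj (uu u c) := by
  unfold uu; split_ifs <;> simp

lemma tw_conj (u : ℂ) (J : Finset (Pt r)) (β : Fn r) : tw (conj u) J β = conj (tw u J β) := by
  unfold tw
  rw [map_prod]
  exact prod_congr rfl fun x _ => uu_conj _ _

section coef
variable {F κ : ℕ} {Λ : Finset (Fn r)} {s : ℝ} {A : Fn r → ℝ}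

lemma tc_zero {V : Submodule F3 (Fn r)} {β : Fn r} (h : κ < supp β) : tc s κ V A β = 0 := by
  unfold tc; rw [ind_false (by omega)]; simp

lemma tc_CS {V : Submodule F3 (Fn r)} : CS (tc s κ V A) := by
  intro β
  unfold tc
  rw [supp_neg, hat_conj, map_mul, Complex.conj_ofReal]

lemma tc_norm {V : Submodule F3 (Fn r)} (h0 : 0 ≤ s) (h1 : s ≤ 1) (β : Fn r) :
    ‖tc s κ V A β‖ ^ 2 ≤ ‖hat V (fun f => (A f : ℂ)) β‖ ^ 2 := by
  unfold tc
  rw [norm_mul]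
  refine pow_le_pow_left₀ (by positivity) ?_ 2
  refine mul_le_of_le_one_left (norm_nonneg _) ?_
  rw [Complex.norm_real, Real.norm_of_nonneg (mul_nonneg (ind_nonneg _) (by positivity))]
  exact mul_le_one₀ (ind_le_one _) (by positivity) (pow_le_one₀ h0 h1)

lemma tc_at_zero {V : Submodule F3 (Fn r)} : (tc s κ V A 0).re = 𝔼 f : V, A f := by
  have : supp (0 : Fn r) = 0 := supp_eq_zero.2 rfl
  unfold tc hat
  rw [this, ind_true (Nat.zero_le _)]
  simp only [pow_zero, mul_one, Complex.ofReal_one, one_mul, chi_zero_left, map_one]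
  rw [← ofReal_expect, Complex.ofReal_re]

lemma low_mem (hκ : 2 * κ < 2 ^ (F + 1)) (hΛ : Reps (P r (2 * F)) Λ)
    (hmin : ∀ β ∈ Λ, ∀ γ : Fn r, β - γ ∈ dl r (2 * F) → supp β ≤ supp γ) {β : Fn r} (hβ : supp β ≤ κ) :
    β ∈ Λ := by
  obtain ⟨γ, ⟨h1, h2⟩, -⟩ := hΛ β
  have h3 : γ - β ∈ dl r (2 * F) := by rw [← neg_sub]; exact neg_mem h2
  have h4 := hmin γ h1 β h3
  by_cases h : β = γ
  · rw [h]; exact h1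
  · exact absurd h2 (interp_dual F (β - γ) (sub_ne_zero.2 h)
      (lt_of_le_of_lt (supp_sub_le _ _) (by omega)))

lemma hat_le (hΛ : Reps (P r (2 * F)) Λ) (hA : ∀ f ∈ P r (2 * F), 0 ≤ A f ∧ A f ≤ 1) :
    ∑ β ∈ Λ, ‖hat (P r (2 * F)) (fun f => (A f : ℂ)) β‖ ^ 2 ≤ 1 := by
  rw [← parseval_hat hΛ]
  refine expect_le_const fun f => ?_
  rw [Complex.norm_real, Real.norm_eq_abs, sq_abs]
  have := hA f f.2
  nlinarith

lemma tc_sum {E : Type*} [AddCommMonoid E] (hκ : 2 * κ < 2 ^ (F + 1)) (hΛ : Reps (P r (2 * F)) Λ)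
    (hmin : ∀ β ∈ Λ, ∀ γ : Fn r, β - γ ∈ dl r (2 * F) → supp β ≤ supp γ) (g : Fn r → E)
    (hg : ∀ β, κ < supp β → g β = 0) : ∑ β, g β = ∑ β ∈ Λ, g β := by
  symm
  refine sum_subset (subset_univ _) fun β _ hβ => hg β ?_
  by_contra h
  exact hβ (low_mem hκ hΛ hmin (not_lt.1 h))

lemma tc_le (h0 : 0 ≤ s) (h1 : s ≤ 1) (hκ : 2 * κ < 2 ^ (F + 1)) (hΛ : Reps (P r (2 * F)) Λ)
    (hmin : ∀ β ∈ Λ, ∀ γ : Fn r, β - γ ∈ dl r (2 * F) → supp β ≤ supp γ)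
    (hA : ∀ f ∈ P r (2 * F), 0 ≤ A f ∧ A f ≤ 1) :
    ∑ β, ‖tc s κ (P r (2 * F)) A β‖ ^ 2 ≤ 1 := by
  rw [tc_sum hκ hΛ hmin _ (fun β h => by rw [tc_zero h]; simp)]
  exact (sum_le_sum fun β _ => tc_norm h0 h1 β).trans (hat_le hΛ hA)

lemma psi_tc (h0 : 0 ≤ s) (h1 : s ≤ 1) {n : ℕ} (hn : 6 * n ≤ 2 * F) (hκ : 2 * κ < 2 ^ (F + 1))
    (hΛ : Reps (P r (2 * F)) Λ)
    (hmin : ∀ β ∈ Λ, ∀ γ : Fn r, β - γ ∈ dl r (2 * F) → supp β ≤ supp γ)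
    (hA : ∀ f ∈ P r (2 * F), 0 ≤ A f ∧ A f ≤ 1) :
    𝔼 f : P r (2 * F), psi (LL (tc s κ (P r (2 * F)) A) f).re ≤
      ((1 + 2 * s) / 3) ^ n * ((κ : ℝ) ^ 2 + 1) + s ^ (κ + 1) + (2 / 3) ^ (2 * n) * κ +
          2 * n * (1 / 3) ^ n := by
  obtain ⟨A', hA', hs⟩ := smoothing h0 h1 (κ := κ) (j := n) (D := 4 * n) (M := 2 * n) (by omega : _ ≤ 2 * F) (by omega)
    hΛ hmin A hA
  rw [show (4 * n - 2 * n) / 2 = n by omega] at hs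
  push_cast at hs
  refine le_trans (expect_le_expect fun f _ => ?_) hs
  have hb := hA' f f.2
  refine (psi_le hb.1 hb.2).trans ?_
  rw [show ∑ β ∈ Λ, tc s κ (P r (2 * F)) A β * chi β f = LL (tc s κ (P r (2 * F)) A) f from
    (tc_sum hκ hΛ hmin _ (fun β h => by rw [tc_zero h, zero_mul])).symm]
  rw [norm_sub_rev, ← sq_abs]
  refine pow_le_pow_left₀ (abs_nonneg _) ?_ 2
  refine le_trans (le_of_eq ?_) (Complex.abs_re_le_norm _)
  simp

end coef

end
end S5

open scoped BigOperators
set_option linter.unusedVariables false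
set_option linter.unusedSectionVars false
namespace S5
open Finset
section
variable {r : ℕ}
local notation "conj" => starRingEnd ℂ

lemma noise_fourier {d : ℕ} {Λ : Finset (Fn r)} (hΛ : Reps (P r (2 * d)) Λ) (A B : Fn r → ℝ) :
    ((𝔼 f : P r (2 * d), A f * 𝔼 p : P r d, B ((f : Fn r) + shift (p : Fn r) 1) : ℝ) : ℂ) =
      ∑ β ∈ Λ, hat (P r (2 * d)) (fun f => (A f : ℂ)) β *
        conj (hat (P r (2 * d)) (fun f => (B f : ℂ)) β * lam d β) := by
  rw [ofReal_expect, ← plancherel hΛ]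
  refine expect_congr rfl fun f _ => ?_
  rw [Complex.ofReal_mul]
  rw [← inversion hΛ (fun f => (A f : ℂ)) f.2]
  congr 1
  rw [← Complex.conj_ofReal]
  congr 1
  have h := inversion hΛ (fun f : Fn r => 𝔼 p : P r d, (B ((f : Fn r) + shift (p : Fn r) 1) : ℂ)) f.2
  rw [ofReal_expect]
  refine h.trans (sum_congr rfl fun β _ => ?_)
  rw [hat_noise (fun f => (B f : ℂ)) (fun p : P r d => shift (p : Fn r) 1) (fun p => shift_mem p.2 1)]
  rfl

lemma main_abs {d κ n : ℕ} (hd : 6 * n ≤ d) (hd1 : 1 ≤ d) (hκn : 2 * κ + 1 ≤ 2 * n)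
    (hlt : (2 / 3 : ℝ) ^ n < (1 / 2) ^ (κ + 1)) (hκ2 : 4 * κ < 2 ^ (n + 1))
    {Λ : Finset (Fn r)} (hΛ : Reps (P r (2 * d)) Λ)
    (hmin : ∀ β ∈ Λ, ∀ γ : Fn r, β - γ ∈ dl r (2 * d) → supp β ≤ supp γ)
    {A B : Fn r → ℝ} (hA : ∀ f ∈ P r (2 * d), 0 ≤ A f ∧ A f ≤ 1)
    (hB : ∀ f ∈ P r (2 * d), 0 ≤ B f ∧ B f ≤ 1)
    {δ' : ℝ} (hδ : 0 < δ') (hI : ∀ I : ℕ, (I : ℝ) * δ' ≤ κ → I + 2 * κ < 2 ^ (n + 1))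
    (hdis : ∀ x, ¬ (δ' ≤ Ix (tc nu κ (P r (2 * d)) A) x ∧ δ' ≤ Ix (tc nu κ (P r (2 * d)) B) x))
    {m : ℝ} (hmA : m ≤ 𝔼 f : P r (2 * d), A f) (hmB : m ≤ 𝔼 f : P r (2 * d), B f)
    {s η t e ε l : ℝ} (hs : 0 < s) (hη : 0 < η) (hη1 : η ≤ 1) (ht : 0 < t)
    (hε : ((1 + 2 * nu) / 3) ^ n * ((κ : ℝ) ^ 2 + 1) + nu ^ (κ + 1) + (2 / 3) ^ (2 * n) * κ +
          2 * n * (1 / 3) ^ n + 14 * (s * κ + 16 ^ κ * (δ' * κ + (1 / 3) ^ n * κ ^ 2) / s) ≤ ε)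
    (he : ((η ^ 2 + 2 * ε / η) / t + t) / 2 ≤ e) (hem : e ≤ m)
    (hl0 : 0 ≤ l) (hl : (1 / 3 : ℝ) ^ (κ + 1) ≤ l ^ 2) :
    (m - e) ^ 8 - 2 * e - l ≤ 𝔼 f : P r (2 * d), A f * 𝔼 p : P r d, B ((f : Fn r) + shift (p : Fn r) 1) := by
  classical
  set V := P r (2 * d) with hV
  set cA := tc nu κ V A with hcA
  set cB := tc nu κ V B with hcB
  have hnd : (2 : ℕ) ^ (n + 1) ≤ 2 ^ (d + 1) := Nat.pow_le_pow_right (by norm_num) (by omega)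
  have hκd : 4 * κ < 2 ^ (d + 1) := by omega
  have hκd' : 2 * κ < 2 ^ (d + 1) := by omega
  have n1 : nu ≤ 1 := nu_le.trans (by norm_num)
  have hcA1 : ∑ β, ‖cA β‖ ^ 2 ≤ 1 := tc_le nu_nonneg n1 hκd' hΛ hmin hA
  have hcB1 : ∑ β, ‖cB β‖ ^ 2 ≤ 1 := tc_le nu_nonneg n1 hκd' hΛ hmin hB
  have hcA0 : ∀ β, κ < supp β → cA β = 0 := fun β h => tc_zero h
  have hcB0 : ∀ β, κ < supp β → cB β = 0 := fun β h => tc_zero h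
  set IA : Finset (Pt r) := univ.filter fun x => δ' ≤ Ix cA x with hIA
  set IB : Finset (Pt r) := univ.filter fun x => δ' ≤ Ix cB x with hIB
  have card_le : ∀ c : Fn r → ℂ, (∀ β, κ < supp β → c β = 0) → ∑ β, ‖c β‖ ^ 2 ≤ 1 →
      ((univ.filter fun x => δ' ≤ Ix c x).card : ℝ) * δ' ≤ κ := by
    intro c h0 h1
    refine le_trans ?_ (sum_Ix h0 h1)
    rw [← nsmul_eq_mul, ← sum_const]
    refine le_trans (sum_le_sum (g := fun x => Ix c x) fun x hx => (mem_filter.1 hx).2) ?_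
    exact sum_le_sum_of_subset_of_nonneg (subset_univ _) fun x _ _ => Ix_nonneg c x
  have hIAc := hI _ (card_le cA hcA0 hcA1)
  have hIBc := hI _ (card_le cB hcB0 hcB1)
  have invA := invariance (j := n) (q := n) hκd hIAc (by omega) (J := IAᶜ) (fun x hx => mem_compl.1 hx) (c := cA)
    tc_CS hcA0 hcA1 (u := conj u1) (by rw [RCLike.norm_conj, norm_u1]) hs (δ' := δ')
    (fun x hx => by
      by_contra h
      exact hx (mem_filter.2 ⟨mem_univ _, (not_le.1 h).le⟩)) hδ.le
  have invB := invariance (j := n) (q := n) hκd hIBc (by omega) (J := IA) (fun x hx hx2 =>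
      hdis x ⟨(mem_filter.1 hx).2, (mem_filter.1 hx2).2⟩) (c := cB)
    tc_CS hcB0 hcB1 (u := u1) norm_u1 hs (δ' := δ')
    (fun x hx => by
      by_contra h
      exact hx (mem_filter.2 ⟨mem_univ _, (not_le.1 h).le⟩)) hδ.le
  have psA := psi_tc nu_nonneg n1 (n := n) (by omega) hκd' hΛ hmin hA
  have psB := psi_tc nu_nonneg n1 (n := n) (by omega) hκd' hΛ hmin hB
  have tw0 : ∀ (u : ℂ) (J : Finset (Pt r)), tw u J 0 = 1 := fun u J => tw_one fun x _ => rfl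
  have tcs : ∀ (c : Fn r → ℂ) (u : ℂ) (J : Finset (Pt r)), CS c → CS fun β => c β * tw u J β := by
    intro c u J h β
    simp only [h β, tw_neg, map_mul]
  have tcn : ∀ (c : Fn r → ℂ) (u : ℂ) (J : Finset (Pt r)), ‖u‖ = 1 → ∑ β, ‖c β‖ ^ 2 ≤ 1 →
      ∑ β, ‖c β * tw u J β‖ ^ 2 ≤ 1 := by
    intro c u J hu h
    simpa only [norm_mul, norm_tw hu, mul_one] using h
  have hcore := core (tcs cA (conj u1) IAᶜ tc_CS) (tcs cB u1 IA tc_CS)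
    (tcn cA (conj u1) IAᶜ (by rw [RCLike.norm_conj, norm_u1]) hcA1) (tcn cB u1 IA norm_u1 hcB1)
    hη hη1 ht (invA.trans (by linarith)) (invB.trans (by linarith))
    (by simp only [tw0, mul_one]; rw [hcA, tc_at_zero]; exact hmA)
    (by simp only [tw0, mul_one]; rw [hcB, tc_at_zero]; exact hmB) he hem
  set hA' := hat V (fun f => (A f : ℂ)) with hhA
  set hB' := hat V (fun f => (B f : ℂ)) with hhB
  have hN := noise_fourier hΛ A B
  rw [← hV, ← hhA, ← hhB] at hN
  have hRe : 𝔼 f : V, A f * 𝔼 p : P r d, B ((f : Fn r) + shift (p : Fn r) 1) =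
      (∑ β ∈ Λ, hA' β * conj (hB' β * lam d β)).re := by rw [← hN, Complex.ofReal_re]
  have lowpt : ∀ β, supp β ≤ κ → (cA β * tw (conj u1) IAᶜ β) *
      conj ((((3 / 5 : ℝ) ^ supp β : ℝ) : ℂ) * (cB β * tw u1 IA β)) = hA' β * conj (hB' β * lam d β) := by
    intro β hβ
    rw [lam_low (q := n) (by omega) (by omega), prod_tau]
    have ht : tw u1 univ β = tw u1 IA β * tw u1 IAᶜ β := by
      unfold tw; rw [prod_mul_prod_compl]
    rw [ht, tw_conj]
    simp only [hcA, hcB, tc, ind_true hβ, one_mul, map_mul, Complex.conj_ofReal]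
    rw [← hhA, ← hhB, mul_pow, ← pow_mul, mul_comm 2 (supp β), pow_mul, sq]
    simp only [Complex.ofReal_mul]
    ring
  have hlow : ∑ β, (cA β * tw (conj u1) IAᶜ β) *
      conj ((((3 / 5 : ℝ) ^ supp β : ℝ) : ℂ) * (cB β * tw u1 IA β)) =
      ∑ β ∈ Λ.filter (fun β => supp β ≤ κ), hA' β * conj (hB' β * lam d β) := by
    rw [tc_sum hκd' hΛ hmin _ (fun β h => by rw [hcA0 β h]; simp), sum_filter]
    refine sum_congr rfl fun β _ => ?_
    split_ifs with h
    · exact lowpt β h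
    · rw [hcA0 β (not_le.1 h)]; simp
  have hhigh : ‖∑ β ∈ Λ.filter (fun β => ¬ supp β ≤ κ), hA' β * conj (hB' β * lam d β)‖ ≤ l := by
    calc ‖∑ β ∈ Λ.filter (fun β => ¬ supp β ≤ κ), hA' β * conj (hB' β * lam d β)‖
        ≤ ∑ β ∈ Λ.filter (fun β => ¬ supp β ≤ κ), ‖hA' β * conj (hB' β * lam d β)‖ := norm_sum_le _ _
      _ ≤ ∑ β ∈ Λ.filter (fun β => ¬ supp β ≤ κ), l * ((‖hA' β‖ ^ 2 + ‖hB' β‖ ^ 2) / 2) := by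
          refine sum_le_sum fun β hβ => ?_
          rw [mem_filter] at hβ
          have h1 : ‖lam d β‖ ≤ l := by
            refine abs_le_of_sq_le_sq' (a := ‖lam d β‖) (le_trans ?_ hl) hl0 |>.2
            refine lam_high (D := 4 * n) (j := n) (by omega) hd1 (by omega) hlt ?_
            rintro ⟨γ, hγ, hγ2⟩
            exact hβ.2 ((hmin β hβ.1 γ hγ2).trans hγ)
          rw [norm_mul, RCLike.norm_conj, norm_mul]
          have h2 : ‖hA' β‖ * ‖hB' β‖ ≤ (‖hA' β‖ ^ 2 + ‖hB' β‖ ^ 2) / 2 := by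
            nlinarith [sq_nonneg (‖hA' β‖ - ‖hB' β‖)]
          calc ‖hA' β‖ * (‖hB' β‖ * ‖lam d β‖) = ‖lam d β‖ * (‖hA' β‖ * ‖hB' β‖) := by ring
            _ ≤ _ := mul_le_mul h1 h2 (by positivity) hl0
      _ ≤ ∑ β ∈ Λ, l * ((‖hA' β‖ ^ 2 + ‖hB' β‖ ^ 2) / 2) :=
          sum_le_sum_of_subset_of_nonneg (filter_subset _ _) fun β _ _ => by positivity
      _ ≤ l := by
          rw [← mul_sum, ← sum_div, sum_add_distrib]
          have h1 : ∑ β ∈ Λ, ‖hA' β‖ ^ 2 ≤ 1 := hat_le hΛ hA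
          have h2 : ∑ β ∈ Λ, ‖hB' β‖ ^ 2 ≤ 1 := hat_le hΛ hB
          exact mul_le_of_le_one_right hl0 (by linarith)
  rw [hRe, ← sum_filter_add_sum_filter_not Λ (fun β => supp β ≤ κ), Complex.add_re, ← hlow]
  have := (abs_le.1 ((Complex.abs_re_le_norm _).trans hhigh)).1
  linarith

end
end S5

open scoped BigOperators
set_option linter.unusedVariables false
set_option linter.unusedSectionVars false
namespace S5
open Finset
section
variable {r : ℕ}

lemma yp {y : ℝ} (h0 : 0 < y) (h1 : y ≤ 1 / 2) {a b : ℕ} (h : b ≤ a) : y ^ a ≤ y ^ b :=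
  pow_le_pow_of_le_one h0.le (by linarith) h

/-- `c * y ^ a ≤ y ^ b` when `c ≤ 2 ^ j` and `b + j ≤ a` -/
lemma yc {y : ℝ} (h0 : 0 < y) (h1 : y ≤ 1 / 2) {c : ℝ} {a b j : ℕ} (hc : c ≤ 2 ^ j) (h : b + j ≤ a) :
    c * y ^ a ≤ y ^ b := by
  have h2 : y ^ a ≤ y ^ b * (1 / 2) ^ j := by
    refine (yp h0 h1 h).trans ?_
    rw [pow_add]
    exact mul_le_mul_of_nonneg_left (pow_le_pow_left₀ h0.le h1 j) (by positivity)
  have h3 : (2 : ℝ) ^ j * (1 / 2) ^ j = 1 := by rw [← mul_pow]; norm_num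
  calc c * y ^ a ≤ 2 ^ j * (y ^ b * (1 / 2) ^ j) :=
        mul_le_mul hc h2 (by positivity) (by positivity)
    _ = y ^ b * (2 ^ j * (1 / 2) ^ j) := by ring
    _ = y ^ b := by rw [h3, mul_one]

lemma num_eps {y k n th nuK r1 r2 sx : ℝ} (h0 : 0 < y) (h1 : y ≤ 1 / 2) (hk0 : 0 ≤ k)
    (hk : k * y ^ 12 ≤ 1) (hth : th ≤ y ^ 312) (hnu : nuK ≤ y ^ 75)
    (hr2 : r2 ≤ y ^ 20000) (hnr : n * r1 ≤ 2 * y ^ 20000) (hr1 : r1 ≤ y ^ 20000)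
    (hsx : sx * y ^ 12000 = 1) :
    th * (k ^ 2 + 1) + nuK + r2 * k + 2 * n * r1 +
      14 * (y ^ 90 * k + sx * (y ^ 12200 * k + r1 * k ^ 2) / y ^ 90) ≤ y ^ 64 := by
  have hk2 : k ^ 2 * y ^ 24 ≤ 1 := by
    have := pow_le_one₀ (n := 2) (by positivity) hk
    calc k ^ 2 * y ^ 24 = (k * y ^ 12) ^ 2 := by ring
      _ ≤ 1 := this
  have hy : ∀ a : ℕ, 0 < y ^ a := fun a => pow_pos h0 a
  have T1 : th * (k ^ 2 + 1) ≤ y ^ 67 := by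
    have e1 : y ^ 24 ≤ 1 := pow_le_one₀ h0.le (by linarith)
    calc th * (k ^ 2 + 1) ≤ y ^ 312 * (k ^ 2 + 1) := mul_le_mul_of_nonneg_right hth (by positivity)
      _ = y ^ 288 * (k ^ 2 * y ^ 24 + y ^ 24) := by ring
      _ ≤ y ^ 288 * 2 := mul_le_mul_of_nonneg_left (by linarith) (hy _).le
      _ = 2 * y ^ 288 := by ring
      _ ≤ y ^ 67 := yc h0 h1 (j := 1) (by norm_num) (by norm_num)
  have T2 : nuK ≤ y ^ 67 := hnu.trans (yp h0 h1 (by norm_num))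
  have T3 : r2 * k ≤ y ^ 67 := by
    calc r2 * k ≤ y ^ 20000 * k := mul_le_mul_of_nonneg_right hr2 hk0
      _ ≤ y ^ 79 * k := mul_le_mul_of_nonneg_right (yp h0 h1 (by norm_num)) hk0
      _ = y ^ 67 * (k * y ^ 12) := by ring
      _ ≤ y ^ 67 := mul_le_of_le_one_right (hy _).le hk
  have T4 : 2 * n * r1 ≤ y ^ 67 := by
    calc 2 * n * r1 = 2 * (n * r1) := by ring
      _ ≤ 2 * (2 * y ^ 20000) := by linarith
      _ = 4 * y ^ 20000 := by ring
      _ ≤ y ^ 67 := yc h0 h1 (j := 2) (by norm_num) (by norm_num)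
  have T5 : 14 * (y ^ 90 * k) ≤ y ^ 67 := by
    calc 14 * (y ^ 90 * k) = 14 * y ^ 78 * (k * y ^ 12) := by ring
      _ ≤ 14 * y ^ 78 := mul_le_of_le_one_right (by positivity) hk
      _ ≤ y ^ 67 := yc h0 h1 (j := 4) (by norm_num) (by norm_num)
  have hsx0 : 0 ≤ sx := by
    by_contra h
    have := mul_neg_of_neg_of_pos (not_le.1 h) (hy 12000)
    linarith
  have T6 : 14 * (sx * (y ^ 12200 * k + r1 * k ^ 2) / y ^ 90) ≤ y ^ 67 := by
    have a1 : y ^ 12200 * k ≤ y ^ 12188 := by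
      calc y ^ 12200 * k = y ^ 12188 * (k * y ^ 12) := by ring
        _ ≤ _ := mul_le_of_le_one_right (hy _).le hk
    have a2 : r1 * k ^ 2 ≤ y ^ 12188 := by
      calc r1 * k ^ 2 ≤ y ^ 20000 * k ^ 2 := mul_le_mul_of_nonneg_right hr1 (by positivity)
        _ ≤ y ^ 12212 * k ^ 2 := mul_le_mul_of_nonneg_right (yp h0 h1 (by norm_num)) (by positivity)
        _ = y ^ 12188 * (k ^ 2 * y ^ 24) := by ring
        _ ≤ _ := mul_le_of_le_one_right (hy _).le hk2
    have a3 : sx * (y ^ 12200 * k + r1 * k ^ 2) ≤ 2 * y ^ 188 := by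
      calc sx * (y ^ 12200 * k + r1 * k ^ 2) ≤ sx * (y ^ 12188 + y ^ 12188) :=
            mul_le_mul_of_nonneg_left (by linarith) hsx0
        _ = (sx * y ^ 12000) * (2 * y ^ 188) := by ring
        _ = 2 * y ^ 188 := by rw [hsx, one_mul]
    have a4 : sx * (y ^ 12200 * k + r1 * k ^ 2) / y ^ 90 ≤ 2 * y ^ 98 := by
      rw [div_le_iff₀ (hy 90)]
      refine a3.trans (le_of_eq ?_)
      ring
    calc 14 * (sx * (y ^ 12200 * k + r1 * k ^ 2) / y ^ 90) ≤ 14 * (2 * y ^ 98) := by linarith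
      _ = 28 * y ^ 98 := by ring
      _ ≤ y ^ 67 := yc h0 h1 (j := 5) (by norm_num) (by norm_num)
  have T7 : 6 * y ^ 67 ≤ y ^ 64 := yc h0 h1 (j := 3) (by norm_num) (by norm_num)
  rw [mul_add 14]
  linarith

lemma num_e {y : ℝ} (h0 : 0 < y) (h1 : y ≤ 1 / 2) :
    (((y ^ 21) ^ 2 + 2 * y ^ 64 / y ^ 21) / y ^ 20 + y ^ 20) / 2 ≤ y ^ 19 := by
  have e1 : 2 * y ^ 64 / y ^ 21 = 2 * y ^ 43 := by
    rw [div_eq_iff (pow_pos h0 _).ne']; ring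
  have e2 : ((y ^ 21) ^ 2 + 2 * y ^ 43) / y ^ 20 = y ^ 22 + 2 * y ^ 23 := by
    rw [div_eq_iff (pow_pos h0 _).ne']; ring
  rw [e1, e2]
  have := yp h0 h1 (show 19 ≤ 22 by norm_num)
  have := yc h0 h1 (c := 2) (j := 1) (a := 23) (b := 22) (by norm_num) (by norm_num)
  have := yc h0 h1 (c := 2) (j := 1) (a := 20) (b := 19) (by norm_num) (by norm_num)
  have := yc h0 h1 (c := 2) (j := 1) (a := 22) (b := 21) (by norm_num) (by norm_num)
  have := yc h0 h1 (c := 2) (j := 1) (a := 21) (b := 20) (by norm_num) (by norm_num)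
  linarith

lemma num_m {y : ℝ} (h0 : 0 < y) (h1 : y ≤ 1 / 2) :
    y ^ 17 ≤ (y - y ^ 19) ^ 8 - 2 * y ^ 19 - y ^ 18 := by
  have e1 : y ^ 2 ≤ y - y ^ 19 := by
    have := yp h0 h1 (show 2 ≤ 19 by norm_num)
    have := yc h0 h1 (c := 2) (j := 1) (a := 2) (b := 1) (by norm_num) (by norm_num)
    rw [pow_one] at this
    linarith
  have e2 : y ^ 16 ≤ (y - y ^ 19) ^ 8 := by
    calc y ^ 16 = (y ^ 2) ^ 8 := by ring
      _ ≤ _ := pow_le_pow_left₀ (by positivity) e1 8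
  have := yc h0 h1 (c := 2) (j := 1) (a := 17) (b := 16) (by norm_num) (by norm_num)
  have := yc h0 h1 (c := 2) (j := 1) (a := 18) (b := 17) (by norm_num) (by norm_num)
  have := yc h0 h1 (c := 4) (j := 2) (a := 19) (b := 17) (by norm_num) (by norm_num)
  linarith

lemma half_pow_le {a : ℝ} (ha : 0 ≤ a) {q N j : ℕ} (h : a ^ q ≤ 1 / 2) {M : ℕ} (hM : M = q * (j * N)) :
    a ^ M ≤ ((1 / 2 : ℝ) ^ N) ^ j := by
  have e : ((1 / 2 : ℝ) ^ N) ^ j = (1 / 2) ^ (j * N) := by rw [← pow_mul, mul_comm]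
  rw [hM, pow_mul, e]
  exact pow_le_pow_left₀ (by positivity) h _

lemma main_num {N d : ℕ} (hN : 1 ≤ N) (hd : 120000 * N ≤ d)
    {Λ : Finset (Fn r)} (hΛ : Reps (P r (2 * d)) Λ)
    (hmin : ∀ β ∈ Λ, ∀ γ : Fn r, β - γ ∈ dl r (2 * d) → supp β ≤ supp γ)
    {A B : Fn r → ℝ} (hA : ∀ f ∈ P r (2 * d), 0 ≤ A f ∧ A f ≤ 1)
    (hB : ∀ f ∈ P r (2 * d), 0 ≤ B f ∧ B f ≤ 1)
    (hdis : ∀ x, ¬ (((1 / 2 : ℝ) ^ N) ^ 12200 ≤ Ix (tc nu (3000 * N) (P r (2 * d)) A) x ∧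
      ((1 / 2 : ℝ) ^ N) ^ 12200 ≤ Ix (tc nu (3000 * N) (P r (2 * d)) B) x))
    (hmA : (1 / 2 : ℝ) ^ N ≤ 𝔼 f : P r (2 * d), A f) (hmB : (1 / 2 : ℝ) ^ N ≤ 𝔼 f : P r (2 * d), B f) :
    ((1 / 2 : ℝ) ^ N) ^ 17 ≤
      𝔼 f : P r (2 * d), A f * 𝔼 p : P r d, B ((f : Fn r) + shift (p : Fn r) 1) := by
  have hnu20 : nu ^ 40 ≤ 1 / 2 := by
    calc nu ^ 40 = (nu ^ 2) ^ 20 := by rw [← pow_mul]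
      _ ≤ 0.9623 ^ 20 := pow_le_pow_left₀ (sq_nonneg _) nu_sq_le 20
      _ ≤ 1 / 2 := by norm_num
  have hth64 : ((1 + 2 * nu) / 3) ^ 64 ≤ 1 / 2 := by
    calc ((1 + 2 * nu) / 3) ^ 64 ≤ 0.98734 ^ 64 :=
          pow_le_pow_left₀ (by linarith [nu_nonneg]) (by linarith [nu_le]) 64
      _ ≤ 1 / 2 := by norm_num
  have n1 : nu ≤ 1 := nu_le.trans (by norm_num)
  have hthn : ((1 + 2 * nu) / 3) ^ (20000 * N) ≤ ((1 / 2 : ℝ) ^ N) ^ 312 :=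
    (pow_le_pow_of_le_one (by linarith [nu_nonneg]) (by linarith) (by omega)).trans
      (half_pow_le (by linarith [nu_nonneg]) (j := 312) hth64 (M := 64 * (312 * N)) rfl)
  have hnuk : nu ^ (3000 * N + 1) ≤ ((1 / 2 : ℝ) ^ N) ^ 75 :=
    (pow_le_pow_of_le_one nu_nonneg n1 (by omega)).trans
      (half_pow_le nu_nonneg (j := 75) hnu20 (M := 40 * (75 * N)) rfl)
  have hr2 : (2 / 3 : ℝ) ^ (2 * (20000 * N)) ≤ ((1 / 2 : ℝ) ^ N) ^ 20000 :=
    half_pow_le (by norm_num) (q := 2) (by norm_num) rfl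
  have hr1 : (1 / 3 : ℝ) ^ (20000 * N) ≤ ((1 / 2 : ℝ) ^ N) ^ 20000 :=
    half_pow_le (by norm_num) (q := 1) (by norm_num) (by ring)
  have hhalf : ((1 / 2 : ℝ) ^ N) ^ 20000 = (1 / 2) ^ (20000 * N) := by rw [← pow_mul, mul_comm]
  have hnr : ((20000 * N : ℕ) : ℝ) * (1 / 3 : ℝ) ^ (20000 * N) ≤ 2 * ((1 / 2 : ℝ) ^ N) ^ 20000 := by
    rw [hhalf]
    generalize 20000 * N = n
    have b := one_add_mul_le_pow (a := (1 / 2 : ℝ)) (by norm_num) n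
    have e : (1 / 2 : ℝ) ^ n = (1 + 1 / 2) ^ n * (1 / 3) ^ n := by rw [← mul_pow]; norm_num
    have := mul_le_mul_of_nonneg_right b (show (0 : ℝ) ≤ (1 / 3) ^ n by positivity)
    rw [← e] at this
    have h3 : (0 : ℝ) ≤ (1 / 3) ^ n := by positivity
    linarith
  have hsx : (16 : ℝ) ^ (3000 * N) * ((1 / 2 : ℝ) ^ N) ^ 12000 = 1 := by
    have e : ((1 / 2 : ℝ) ^ N) ^ 12000 = ((1 / 2) ^ 4) ^ (3000 * N) := by
      rw [← pow_mul, ← pow_mul]; congr 1; ring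
    rw [e, ← mul_pow]; norm_num
  have hkN : 3000 * N ≤ 2 ^ (12 * N) := by
    rw [pow_mul]
    have : ∀ M : ℕ, 1 ≤ M → 3000 * M ≤ (2 ^ 12) ^ M := by
      intro M hM
      induction M, hM using Nat.le_induction with
      | base => norm_num
      | succ M h ih => rw [pow_succ]; omega
    exact this N hN
  have hk : ((3000 * N : ℕ) : ℝ) * ((1 / 2 : ℝ) ^ N) ^ 12 ≤ 1 := by
    have h : ((3000 * N : ℕ) : ℝ) ≤ 2 ^ (12 * N) := by exact_mod_cast hkN
    have e : (2 : ℝ) ^ (12 * N) * ((1 / 2 : ℝ) ^ N) ^ 12 = 1 := by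
      rw [← pow_mul, mul_comm N 12, ← mul_pow]; norm_num
    exact (mul_le_mul_of_nonneg_right h (by positivity)).trans_eq e
  have hpow : ∀ a b : ℕ, a ≤ b → (2 : ℕ) ^ a ≤ 2 ^ b := fun a b h => Nat.pow_le_pow_right (by norm_num) h
  have hlt : (2 / 3 : ℝ) ^ (20000 * N) < (1 / 2) ^ (3000 * N + 1) := by
    have h1 : (2 / 3 : ℝ) ^ (20000 * N) ≤ ((1 / 2 : ℝ) ^ N) ^ 10000 :=
      half_pow_le (by norm_num) (q := 2) (by norm_num) (by ring)
    rw [← pow_mul] at h1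
    exact h1.trans_lt (pow_lt_pow_right_of_lt_one₀ (by norm_num) (by norm_num) (by omega))
  have hκ2 : 4 * (3000 * N) < 2 ^ (20000 * N + 1) := by
    have h1 := hpow (12 * N + 3) (20000 * N + 1) (by omega)
    have h2 : (2 : ℕ) ^ (12 * N + 3) = 8 * 2 ^ (12 * N) := by rw [pow_add]; ring
    omega
  have hI : ∀ I : ℕ, (I : ℝ) * ((1 / 2 : ℝ) ^ N) ^ 12200 ≤ ((3000 * N : ℕ) : ℝ) →
      I + 2 * (3000 * N) < 2 ^ (20000 * N + 1) := by
    intro I h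
    have h1 : (I : ℝ) ≤ ((3000 * N : ℕ) : ℝ) * 2 ^ (12200 * N) := by
      have e : ((1 / 2 : ℝ) ^ N) ^ 12200 * 2 ^ (12200 * N) = 1 := by
        rw [← pow_mul, mul_comm N 12200, ← mul_pow]; norm_num
      have := mul_le_mul_of_nonneg_right h (show (0 : ℝ) ≤ 2 ^ (12200 * N) by positivity)
      rwa [mul_assoc, e, mul_one] at this
    have h2 : I ≤ 3000 * N * 2 ^ (12200 * N) := by exact_mod_cast h1
    have h3 : 3000 * N * 2 ^ (12200 * N) ≤ 2 ^ (12212 * N) := by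
      calc 3000 * N * 2 ^ (12200 * N) ≤ 2 ^ (12 * N) * 2 ^ (12200 * N) := Nat.mul_le_mul_right _ hkN
        _ = 2 ^ (12212 * N) := by rw [← pow_add]; congr 1; ring
    have h4 := hpow (12212 * N + 3) (20000 * N + 1) (by omega)
    have h5 : (2 : ℕ) ^ (12212 * N + 3) = 8 * 2 ^ (12212 * N) := by rw [pow_add]; ring
    have h6 := hpow (12 * N) (12212 * N) (by omega)
    omega
  have hl : (1 / 3 : ℝ) ^ (3000 * N + 1) ≤ (((1 / 2 : ℝ) ^ N) ^ 18) ^ 2 := by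
    rw [← pow_mul]
    exact (pow_le_pow_of_le_one (by norm_num) (by norm_num) (by omega)).trans
      (half_pow_le (by norm_num) (q := 1) (j := 18 * 2) (by norm_num) (M := 36 * N) (by ring))
  have h0 : 0 < (1 / 2 : ℝ) ^ N := by positivity
  have h1 : (1 / 2 : ℝ) ^ N ≤ 1 / 2 := by
    simpa using pow_le_pow_of_le_one (a := (1 / 2 : ℝ)) (by norm_num) (by norm_num) hN
  generalize (1 / 2 : ℝ) ^ N = y at *
  have hε := num_eps h0 h1 (Nat.cast_nonneg _) hk hthn hnuk hr2 hnr hr1 hsx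
  refine (num_m h0 h1).trans ?_
  exact main_abs (n := 20000 * N) (by omega) (by omega) (by omega) hlt hκ2 hΛ hmin hA hB
    (pow_pos h0 _) hI hdis hmA hmB (pow_pos h0 90) (pow_pos h0 21)
    (pow_le_one₀ h0.le (by linarith)) (pow_pos h0 20) hε (num_e h0 h1)
    ((yp h0 h1 (show 1 ≤ 19 by norm_num)).trans (by rw [pow_one])) (pow_pos h0 18).le hl

end
end S5

open scoped BigOperators
set_option linter.unusedVariables false
set_option linter.unusedSectionVars false
namespace S5
open Finset
section
variable {r : ℕ}

lemma card_poly (r D : ℕ) : (polyFinset r D).card = Fintype.card (P r D) :=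
  (Fintype.card_of_subtype (polyFinset r D) (fun x => mem_polyFinset)).symm

lemma sum_poly {E : Type*} [AddCommMonoid E] (r D : ℕ) (F : Fn r → E) :
    ∑ f ∈ polyFinset r D, F f = ∑ f : P r D, F f :=
  Finset.sum_subtype (polyFinset r D) (fun x => mem_polyFinset) F

lemma expP_eq (D : ℕ) (F : Fn r → ℝ) : expP r D F = 𝔼 f : P r D, F f := by
  rw [expP, card_poly, sum_poly, Fintype.expect_eq_sum_div_card]

lemma fourierP_eq (D : ℕ) (F : Fn r → ℂ) (β : Fn r) : fourierP r D F β = hat (P r D) F β := by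
  rw [fourierP, card_poly, sum_poly, hat, Fintype.expect_eq_sum_div_card]

lemma Ix_le_infP {d k κ : ℕ} (hκk : κ ≤ k) (hκ : 2 * κ < 2 ^ (d + 1)) {Λ : Finset (Fn r)}
    (hΛ : Reps (P r (2 * d)) Λ)
    (hmin : ∀ β ∈ Λ, ∀ γ : Fn r, β - γ ∈ dl r (2 * d) → supp β ≤ supp γ) (A : Fn r → ℝ) (x : Pt r) :
    Ix (tc nu κ (P r (2 * d)) A) x ≤ infP r (2 * d) k Λ A x := by
  have n1 : nu ≤ 1 := nu_le.trans (by norm_num)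
  unfold Ix infA infP
  rw [tc_sum hκ hΛ hmin _ (fun β h => by rw [tc_zero h]; simp), sum_filter]
  refine sum_le_sum fun β _ => ?_
  by_cases h1 : β x ≠ 0
  · rw [ind_true h1, one_mul]
    by_cases h2 : supp β ≤ κ
    · rw [if_pos ⟨h1, h2.trans hκk⟩, fourierP_eq]
      exact tc_norm nu_nonneg n1 β
    · rw [tc_zero (not_le.1 h2)]
      split_ifs <;> simp
  · rw [ind_false h1, zero_mul]
    split_ifs <;> positivity

/-- correlation with the shift by `a (p^2+1)` -/
noncomputable def GG (d : ℕ) (A B : Fn r → ℝ) (a : F3) : ℝ :=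
  𝔼 f : P r (2 * d), A f * 𝔼 p : P r d, B ((f : Fn r) + shift (p : Fn r) a)

lemma GG_nonneg {d : ℕ} {A B : Fn r → ℝ} (hA : ∀ f ∈ P r (2 * d), 0 ≤ A f ∧ A f ≤ 1)
    (hB : ∀ f ∈ P r (2 * d), 0 ≤ B f ∧ B f ≤ 1) (a : F3) : 0 ≤ GG d A B a :=
  expect_nonneg' fun f => mul_nonneg (hA f f.2).1
    (expect_nonneg' fun p => (hB _ (add_mem f.2 (shift_mem p.2 a))).1)

lemma GG_eq {d : ℕ} (A B : Fn r → ℝ) (a : F3) :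
    GG d A B a = 𝔼 p : P r d, 𝔼 f : P r (2 * d), A f * B ((f : Fn r) + shift (p : Fn r) a) := by
  unfold GG
  rw [expect_comm]
  exact expect_congr rfl fun f _ => mul_expect _ _ _

lemma GG_triv {d : ℕ} {A B : Fn r → ℝ} (hA : ∀ f ∈ P r (2 * d), 0 ≤ A f ∧ A f ≤ 1)
    (hB : ∀ f ∈ P r (2 * d), 0 ≤ B f ∧ B f ≤ 1) (a : F3) :
    (𝔼 f : P r (2 * d), A f) + (𝔼 f : P r (2 * d), B f) - 1 ≤ GG d A B a := by
  rw [GG_eq]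
  have key : ∀ p : P r d, (𝔼 f : P r (2 * d), A f) + (𝔼 f : P r (2 * d), B f) - 1 ≤
      𝔼 f : P r (2 * d), A f * B ((f : Fn r) + shift (p : Fn r) a) := by
    intro p
    have h1 := expect_trans (shift_mem p.2 a) B
    have h2 : 𝔼 f : P r (2 * d), (A f + B ((f : Fn r) + shift (p : Fn r) a) - 1) =
        (𝔼 f : P r (2 * d), A f) + (𝔼 f : P r (2 * d), B f) - 1 := by
      rw [expect_sub_distrib, expect_add_distrib, h1, Fintype.expect_const]
    rw [← h2]
    refine expect_le_expect fun f _ => ?_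
    have a1 := hA f f.2
    have b1 := hB _ (add_mem f.2 (shift_mem p.2 a))
    nlinarith [mul_nonneg (sub_nonneg.2 a1.2) (sub_nonneg.2 b1.2)]
  calc (𝔼 f : P r (2 * d), A f) + (𝔼 f : P r (2 * d), B f) - 1
      = 𝔼 p : P r d, ((𝔼 f : P r (2 * d), A f) + (𝔼 f : P r (2 * d), B f) - 1) :=
        (Fintype.expect_const _).symm
    _ ≤ _ := expect_le_expect fun p _ => key p

lemma hyp_eq {d : ℕ} (A B : Fn r → ℝ) :
    (∑ f ∈ polyFinset r (2 * d), ∑ p ∈ polyFinset r d,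
        ∑ a ∈ ({1, 2} : Finset F3), A f * B (f + shift p a)) /
        (((polyFinset r (2 * d)).card : ℝ) * ((polyFinset r d).card : ℝ) * 2) =
      (GG d A B 1 + GG d A B 2) / 2 := by
  have h12 : (1 : F3) ≠ 2 := by decide
  have hG : ∀ a : F3, GG d A B a = (∑ f ∈ polyFinset r (2 * d), ∑ p ∈ polyFinset r d,
      A f * B (f + shift p a)) / (((polyFinset r (2 * d)).card : ℝ) * ((polyFinset r d).card : ℝ)) := by
    intro a
    unfold GG
    rw [card_poly, card_poly, sum_poly, Fintype.expect_eq_sum_div_card, mul_comm (Fintype.card (P r (2 * d)) : ℝ),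
      ← div_div]
    congr 1
    rw [sum_div]
    refine sum_congr rfl fun f _ => ?_
    rw [sum_poly r d (fun p => A (f : Fn r) * B ((f : Fn r) + shift p a)), ← mul_sum,
      Fintype.expect_eq_sum_div_card, mul_div_assoc]
  simp only [sum_pair h12, sum_add_distrib]
  rw [hG, hG, ← add_div, div_div]

theorem main :
    ∃ C : ℝ, 0 < C ∧
      ∀ μ : ℝ, 0 < μ → μ < 1 →
        ∀ k d : ℕ, k = ⌈C * Real.log (1 / μ)⌉₊ → d = ⌈C * Real.log (1 / μ)⌉₊ →
          (k : ℝ) < (3 : ℝ) ^ ((2 * (d : ℝ) + 1) / 2) / 2 ∧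
          ∀ r : ℕ, d ≤ r →
            ∀ A B : Fn r → ℝ,
              (∀ f ∈ polyFinset r (2 * d), 0 ≤ A f ∧ A f ≤ 1) →
              (∀ f ∈ polyFinset r (2 * d), 0 ≤ B f ∧ B f ≤ 1) →
              μ < expP r (2 * d) A → μ < expP r (2 * d) B →
              (∑ f ∈ polyFinset r (2 * d), ∑ p ∈ polyFinset r d,
                  ∑ a ∈ ({1, 2} : Finset F3), A f * B (f + shift p a)) /
                  (((polyFinset r (2 * d)).card : ℝ) * ((polyFinset r d).card : ℝ) * 2)
                ≤ μ ^ C →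
              ∀ Λ : Finset (Fn r), IsMinRepSet r (2 * d) Λ →
                ∃ x : Pt r,
                  μ ^ C ≤ infP r (2 * d) k Λ A x ∧ μ ^ C ≤ infP r (2 * d) k Λ B x := by
  refine ⟨1000000, by norm_num, ?_⟩
  intro μ h0 h1 k d hk hd
  have hkd : k = d := hk.trans hd.symm
  subst hkd
  clear hk
  set L := Real.log (1 / μ) with hL
  have hL0 : 0 < L := Real.log_pos (one_lt_one_div h0 h1)
  constructor
  · have b := one_add_mul_le_pow (a := (2 : ℝ)) (by norm_num) k
    have h3 : (3 : ℝ) ^ k ≤ (3 : ℝ) ^ ((2 * (k : ℝ) + 1) / 2) := by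
      rw [← Real.rpow_natCast]
      exact Real.rpow_le_rpow_of_exponent_le (by norm_num) (by linarith)
    have e : (1 + 2 : ℝ) = 3 := by norm_num
    rw [e] at b
    linarith
  intro r hr A B hA hB hEA hEB hyp Λ hΛ
  simp only [mem_polyFinset] at hA hB
  rw [expP_eq] at hEA hEB
  rw [hyp_eq] at hyp
  by_cases hμ : 3 / 4 ≤ μ
  · exfalso
    have t1 := GG_triv hA hB 1
    have t2 := GG_triv hA hB 2
    have hp : μ ^ (1000000 : ℝ) ≤ 2 * μ - 1 := by
      have e1 : μ ^ (1000000 : ℝ) ≤ μ ^ (3 : ℝ) :=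
        Real.rpow_le_rpow_of_exponent_ge h0 h1.le (by norm_num)
      have e2 : μ ^ (3 : ℝ) = μ ^ 3 := by exact_mod_cast Real.rpow_natCast μ 3
      rw [e2] at e1
      refine e1.trans ?_
      nlinarith [mul_nonneg (sub_nonneg.2 h1.le) (show 0 ≤ μ ^ 2 + μ - 1 by nlinarith)]
    linarith
  · rw [not_le] at hμ
    have hL4 : 1 / 4 ≤ L := by
      have := Real.one_sub_inv_le_log_of_pos (show 0 < 1 / μ by positivity)
      rw [one_div, inv_inv] at this
      rw [hL, one_div μ]
      linarith
    set N := ⌈2 * L⌉₊ with hNdef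
    have hN2 : 2 * L ≤ N := Nat.le_ceil _
    have hN3 : (N : ℝ) < 2 * L + 1 := Nat.ceil_lt_add_one (by linarith)
    have hN1 : 1 ≤ N := Nat.one_le_ceil_iff.2 (by linarith)
    have hkC : 1000000 * L ≤ k := by rw [hd]; exact Nat.le_ceil _
    have hNk : 120000 * N ≤ k := by
      have : (120000 * N : ℝ) ≤ k := by linarith
      exact_mod_cast this
    have hμL : μ = Real.exp (-L) := by
      rw [hL, one_div, Real.log_inv, neg_neg, Real.exp_log h0]
    have hyμ : (1 / 2 : ℝ) ^ N ≤ μ := by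
      have e : (1 / 2 : ℝ) ^ N = Real.exp (-(N * Real.log 2)) := by
        rw [Real.exp_neg, mul_comm, Real.exp_mul, Real.exp_log (by norm_num), Real.rpow_natCast]
        simp
      rw [e, hμL]
      refine Real.exp_le_exp.2 (neg_le_neg ?_)
      have := Real.log_two_gt_d9
      nlinarith
    have hy0 : 0 < (1 / 2 : ℝ) ^ N := by positivity
    have hy1 : (1 / 2 : ℝ) ^ N ≤ 1 / 2 := by
      simpa using pow_le_pow_of_le_one (a := (1 / 2 : ℝ)) (by norm_num) (by norm_num) hN1
    have hδ : μ ^ (1000000 : ℝ) ≤ ((1 / 2 : ℝ) ^ N) ^ 120000 := by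
      have e : μ ^ (1000000 : ℝ) = Real.exp (-(1000000 * L)) := by
        rw [hμL, ← Real.exp_mul]; congr 1; ring
      have e2 : Real.exp (-1) ≤ 1 / 2 := by
        rw [Real.exp_neg, one_div]
        refine inv_anti₀ (by norm_num) ?_
        have := Real.exp_one_gt_d9
        linarith
      calc μ ^ (1000000 : ℝ) ≤ Real.exp (((120000 * N : ℕ) : ℝ) * (-1)) := by
            rw [e]
            refine Real.exp_le_exp.2 ?_
            push_cast
            linarith
        _ = Real.exp (-1) ^ (120000 * N) := Real.exp_nat_mul _ _
        _ ≤ ((1 / 2 : ℝ) ^ N) ^ 120000 :=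
            half_pow_le (Real.exp_pos _).le (q := 1) (by rw [pow_one]; exact e2) (by ring)
    have hδ1 : μ ^ (1000000 : ℝ) ≤ ((1 / 2 : ℝ) ^ N) ^ 12200 :=
      hδ.trans (yp hy0 hy1 (by norm_num))
    have hδ2 : 4 * μ ^ (1000000 : ℝ) ≤ ((1 / 2 : ℝ) ^ N) ^ 17 :=
      (mul_le_mul_of_nonneg_left hδ (by norm_num)).trans
        (yc hy0 hy1 (j := 2) (by norm_num) (by norm_num))
    have hΛ1 : Reps (P r (2 * k)) Λ := by
      intro β
      have := hΛ.1 β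
      simp only [mem_dualSet] at this
      exact this
    have hmin : ∀ β ∈ Λ, ∀ γ : Fn r, β - γ ∈ dl r (2 * k) → supp β ≤ supp γ :=
      fun β hβ γ h => hΛ.2 β hβ γ (mem_dualSet.2 h)
    have hκ : 2 * (3000 * N) < 2 ^ (k + 1) := by
      have h2 : k < 2 ^ k := Nat.lt_two_pow_self
      rw [pow_succ]
      omega
    have hκk : 3000 * N ≤ k := by omega
    by_contra hno
    have hmain := main_num hN1 hNk hΛ1 hmin hA hB (fun x hx => hno ⟨x,
        hδ1.trans (hx.1.trans (Ix_le_infP hκk hκ hΛ1 hmin A x)),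
        hδ1.trans (hx.2.trans (Ix_le_infP hκk hκ hΛ1 hmin B x))⟩)
      (hyμ.trans hEA.le) (hyμ.trans hEB.le)
    have hG2 := GG_nonneg hA hB 2
    have hG1 : ((1 / 2 : ℝ) ^ N) ^ 17 ≤ GG k A B 1 := hmain
    have hpos : 0 < μ ^ (1000000 : ℝ) := Real.rpow_pos_of_pos h0 _
    linarith

end
end S5

/-- Derandomized "majority is stablest" (Theorem 1.4): there is a universal `C > 0` such
that for `μ ∈ (0,1)`, `δ := μ^C`, `k = d := ⌈C·log(1/μ)⌉` (with `C` such that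
`k < 3^{(2d+1)/2}/2`), and all `r ≥ d`: if `A, B : P_{r,2d} → [0,1]` satisfy
`E[A] > μ`, `E[B] > μ` and `E[A(f)·B(f + a(p²+1))] ≤ δ`, then for every valid choice of
minimal-support representatives `Λ` there is an `x ∈ F₃^r` with
`Inf_x^{≤k}(A) ≥ δ` and `Inf_x^{≤k}(B) ≥ δ`. -/
theorem stmt5 :
    ∃ C : ℝ, 0 < C ∧
      ∀ μ : ℝ, 0 < μ → μ < 1 →
        ∀ k d : ℕ, k = ⌈C * Real.log (1 / μ)⌉₊ → d = ⌈C * Real.log (1 / μ)⌉₊ →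
          (k : ℝ) < (3 : ℝ) ^ ((2 * (d : ℝ) + 1) / 2) / 2 ∧
          ∀ r : ℕ, d ≤ r →
            ∀ A B : Fn r → ℝ,
              (∀ f ∈ polyFinset r (2 * d), 0 ≤ A f ∧ A f ≤ 1) →
              (∀ f ∈ polyFinset r (2 * d), 0 ≤ B f ∧ B f ≤ 1) →
              μ < expP r (2 * d) A → μ < expP r (2 * d) B →
              (∑ f ∈ polyFinset r (2 * d), ∑ p ∈ polyFinset r d,
                  ∑ a ∈ ({1, 2} : Finset F3), A f * B (f + shift p a)) /
                  (((polyFinset r (2 * d)).card : ℝ) * ((polyFinset r d).card : ℝ) * 2)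
                ≤ μ ^ C →
              ∀ Λ : Finset (Fn r), IsMinRepSet r (2 * d) Λ →
                ∃ x : Pt r,
                  μ ^ C ≤ infP r (2 * d) k Λ A x ∧ μ ^ C ≤ infP r (2 * d) k Λ B x := by
  exact S5.main
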